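/- Let a ≥ 2 be an integer and for a nonzero integer q set |q|_a = inf{a^{−n} : n ≥ 0 and a^n divides q}. Then the set of real numbers u for which liminf_{q→∞} q·|q|_a·⟨qu⟩ > 0 (the liminf taken over positive integers q) has Hausdorff dimension zero. -/

import Mathlib

/-- `nearestIntDist z` is the distance from `z` to the nearest integer, denoted ⟨z⟩. -/
noncomputable def nearestIntDist (z : ℝ) : ℝ := ⨅ k : ℤ, |z - (k : ℝ)|

/-- The `a`-adic pseudo-valuation `|q|_a = inf {a^{-n} : n ≥ 0, aⁿ ∣ q}` of an integer. -/
noncomputable def aAdicNorm (a : ℕ) (q : ℤ) : ℝ :=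
  sInf {x : ℝ | ∃ n : ℕ, (a : ℤ) ^ n ∣ q ∧ x = ((a : ℝ) ^ n)⁻¹}

namespace PAdicLittlewood

open Matrix Matrix.SpecialLinearGroup

/-- `y` is badly approximable with constant `ε`. -/
def Bad (ε y : ℝ) : Prop := ∀ q : ℤ, 0 < q → ∀ r : ℤ, ε ≤ q * |q * y - r|

/-- The two elementary unipotent matrices driving the Farey descent. -/
def letterMat : Bool → SpecialLinearGroup (Fin 2) ℤ
  | true => ⟨!![1, 1; 0, 1], by simp [Matrix.det_fin_two]⟩
  | false => ⟨!![1, 0; 1, 1], by simp [Matrix.det_fin_two]⟩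

/-- The columns of `B` are the endpoints of a Farey interval around `y`, right endpoint first. -/
structure IsFrame (B : SpecialLinearGroup (Fin 2) ℤ) (y : ℝ) : Prop where
  right_pos : 0 < B 1 0
  left_pos : 0 < B 1 1
  left_lt : 0 < (B 1 1 : ℝ) * y - B 0 1
  lt_right : 0 < (B 0 0 : ℝ) - B 1 0 * y

/-- `true` when the mediant of the interval `B` lies to the left of `y`. -/
noncomputable def nextLetter (y : ℝ) (B : SpecialLinearGroup (Fin 2) ℤ) : Bool :=
  open Classical in decide (0 < ((B 1 0 : ℝ) + B 1 1) * y - (B 0 0 + B 0 1))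

/-- The `n`-th Farey interval around `y`. -/
noncomputable def frame (y : ℝ) : ℕ → SpecialLinearGroup (Fin 2) ℤ
  | 0 => ⟨!![⌊y⌋ + 1, ⌊y⌋; 1, 1], by simp [Matrix.det_fin_two]⟩
  | n + 1 => frame y n * letterMat (nextLetter y (frame y n))

/-- The `n`-th letter of the Farey expansion of `y`. -/
noncomputable def letter (y : ℝ) (n : ℕ) : Bool := nextLetter y (frame y n)

theorem frame_succ (y : ℝ) (n : ℕ) : frame y (n + 1) = frame y n * letterMat (letter y n) := rfl

section entries

variable (B C : SpecialLinearGroup (Fin 2) ℤ)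

theorem mul_entry (i j : Fin 2) : (B * C) i j = B i 0 * C 0 j + B i 1 * C 1 j := by
  simp [Matrix.mul_apply, Fin.sum_univ_two]

theorem det_entry : B 0 0 * B 1 1 - B 0 1 * B 1 0 = 1 := by
  have := B.det_coe
  rwa [Matrix.det_fin_two] at this

theorem det_entry_real : (B 0 0 : ℝ) * B 1 1 - B 0 1 * B 1 0 = 1 := by
  exact_mod_cast det_entry B

@[simp] theorem inv_entry_zero_zero : B⁻¹ 0 0 = B 1 1 := by
  simp [Matrix.adjugate_fin_two]

@[simp] theorem inv_entry_zero_one : B⁻¹ 0 1 = -B 0 1 := by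
  simp [Matrix.adjugate_fin_two]

@[simp] theorem inv_entry_one_zero : B⁻¹ 1 0 = -B 1 0 := by
  simp [Matrix.adjugate_fin_two]

@[simp] theorem inv_entry_one_one : B⁻¹ 1 1 = B 0 0 := by
  simp [Matrix.adjugate_fin_two]

theorem ext_entry (h00 : B 0 0 = C 0 0) (h01 : B 0 1 = C 0 1) (h10 : B 1 0 = C 1 0)
    (h11 : B 1 1 = C 1 1) : B = C := by
  ext i j
  fin_cases i <;> fin_cases j <;> assumption

theorem mul_letter_true_zero (i : Fin 2) : (B * letterMat true) i 0 = B i 0 := by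
  rw [mul_entry]; simp [letterMat]

theorem mul_letter_true_one (i : Fin 2) : (B * letterMat true) i 1 = B i 0 + B i 1 := by
  rw [mul_entry]; simp [letterMat]

theorem mul_letter_false_zero (i : Fin 2) : (B * letterMat false) i 0 = B i 0 + B i 1 := by
  rw [mul_entry]; simp [letterMat]

theorem mul_letter_false_one (i : Fin 2) : (B * letterMat false) i 1 = B i 1 := by
  rw [mul_entry]; simp [letterMat]

end entries

theorem Bad.mul_sub_ne {ε y : ℝ} (hε : 0 < ε) (h : Bad ε y) {q : ℤ} (hq : 0 < q) (r : ℤ) :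
    (q : ℝ) * y - r ≠ 0 := by
  intro h0
  have := h q hq r
  rw [h0] at this
  simp at this
  linarith

section frames

variable {ε y : ℝ} {B : SpecialLinearGroup (Fin 2) ℤ}

theorem IsFrame.mul_letter (hB : IsFrame B y) (hε : 0 < ε) (h : Bad ε y) :
    IsFrame (B * letterMat (nextLetter y B)) y := by
  obtain ⟨h1, h2, h3, h4⟩ := hB
  have hne := h.mul_sub_ne hε (add_pos h1 h2) (B 0 0 + B 0 1)
  push_cast at hne
  by_cases hm : 0 < ((B 1 0 : ℝ) + B 1 1) * y - (B 0 0 + B 0 1)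
  · have : nextLetter y B = true := by simpa [nextLetter] using hm
    rw [this]
    constructor <;> simp only [mul_letter_true_zero, mul_letter_true_one] <;> push_cast <;>
      first | assumption | positivity
  · have : nextLetter y B = false := by simpa [nextLetter] using hm
    rw [this]
    constructor <;> simp only [mul_letter_false_zero, mul_letter_false_one] <;> push_cast <;>
      first | assumption | positivity | skip
    rcases lt_or_gt_of_ne hne with h | h
    · linarith
    · exact absurd h hm

theorem nextLetter_eq_of_isFrame {b : Bool} (hB : IsFrame (B * letterMat b) y) :
    nextLetter y B = b := by
  cases b
  · have := hB.lt_right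
    simp only [mul_letter_false_zero] at this
    push_cast at this
    simp only [nextLetter, decide_eq_false_iff_not, not_lt]
    linarith
  · have := hB.left_lt
    simp only [mul_letter_true_one] at this
    push_cast at this
    simp only [nextLetter, decide_eq_true_eq]
    linarith

theorem isFrame_frame (hε : 0 < ε) (h : Bad ε y) (n : ℕ) : IsFrame (frame y n) y := by
  induction n with
  | zero =>
    have hne := h.mul_sub_ne hε one_pos ⌊y⌋
    have h1 := Int.floor_le y
    have h2 := Int.lt_floor_add_one y
    have h3 : (⌊y⌋ : ℝ) < y := lt_of_le_of_ne h1 (fun h => hne (by push_cast; linarith))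
    constructor <;> simp [frame, -Int.self_sub_floor] <;> linarith
  | succ n ih => exact ih.mul_letter hε h

theorem frame_succ_eq_of_isFrame {n : ℕ} {b : Bool} (hB : frame y n = B)
    (h : IsFrame (B * letterMat b) y) : frame y (n + 1) = B * letterMat b := by
  rw [frame_succ, letter, hB, nextLetter_eq_of_isFrame h]

theorem IsFrame.exists_frame_eq (hB : IsFrame B y) : ∃ n, frame y n = B := by
  obtain ⟨k, hk⟩ : ∃ k : ℕ, B 1 0 + B 1 1 ≤ k := ⟨(B 1 0 + B 1 1).toNat, Int.self_le_toNat _⟩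
  induction k generalizing B with
  | zero =>
    have := hB.right_pos
    have := hB.left_pos
    simp at hk
    omega
  | succ k ih =>
    have hdet := det_entry B
    have hdet' := det_entry_real B
    obtain ⟨h1, h2, h3, h4⟩ := hB
    have h1' : (0 : ℝ) < B 1 0 := by exact_mod_cast h1
    have h2' : (0 : ℝ) < B 1 1 := by exact_mod_cast h2
    rcases lt_trichotomy (B 1 0) (B 1 1) with hlt | heq | hgt
    · set C := B * (letterMat true)⁻¹ with hC
      have hCB : C * letterMat true = B := by simp [hC]
      have e0 : ∀ i, B i 0 = C i 0 := fun i => by rw [← hCB, mul_letter_true_zero]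
      have e1 : ∀ i, B i 1 = C i 0 + C i 1 := fun i => by rw [← hCB, mul_letter_true_one]
      simp only [e0, e1] at h1 h2 h3 h4 hlt hk
      push_cast at h3
      have hCf : IsFrame C y := ⟨h1, by omega, by linarith, h4⟩
      obtain ⟨n, hn⟩ := ih hCf (by push_cast at hk; omega)
      refine ⟨n + 1, ?_⟩
      rw [← hCB]
      apply frame_succ_eq_of_isFrame hn
      rw [hCB]
      constructor <;> simp only [e0, e1] <;> push_cast <;> assumption
    · refine ⟨0, ?_⟩
      rw [heq] at hdet
      have hq : B 1 1 = 1 := by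
        have : B 1 1 ∣ 1 := ⟨B 0 0 - B 0 1, by linarith⟩
        exact Int.eq_one_of_dvd_one h2.le this
      have hq' : B 1 0 = 1 := heq.trans hq
      rw [hq] at hdet h3
      rw [hq'] at h4
      have hr : B 0 0 = B 0 1 + 1 := by linarith
      have hfl : ⌊y⌋ = B 0 1 := by
        rw [Int.floor_eq_iff]
        rw [hr] at h4
        push_cast at *
        constructor <;> linarith
      apply ext_entry <;> simp [frame, hfl, hr, hq, hq']
    · set C := B * (letterMat false)⁻¹ with hC
      have hCB : C * letterMat false = B := by simp [hC]
      have e0 : ∀ i, B i 1 = C i 1 := fun i => by rw [← hCB, mul_letter_false_one]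
      have e1 : ∀ i, B i 0 = C i 0 + C i 1 := fun i => by rw [← hCB, mul_letter_false_zero]
      simp only [e0, e1] at h1 h2 h3 h4 hgt hk
      push_cast at h4
      have hCf : IsFrame C y := ⟨by omega, h2, h3, by linarith⟩
      obtain ⟨n, hn⟩ := ih hCf (by push_cast at hk; omega)
      refine ⟨n + 1, ?_⟩
      rw [← hCB]
      apply frame_succ_eq_of_isFrame hn
      rw [hCB]
      constructor <;> simp only [e0, e1] <;> push_cast <;> assumption

/-- The length of the Farey interval `B`. -/
noncomputable def len (B : SpecialLinearGroup (Fin 2) ℤ) : ℝ := 1 / ((B 1 0 : ℝ) * B 1 1)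

theorem IsFrame.len_pos (hB : IsFrame B y) : 0 < len B := by
  have h1 : (0 : ℝ) < B 1 0 := by exact_mod_cast hB.right_pos
  have h2 : (0 : ℝ) < B 1 1 := by exact_mod_cast hB.left_pos
  unfold len
  positivity

theorem IsFrame.det_form (_ : IsFrame B y) :
    (B 1 1 : ℝ) * (B 0 0 - B 1 0 * y) + B 1 0 * (B 1 1 * y - B 0 1) = 1 := by
  linarith [det_entry_real B]

theorem IsFrame.le_left (hB : IsFrame B y) (h : Bad ε y) :
    ε ≤ B 1 1 * ((B 1 1 : ℝ) * y - B 0 1) := by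
  simpa [abs_of_pos hB.left_lt] using h _ hB.left_pos (B 0 1)

theorem IsFrame.le_right (hB : IsFrame B y) (h : Bad ε y) :
    ε ≤ B 1 0 * ((B 0 0 : ℝ) - B 1 0 * y) := by
  have := h _ hB.right_pos (B 0 0)
  rwa [abs_sub_comm, abs_of_pos hB.lt_right] at this

theorem IsFrame.ratio_le (hB : IsFrame B y) (h : Bad ε y) :
    ε * B 1 0 ≤ B 1 1 := by
  have h1 : (0 : ℝ) < B 1 0 := by exact_mod_cast hB.right_pos
  have h2 : (0 : ℝ) < B 1 1 := by exact_mod_cast hB.left_pos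
  have h3 := hB.left_lt
  have h4 := hB.lt_right
  have h5 := hB.det_form
  have h6 := hB.le_left h
  nlinarith [mul_pos h2 h4]

theorem IsFrame.ratio_le' (hB : IsFrame B y) (h : Bad ε y) :
    ε * B 1 1 ≤ B 1 0 := by
  have h1 : (0 : ℝ) < B 1 0 := by exact_mod_cast hB.right_pos
  have h2 : (0 : ℝ) < B 1 1 := by exact_mod_cast hB.left_pos
  have h3 := hB.left_lt
  have h4 := hB.lt_right
  have h5 := hB.det_form
  have h6 := hB.le_right h
  nlinarith [mul_pos h1 h3]

/-- The contraction constant attached to the badness constant `ε`. -/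
noncomputable def contr (ε : ℝ) : ℝ := ε / (1 + ε)

theorem contr_pos (hε : 0 < ε) : 0 < contr ε := by unfold contr; positivity

theorem contr_lt_one (hε : 0 < ε) : contr ε < 1 := by
  unfold contr; rw [div_lt_one (by positivity)]; linarith

theorem len_mul_letter_bounds (hε : 0 < ε) (hB : IsFrame B y) (h : Bad ε y) (b : Bool) :
    contr ε * len B ≤ len (B * letterMat b) ∧
      len (B * letterMat b) ≤ (1 - contr ε) * len B := by
  have h1 : (0 : ℝ) < B 1 0 := by exact_mod_cast hB.right_pos
  have h2 : (0 : ℝ) < B 1 1 := by exact_mod_cast hB.left_pos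
  have h3 := hB.ratio_le h
  have h4 := hB.ratio_le' h
  have e1 : 1 - contr ε = 1 / (1 + ε) := by unfold contr; field_simp; ring
  have e2 : contr ε = ε / (1 + ε) := rfl
  rw [e1, e2]
  unfold len
  cases b
  · simp only [mul_letter_false_zero, mul_letter_false_one]
    push_cast
    constructor
    · rw [div_mul_div_comm, div_le_div_iff₀ (by positivity) (by positivity)]
      nlinarith [mul_pos h1 h2]
    · rw [div_mul_div_comm, div_le_div_iff₀ (by positivity) (by positivity)]
      nlinarith [mul_pos h1 h2]
  · simp only [mul_letter_true_zero, mul_letter_true_one]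
    push_cast
    constructor
    · rw [div_mul_div_comm, div_le_div_iff₀ (by positivity) (by positivity)]
      nlinarith [mul_pos h1 h2]
    · rw [div_mul_div_comm, div_le_div_iff₀ (by positivity) (by positivity)]
      nlinarith [mul_pos h1 h2]

theorem len_frame_add_bounds (hε : 0 < ε) (h : Bad ε y) (n k : ℕ) :
    contr ε ^ k * len (frame y n) ≤ len (frame y (n + k)) ∧
      len (frame y (n + k)) ≤ (1 - contr ε) ^ k * len (frame y n) := by
  have h0 := contr_pos hε
  have h1 := contr_lt_one hε
  induction k with
  | zero => simp
  | succ k ih =>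
    have hb := len_mul_letter_bounds hε (isFrame_frame hε h (n + k)) h (letter y (n + k))
    rw [← frame_succ, add_assoc] at hb
    constructor
    · calc contr ε ^ (k + 1) * len (frame y n) = contr ε * (contr ε ^ k * len (frame y n)) := by ring
        _ ≤ contr ε * len (frame y (n + k)) := by gcongr; exact ih.1
        _ ≤ _ := hb.1
    · calc len (frame y (n + (k + 1))) ≤ (1 - contr ε) * len (frame y (n + k)) := hb.2
        _ ≤ (1 - contr ε) * ((1 - contr ε) ^ k * len (frame y n)) := by
          apply mul_le_mul_of_nonneg_left ih.2; linarith
        _ = _ := by ring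

theorem len_frame_zero (y : ℝ) : len (frame y 0) = 1 := by simp [len, frame]

theorem len_frame_bounds (hε : 0 < ε) (h : Bad ε y) (n : ℕ) :
    contr ε ^ n ≤ len (frame y n) ∧ len (frame y n) ≤ (1 - contr ε) ^ n := by
  simpa [len_frame_zero] using len_frame_add_bounds hε h 0 n

end frames

section gap

variable {ε y y' : ℝ} {B : SpecialLinearGroup (Fin 2) ℤ}

/-- The lattice gap constant attached to the badness constant `ε`. -/
noncomputable def gap (ε : ℝ) : ℝ := ε ^ 2 / (2 + 2 * ε)

theorem gap_pos (hε : 0 < ε) : 0 < gap ε := by unfold gap; positivity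

/-- Short integer vectors cannot pair to `0` modulo `A` with the top row of a frame. -/
theorem gap_mul_le_sq (hε : 0 < ε) (hε1 : ε ≤ 1) {A : ℕ} (hA : 0 < A) (hy : y = A * y')
    (h : Bad ε y) (h' : Bad ε y') (hB : IsFrame B y) {w₁ w₂ : ℤ} (hw : w₁ ≠ 0 ∨ w₂ ≠ 0)
    (hdvd : (A : ℤ) ∣ B 0 0 * w₁ + B 0 1 * w₂) {M : ℝ} (h₁ : |(w₁ : ℝ)| ≤ M)
    (h₂ : |(w₂ : ℝ)| ≤ M) : gap ε * A ≤ M ^ 2 := by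
  obtain ⟨R, hR⟩ := hdvd
  have hq' : (1 : ℝ) ≤ B 1 0 := by exact_mod_cast hB.right_pos
  have hq : (1 : ℝ) ≤ B 1 1 := by exact_mod_cast hB.left_pos
  have hl := hB.left_lt
  have hr := hB.lt_right
  have hdet := hB.det_form
  have hra := hB.ratio_le h
  have hra' := hB.ratio_le' h
  set l : ℝ := B 1 1 * y - B 0 1 with hldef
  set l' : ℝ := B 0 0 - B 1 0 * y with hl'def
  have hAr : (0 : ℝ) < A := by exact_mod_cast hA
  have hM : 0 ≤ M := (abs_nonneg _).trans h₁
  have hRr : (B 0 0 : ℝ) * w₁ + B 0 1 * w₂ = A * R := by exact_mod_cast hR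
  set Q : ℤ := B 1 0 * w₁ + B 1 1 * w₂ with hQ
  have hQr : (Q : ℝ) = B 1 0 * w₁ + B 1 1 * w₂ := by rw [hQ]; push_cast; ring
  have key : (A : ℝ) * (Q * y' - R) = w₂ * l - w₁ * l' := by
    calc (A : ℝ) * (Q * y' - R) = Q * (A * y') - A * R := by ring
      _ = _ := by rw [← hy, ← hRr, hQr, hldef, hl'def]; ring
  have hlin : |(w₂ : ℝ) * l - w₁ * l'| ≤ M * (l + l') := by
    calc |(w₂ : ℝ) * l - w₁ * l'| ≤ |(w₂ : ℝ) * l| + |w₁ * l'| := abs_sub _ _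
      _ = |(w₂ : ℝ)| * l + |(w₁ : ℝ)| * l' := by rw [abs_mul, abs_mul, abs_of_pos hl, abs_of_pos hr]
      _ ≤ M * l + M * l' := by gcongr
      _ = _ := by ring
  have hgap : gap ε = ε ^ 2 / (2 + 2 * ε) := rfl
  have hM1 : 1 ≤ M := by
    rcases hw with hw | hw
    · refine le_trans ?_ h₁
      exact_mod_cast Int.one_le_abs hw
    · refine le_trans ?_ h₂
      exact_mod_cast Int.one_le_abs hw
  rcases eq_or_ne Q 0 with hQ0 | hQ0
  · have hR0 : R ≠ 0 := by
      rintro rfl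
      have hd := det_entry B
      simp only [mul_zero] at hR
      rw [hQ0] at hQ
      rcases hw with hw | hw
      · apply hw; linear_combination (-w₁) * hd + B 1 1 * hR + B 0 1 * hQ
      · apply hw; linear_combination (-w₂) * hd - B 1 0 * hR - B 0 0 * hQ
    have hR1 : (1 : ℝ) ≤ |(R : ℝ)| := by exact_mod_cast Int.one_le_abs hR0
    have hAle : (A : ℝ) ≤ M * (l + l') := by
      refine le_trans ?_ hlin
      rw [← key, hQ0]
      simp only [Int.cast_zero, zero_mul, zero_sub, abs_mul, abs_neg, abs_of_pos hAr]
      nlinarith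
    have hl1 : l + l' ≤ 2 := by nlinarith
    have h1 : (A : ℝ) ≤ 2 * M := by nlinarith
    have h2 : gap ε ≤ 1 / 2 := by
      rw [hgap, div_le_div_iff₀ (by positivity) (by positivity)]; nlinarith
    nlinarith [gap_pos hε]
  · have hb : ε ≤ |(Q : ℝ)| * |(Q : ℝ) * y' - R| := by
      rcases lt_or_gt_of_ne hQ0 with hneg | hpos
      · have := h' (-Q) (by omega) (-R)
        rw [abs_of_neg (by exact_mod_cast hneg : (Q : ℝ) < 0)]
        push_cast at this
        rwa [show (-(Q : ℝ)) * y' - -R = -(Q * y' - R) by ring, abs_neg] at this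
      · have := h' Q hpos R
        rwa [abs_of_pos (by exact_mod_cast hpos : (0 : ℝ) < Q)]
    have hQM : |(Q : ℝ)| ≤ M * (B 1 0 + B 1 1) := by
      rw [hQr]
      calc |(B 1 0 : ℝ) * w₁ + B 1 1 * w₂| ≤ |(B 1 0 : ℝ) * w₁| + |(B 1 1 : ℝ) * w₂| := abs_add_le _ _
        _ = B 1 0 * |(w₁ : ℝ)| + B 1 1 * |(w₂ : ℝ)| := by
          rw [abs_mul, abs_mul, abs_of_pos (by linarith : (0 : ℝ) < B 1 0),
            abs_of_pos (by linarith : (0 : ℝ) < B 1 1)]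
        _ ≤ B 1 0 * M + B 1 1 * M := by gcongr
        _ = _ := by ring
    have h1 : ε * A ≤ M * (B 1 0 + B 1 1) * (M * (l + l')) := by
      calc ε * A ≤ |(Q : ℝ)| * |(Q : ℝ) * y' - R| * A := by gcongr
        _ = |(Q : ℝ)| * |(A : ℝ) * (Q * y' - R)| := by rw [abs_mul, abs_of_pos hAr]; ring
        _ ≤ _ := by rw [key]; gcongr
    have h2 : ε * ((B 1 0 + B 1 1) * (l + l')) ≤ 1 + ε := by
      linarith [congrArg (ε * ·) hdet, mul_le_mul_of_nonneg_right hra hr.le,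
        mul_le_mul_of_nonneg_right hra' hl.le]
    rw [hgap, div_mul_eq_mul_div, div_le_iff₀ (by positivity)]
    have hM2 : 0 ≤ M ^ 2 := sq_nonneg M
    have h3 : 0 ≤ M ^ 2 * (1 + ε) := by positivity
    linarith [mul_le_mul_of_nonneg_left h1 hε.le, mul_le_mul_of_nonneg_left h2 hM2]

end gap

section rows

variable {ε y : ℝ} {A : ℕ} {B B' : SpecialLinearGroup (Fin 2) ℤ}

/-- The interval `B` is contained in `A` times the interval `B'`. -/
def Contains (A : ℕ) (B' B : SpecialLinearGroup (Fin 2) ℤ) : Prop :=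
  A * B' 0 1 * B 1 1 ≤ B' 1 1 * B 0 1 ∧ B' 1 0 * B 0 0 ≤ A * B' 0 0 * B 1 0

/-- `A` times the interval `B'` is contained in the interval `B`. -/
def Within (A : ℕ) (B' B : SpecialLinearGroup (Fin 2) ℤ) : Prop :=
  B 0 1 * B' 1 1 ≤ A * B' 0 1 * B 1 1 ∧ A * B' 0 0 * B 1 0 ≤ B 0 0 * B' 1 0

theorem sq_mul_len_le_left (hε : 0 < ε) (hB : IsFrame B y) (h : Bad ε y) :
    ε ^ 2 * len B ≤ y - B 0 1 / B 1 1 := by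
  have h1 : (0 : ℝ) < B 1 0 := by exact_mod_cast hB.right_pos
  have h2 : (0 : ℝ) < B 1 1 := by exact_mod_cast hB.left_pos
  have h3 := hB.le_left h
  have h4 := hB.ratio_le' h
  have e : y - B 0 1 / B 1 1 = (B 1 1 * (B 1 1 * y - B 0 1)) / (B 1 1 * B 1 1 : ℝ) := by field_simp
  rw [e, len, mul_one_div, div_le_div_iff₀ (by positivity) (by positivity)]
  nlinarith [mul_pos h1 h2, mul_pos h2 h2, mul_pos hε h2]

theorem sq_mul_len_le_right (hε : 0 < ε) (hB : IsFrame B y) (h : Bad ε y) :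
    ε ^ 2 * len B ≤ B 0 0 / B 1 0 - y := by
  have h1 : (0 : ℝ) < B 1 0 := by exact_mod_cast hB.right_pos
  have h2 : (0 : ℝ) < B 1 1 := by exact_mod_cast hB.left_pos
  have h3 := hB.le_right h
  have h4 := hB.ratio_le h
  have e : B 0 0 / B 1 0 - y = (B 1 0 * (B 0 0 - B 1 0 * y)) / (B 1 0 * B 1 0 : ℝ) := by field_simp
  rw [e, len, mul_one_div, div_le_div_iff₀ (by positivity) (by positivity)]
  nlinarith [mul_pos h1 h2, mul_pos h1 h1, mul_pos hε h1]

theorem len_eq (hB : IsFrame B y) : len B = B 0 0 / B 1 0 - B 0 1 / B 1 1 := by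
  have h1 : (0 : ℝ) < B 1 0 := by exact_mod_cast hB.right_pos
  have h2 : (0 : ℝ) < B 1 1 := by exact_mod_cast hB.left_pos
  rw [len]
  field_simp
  linarith [det_entry_real B]

theorem left_lt_self (hB : IsFrame B y) : (B 0 1 : ℝ) / B 1 1 < y := by
  have h2 : (0 : ℝ) < B 1 1 := by exact_mod_cast hB.left_pos
  rw [div_lt_iff₀ h2]; linarith [hB.left_lt]

theorem self_lt_right (hB : IsFrame B y) : y < (B 0 0 : ℝ) / B 1 0 := by
  have h2 : (0 : ℝ) < B 1 0 := by exact_mod_cast hB.right_pos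
  rw [lt_div_iff₀ h2]; linarith [hB.lt_right]

theorem contains_iff {y' : ℝ} (hB : IsFrame B y) (hB' : IsFrame B' y') :
    Contains A B' B ↔ A * ((B' 0 1 : ℝ) / B' 1 1) ≤ B 0 1 / B 1 1 ∧
      (B 0 0 : ℝ) / B 1 0 ≤ A * (B' 0 0 / B' 1 0) := by
  have h1 : (0 : ℝ) < B 1 0 := by exact_mod_cast hB.right_pos
  have h2 : (0 : ℝ) < B 1 1 := by exact_mod_cast hB.left_pos
  have h3 : (0 : ℝ) < B' 1 0 := by exact_mod_cast hB'.right_pos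
  have h4 : (0 : ℝ) < B' 1 1 := by exact_mod_cast hB'.left_pos
  rw [← mul_div_assoc, ← mul_div_assoc, div_le_div_iff₀ h4 h2, div_le_div_iff₀ h1 h3,
    mul_comm (B 0 1 : ℝ), mul_comm (B 0 0 : ℝ)]
  unfold Contains
  exact_mod_cast Iff.rfl

theorem within_iff {y' : ℝ} (hB : IsFrame B y) (hB' : IsFrame B' y') :
    Within A B' B ↔ (B 0 1 : ℝ) / B 1 1 ≤ A * (B' 0 1 / B' 1 1) ∧
      A * ((B' 0 0 : ℝ) / B' 1 0) ≤ B 0 0 / B 1 0 := by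
  have h1 : (0 : ℝ) < B 1 0 := by exact_mod_cast hB.right_pos
  have h2 : (0 : ℝ) < B 1 1 := by exact_mod_cast hB.left_pos
  have h3 : (0 : ℝ) < B' 1 0 := by exact_mod_cast hB'.right_pos
  have h4 : (0 : ℝ) < B' 1 1 := by exact_mod_cast hB'.left_pos
  rw [← mul_div_assoc, ← mul_div_assoc, div_le_div_iff₀ h2 h4, div_le_div_iff₀ h3 h1]
  unfold Within
  exact_mod_cast Iff.rfl

variable {y' : ℝ}

theorem contains_of_len (hε : 0 < ε) (hy : y = A * y') (hB : IsFrame B y) (hB' : IsFrame B' y')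
    (h' : Bad ε y') (hlen : len B ≤ ε ^ 2 * (A * len B')) : Contains A B' B := by
  rw [contains_iff hB hB']
  have h1 := left_lt_self hB
  have h2 := self_lt_right hB
  have h3 := len_eq hB
  have hA : (0 : ℝ) ≤ A := by positivity
  have h4 := mul_le_mul_of_nonneg_left (sq_mul_len_le_left hε hB' h') hA
  have h5 := mul_le_mul_of_nonneg_left (sq_mul_len_le_right hε hB' h') hA
  rw [mul_sub, ← hy] at h4 h5
  constructor <;> nlinarith

theorem within_of_len (hε : 0 < ε) (hA : 0 < A) (hy : y = A * y') (hB : IsFrame B y)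
    (hB' : IsFrame B' y') (h : Bad ε y) (hlen : A * len B' ≤ ε ^ 2 * len B) : Within A B' B := by
  rw [within_iff hB hB']
  have hA : (0 : ℝ) < A := by exact_mod_cast hA
  have h1 := mul_lt_mul_of_pos_left (left_lt_self hB') hA
  have h2 := mul_lt_mul_of_pos_left (self_lt_right hB') hA
  have h3 := len_eq hB'
  have h4 := sq_mul_len_le_left hε hB h
  have h5 := sq_mul_len_le_right hε hB h
  rw [h3, mul_sub] at hlen
  constructor <;> linarith

theorem Contains.len_le (hc : Contains A B' B) (hB : IsFrame B y) (hB' : IsFrame B' y') :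
    len B ≤ A * len B' := by
  rw [contains_iff hB hB'] at hc
  rw [len_eq hB, len_eq hB', mul_sub]
  linarith [hc.1, hc.2]

theorem Contains.isFrame (hc : Contains A B' B) (hA : 0 < A) (hy : y = A * y') (hB : IsFrame B y)
    (h1 : 0 < B' 1 0) (h2 : 0 < B' 1 1) : IsFrame B' y' := by
  have hA : (0 : ℝ) < A := by exact_mod_cast hA
  have h3 : (0 : ℝ) < B 1 0 := by exact_mod_cast hB.right_pos
  have h4 : (0 : ℝ) < B 1 1 := by exact_mod_cast hB.left_pos
  have h5 : (0 : ℝ) < B' 1 0 := by exact_mod_cast h1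
  have h6 : (0 : ℝ) < B' 1 1 := by exact_mod_cast h2
  obtain ⟨c1, c2⟩ := hc
  have c1' : (A : ℝ) * B' 0 1 * B 1 1 ≤ B' 1 1 * B 0 1 := by exact_mod_cast c1
  have c2' : (B' 1 0 : ℝ) * B 0 0 ≤ A * B' 0 0 * B 1 0 := by exact_mod_cast c2
  refine ⟨h1, h2, ?_, ?_⟩
  · have : 0 < A * B 1 1 * ((B' 1 1 : ℝ) * y' - B' 0 1) := by
      have := mul_pos h6 hB.left_lt
      rw [hy] at this
      linarith
    exact (pos_iff_pos_of_mul_pos this).1 (by positivity)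
  · have : 0 < A * B 1 0 * ((B' 0 0 : ℝ) - B' 1 0 * y') := by
      have := mul_pos h5 hB.lt_right
      rw [hy] at this
      linarith
    exact (pos_iff_pos_of_mul_pos this).1 (by positivity)

theorem Contains.of_mul_letter {b : Bool} (hc : Contains A (B' * letterMat b) B)
    (hB : IsFrame B y) (hB' : IsFrame B' y') (hb : IsFrame (B' * letterMat b) y') :
    Contains A B' B := by
  rw [contains_iff hB hb] at hc
  rw [contains_iff hB hB']
  have h3 : (0 : ℝ) < B' 1 0 := by exact_mod_cast hB'.right_pos
  have h4 : (0 : ℝ) < B' 1 1 := by exact_mod_cast hB'.left_pos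
  have hdet := det_entry_real B'
  have hA : (0 : ℝ) ≤ A := by positivity
  cases b
  · simp only [mul_letter_false_zero, mul_letter_false_one] at hc
    refine ⟨hc.1, hc.2.trans ?_⟩
    push_cast
    gcongr ?_ * ?_
    rw [div_le_div_iff₀ (by positivity) (by positivity)]
    nlinarith
  · simp only [mul_letter_true_zero, mul_letter_true_one] at hc
    refine ⟨le_trans ?_ hc.1, hc.2⟩
    push_cast
    gcongr ?_ * ?_
    rw [div_le_div_iff₀ (by positivity) (by positivity)]
    nlinarith

theorem Contains.mul_letter {b : Bool} (hc : Contains A B' B)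
    (hB : IsFrame B y) (hB' : IsFrame B' y') (hb : IsFrame (B * letterMat b) y) :
    Contains A B' (B * letterMat b) := by
  rw [contains_iff hB hB'] at hc
  rw [contains_iff hb hB']
  have h3 : (0 : ℝ) < B 1 0 := by exact_mod_cast hB.right_pos
  have h4 : (0 : ℝ) < B 1 1 := by exact_mod_cast hB.left_pos
  have hdet := det_entry_real B
  cases b
  · simp only [mul_letter_false_zero, mul_letter_false_one]
    refine ⟨hc.1, le_trans ?_ hc.2⟩
    push_cast
    rw [div_le_div_iff₀ (by positivity) (by positivity)]
    nlinarith
  · simp only [mul_letter_true_zero, mul_letter_true_one]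
    refine ⟨hc.1.trans ?_, hc.2⟩
    push_cast
    rw [div_le_div_iff₀ (by positivity) (by positivity)]
    nlinarith

theorem Contains.frame_mono {k k' n n' : ℕ} (hε : 0 < ε) (h : Bad ε y) (h' : Bad ε y')
    (hk : k' ≤ k) (hn : n ≤ n') (hc : Contains A (frame y' k) (frame y n)) :
    Contains A (frame y' k') (frame y n') := by
  have h1 : Contains A (frame y' k) (frame y n') := by
    induction n', hn using Nat.le_induction with
    | base => exact hc
    | succ n' _ ih =>
      exact ih.mul_letter (isFrame_frame hε h _) (isFrame_frame hε h' _)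
        (isFrame_frame hε h (n' + 1))
  induction hk using Nat.decreasingInduction with
  | self => exact h1
  | of_succ k' _ ih =>
    exact ih.of_mul_letter (isFrame_frame hε h _) (isFrame_frame hε h' _)
      (isFrame_frame hε h' (k' + 1))

theorem contains_frame_zero (hA : 0 < A) (hy : y = A * y') :
    Contains A (frame y' 0) (frame y 0) := by
  have hA' : (0 : ℝ) < A := by exact_mod_cast hA
  have h1 : (A : ℤ) * ⌊y'⌋ ≤ ⌊y⌋ := by
    rw [Int.le_floor, hy]; push_cast
    have := Int.floor_le y'
    gcongr
  have h2 : ⌊y⌋ < (A : ℤ) * (⌊y'⌋ + 1) := by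
    rw [Int.floor_lt, hy]; push_cast
    have := Int.lt_floor_add_one y'
    gcongr
  constructor <;> simp [frame] <;> linarith

end rows

section rowIdx

variable {ε y y' : ℝ} {A κ n : ℕ}

/-- The index of the smallest Farey interval of `y'` whose `A`-multiple contains the `n`-th
interval of `y`. -/
noncomputable def rowIdx (A : ℕ) (y y' : ℝ) (n : ℕ) : ℕ :=
  sSup {k | Contains A (frame y' k) (frame y n)}

theorem pow_le_of_contains (hε : 0 < ε) (h : Bad ε y) (h' : Bad ε y') {k : ℕ}
    (hc : Contains A (frame y' k) (frame y n)) :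
    contr ε ^ n ≤ A * (1 - contr ε) ^ k := by
  have h1 := hc.len_le (isFrame_frame hε h _) (isFrame_frame hε h' _)
  refine (len_frame_bounds hε h n).1.trans (h1.trans ?_)
  gcongr
  exact (len_frame_bounds hε h' k).2

theorem bddAbove_contains (hε : 0 < ε) (h : Bad ε y) (h' : Bad ε y') :
    BddAbove {k | Contains A (frame y' k) (frame y n)} := by
  have h0 := contr_pos hε
  have h1 := contr_lt_one hε
  have hpos : 0 < contr ε ^ n / (A + 1) := by positivity
  obtain ⟨K, hK⟩ := exists_pow_lt_of_lt_one hpos (by linarith : 1 - contr ε < 1)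
  refine ⟨K, fun k hk => ?_⟩
  by_contra! hlt
  have h2 := pow_le_of_contains hε h h' hk
  have h3 : (1 - contr ε) ^ k ≤ (1 - contr ε) ^ K :=
    pow_le_pow_of_le_one (by linarith) (by linarith) hlt.le
  rw [lt_div_iff₀ (by positivity)] at hK
  have h4 : 0 ≤ (1 - contr ε) ^ k := pow_nonneg (by linarith) _
  have hAr : (0 : ℝ) ≤ A := by positivity
  have h5 : (A : ℝ) * (1 - contr ε) ^ k ≤ A * (1 - contr ε) ^ K := by gcongr
  nlinarith

variable (hε : 0 < ε) (hA : 0 < A) (hy : y = A * y') (h : Bad ε y) (h' : Bad ε y')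
include hε hA hy h h'

theorem contains_rowIdx (n : ℕ) : Contains A (frame y' (rowIdx A y y' n)) (frame y n) :=
  Nat.sSup_mem (s := {k | Contains A (frame y' k) (frame y n)})
    ⟨0, (contains_frame_zero hA hy).frame_mono hε h h' le_rfl (Nat.zero_le n)⟩
    (bddAbove_contains hε h h')

omit hA hy in
theorem le_rowIdx {k : ℕ} (hc : Contains A (frame y' k) (frame y n)) : k ≤ rowIdx A y y' n :=
  le_csSup (bddAbove_contains hε h h') hc

theorem contains_of_le_rowIdx {k : ℕ} (hk : k ≤ rowIdx A y y' n) :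
    Contains A (frame y' k) (frame y n) :=
  (contains_rowIdx hε hA hy h h' n).frame_mono hε h h' hk le_rfl

theorem rowIdx_eq {k : ℕ} (hc : Contains A (frame y' k) (frame y n))
    (hn : ¬ Contains A (frame y' (k + 1)) (frame y n)) : rowIdx A y y' n = k := by
  refine le_antisymm ?_ (le_rowIdx hε h h' hc)
  by_contra! hlt
  exact hn (contains_of_le_rowIdx hε hA hy h h' hlt)

theorem rowIdx_mono {n n' : ℕ} (hn : n ≤ n') : rowIdx A y y' n ≤ rowIdx A y y' n' :=
  le_rowIdx hε h h' ((contains_rowIdx hε hA hy h h' n).frame_mono hε h h' le_rfl hn)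

theorem len_le_rowIdx (n : ℕ) :
    len (frame y n) ≤ A * len (frame y' (rowIdx A y y' n)) :=
  (contains_rowIdx hε hA hy h h' n).len_le (isFrame_frame hε h _) (isFrame_frame hε h' _)

theorem len_rowIdx_lt (n : ℕ) :
    ε ^ 2 * contr ε * (A * len (frame y' (rowIdx A y y' n))) < len (frame y n) := by
  by_contra! hle
  have h1 := (len_frame_add_bounds hε h' (rowIdx A y y' n) 1).1
  have hAr : (0 : ℝ) < A := by exact_mod_cast hA
  have hc : Contains A (frame y' (rowIdx A y y' n + 1)) (frame y n) := by
    apply contains_of_len hε hy (isFrame_frame hε h _) (isFrame_frame hε h' _) h'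
    refine hle.trans ?_
    rw [pow_one] at h1
    calc ε ^ 2 * contr ε * (A * len (frame y' (rowIdx A y y' n)))
        = ε ^ 2 * (A * (contr ε * len (frame y' (rowIdx A y y' n)))) := by ring
      _ ≤ _ := by gcongr
  have := le_rowIdx hε h h' hc
  omega

variable (hε1 : ε ≤ 1) (hκ : (1 - contr ε) ^ κ ≤ ε ^ 2 * contr ε)
include hε1 hκ

omit hA hy h h' in
theorem rate_pow_le (m : ℕ) :
    (1 - contr ε) ^ (κ * (m + 2)) ≤ ε ^ 4 * contr ε ^ (m + 2) := by
  have h0 := contr_pos hε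
  have h1 : 0 ≤ 1 - contr ε := by linarith [contr_lt_one hε]
  have h2 : ε ^ 2 * contr ε ≤ contr ε := by nlinarith [pow_le_one₀ hε.le hε1 (n := 2)]
  have h3 : (1 - contr ε) ^ κ ≤ contr ε := hκ.trans h2
  calc (1 - contr ε) ^ (κ * (m + 2)) = ((1 - contr ε) ^ κ) ^ m * ((1 - contr ε) ^ κ) ^ 2 := by
        rw [pow_mul, pow_add]
    _ ≤ contr ε ^ m * (ε ^ 2 * contr ε) ^ 2 := by gcongr
    _ = _ := by ring

theorem contains_of_le_rowIdx_add {m k : ℕ} (hk : k ≤ rowIdx A y y' n + m + 1) :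
    Contains A (frame y' k) (frame y (n + κ * (m + 2))) := by
  have h0 := contr_pos hε
  have h1 : 0 ≤ 1 - contr ε := by linarith [contr_lt_one hε]
  have hAr : (0 : ℝ) < A := by exact_mod_cast hA
  have hs : Contains A (frame y' (rowIdx A y y' n + (m + 1))) (frame y (n + κ * (m + 2))) := by
    apply contains_of_len hε hy (isFrame_frame hε h _) (isFrame_frame hε h' _) h'
    have e1 := (len_frame_add_bounds hε h n (κ * (m + 2))).2
    have e2 := (len_frame_add_bounds hε h' (rowIdx A y y' n) (m + 1)).1
    have e3 := rate_pow_le hε hε1 hκ m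
    have e4 := len_le_rowIdx hε hA hy h h' n
    have l1 := (isFrame_frame hε h n).len_pos
    have l2 := (isFrame_frame hε h' (rowIdx A y y' n)).len_pos
    have e5 : ε ^ 4 * contr ε ^ (m + 2) ≤ ε ^ 2 * contr ε ^ (m + 1) := by
      gcongr ?_ * ?_
      · exact pow_le_pow_of_le_one hε.le hε1 (by omega)
      · exact pow_le_pow_of_le_one h0.le (contr_lt_one hε).le (by omega)
    calc _ ≤ _ := e1
      _ ≤ (ε ^ 2 * contr ε ^ (m + 1)) * (A * len (frame y' (rowIdx A y y' n))) := by
        gcongr; exact e3.trans e5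
      _ = ε ^ 2 * (A * (contr ε ^ (m + 1) * len (frame y' (rowIdx A y y' n)))) := by ring
      _ ≤ _ := by gcongr
  exact hs.frame_mono hε h h' (by omega) le_rfl

theorem within_of_rowIdx_le {m k : ℕ} (hk : rowIdx A y y' (n + κ * (m + 2)) ≤ k + m) :
    Within A (frame y' k) (frame y n) := by
  have h0 := contr_pos hε
  have h1 : 0 ≤ 1 - contr ε := by linarith [contr_lt_one hε]
  have hAr : (0 : ℝ) < A := by exact_mod_cast hA
  apply within_of_len hε hA hy (isFrame_frame hε h _) (isFrame_frame hε h' _) h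
  set K := rowIdx A y y' (n + κ * (m + 2)) with hK
  have e1 := (len_frame_add_bounds hε h n (κ * (m + 2))).2
  have e3 := rate_pow_le hε hε1 hκ m
  have e4 := len_rowIdx_lt hε hA hy h h' (n + κ * (m + 2))
  rw [← hK] at e4
  have l1 := (isFrame_frame hε h n).len_pos
  have l2 := (isFrame_frame hε h' k).len_pos
  have l3 := (isFrame_frame hε h' K).len_pos
  have e2 : contr ε ^ m * len (frame y' k) ≤ len (frame y' K) := by
    rcases le_total k K with hkK | hkK
    · obtain ⟨d, hd⟩ := Nat.exists_eq_add_of_le hkK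
      rw [hd]
      refine le_trans ?_ (len_frame_add_bounds hε h' k d).1
      gcongr ?_ * ?_
      exact pow_le_pow_of_le_one h0.le (contr_lt_one hε).le (by omega)
    · obtain ⟨d, rfl⟩ := Nat.exists_eq_add_of_le hkK
      have e5 := (len_frame_add_bounds hε h' K d).2
      have e6 : (1 - contr ε) ^ d ≤ 1 := pow_le_one₀ h1 (by linarith)
      have e7 : contr ε ^ m ≤ 1 := pow_le_one₀ h0.le (contr_lt_one hε).le
      nlinarith
  have e8 : ε ^ 2 * contr ε ^ (m + 1) * (A * len (frame y' k)) ≤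
      ε ^ 2 * contr ε ^ (m + 1) * (ε ^ 2 * len (frame y n)) := by
    calc ε ^ 2 * contr ε ^ (m + 1) * (A * len (frame y' k))
        = ε ^ 2 * contr ε * (A * (contr ε ^ m * len (frame y' k))) := by ring
      _ ≤ ε ^ 2 * contr ε * (A * len (frame y' K)) := by gcongr
      _ ≤ (1 - contr ε) ^ (κ * (m + 2)) * len (frame y n) := e4.le.trans e1
      _ ≤ ε ^ 4 * contr ε ^ (m + 2) * len (frame y n) := by gcongr
      _ ≤ ε ^ 4 * contr ε ^ (m + 1) * len (frame y n) := by
        gcongr ?_ * ?_ * ?_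
        exact pow_le_pow_of_le_one h0.le (contr_lt_one hε).le (by omega)
      _ = _ := by ring
  exact le_of_mul_le_mul_left e8 (by positivity)

omit hA hy h h' hε1 hκ in
theorem rate_lt_one : 0 < 1 - contr ε ∧ 1 - contr ε < 1 := by
  constructor <;> linarith [contr_lt_one hε, contr_pos hε]

omit hA hy h h' in
theorem rate_pow_le' (k : ℕ) : (1 - contr ε) ^ (κ * k) ≤ contr ε ^ k := by
  have h0 := contr_pos hε
  rw [pow_mul]
  refine pow_le_pow_left₀ (pow_nonneg (rate_lt_one hε).1.le _) (hκ.trans ?_) k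
  nlinarith [pow_le_one₀ hε.le hε1 (n := 2)]

theorem rowIdx_add_le (n T : ℕ) :
    rowIdx A y y' (n + T) ≤ rowIdx A y y' n + κ * (T + 1) := by
  obtain ⟨hs0, hs1⟩ := rate_lt_one hε
  have h0 := contr_pos hε
  obtain ⟨τ, hτ⟩ := Nat.exists_eq_add_of_le (rowIdx_mono hε hA hy h h' (Nat.le_add_right n T))
  have hAr : (0 : ℝ) < A := by exact_mod_cast hA
  have e1 := (len_frame_add_bounds hε h n T).1
  have e2 := (len_frame_add_bounds hε h' (rowIdx A y y' n) τ).2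
  have e3 := len_rowIdx_lt hε hA hy h h' n
  have e4 := len_le_rowIdx hε hA hy h h' (n + T)
  have l1 := (isFrame_frame hε h' (rowIdx A y y' n)).len_pos
  rw [hτ] at e4 ⊢
  have e5 : (1 - contr ε) ^ (κ * (T + 1)) * (A * len (frame y' (rowIdx A y y' n))) <
      (1 - contr ε) ^ τ * (A * len (frame y' (rowIdx A y y' n))) := by
    calc (1 - contr ε) ^ (κ * (T + 1)) * (A * len (frame y' (rowIdx A y y' n)))
        ≤ contr ε ^ T * (ε ^ 2 * contr ε) * (A * len (frame y' (rowIdx A y y' n))) := by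
          rw [mul_add, pow_add, mul_one]
          gcongr
          exact rate_pow_le' hε hε1 hκ T
      _ = contr ε ^ T * (ε ^ 2 * contr ε * (A * len (frame y' (rowIdx A y y' n)))) := by ring
      _ < contr ε ^ T * len (frame y n) := by gcongr
      _ ≤ A * len (frame y' (rowIdx A y y' n + τ)) := e1.trans e4
      _ ≤ A * ((1 - contr ε) ^ τ * len (frame y' (rowIdx A y y' n))) := by gcongr
      _ = _ := by ring
  have e6 := lt_of_mul_lt_mul_right e5 (by positivity)
  have := (pow_lt_pow_iff_right_of_lt_one₀ hs0 hs1).1 e6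
  omega

theorem lt_add_of_rowIdx_eq {n n' : ℕ} (heq : rowIdx A y y' n = rowIdx A y y' n') :
    n' < n + κ := by
  obtain ⟨hs0, hs1⟩ := rate_lt_one hε
  have hκ0 : 0 < κ := by
    rcases Nat.eq_zero_or_pos κ with rfl | hpos
    · have := rate_pow_le' hε hε1 hκ 1
      simp at this
      linarith [contr_lt_one hε]
    · exact hpos
  rcases le_or_gt n' n with hle | hlt
  · omega
  obtain ⟨d, rfl⟩ := Nat.exists_eq_add_of_le hlt.le
  have h0 := contr_pos hε
  have e1 := (len_frame_add_bounds hε h n d).2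
  have e3 := len_rowIdx_lt hε hA hy h h' (n + d)
  have e4 := len_le_rowIdx hε hA hy h h' n
  have l1 := (isFrame_frame hε h n).len_pos
  rw [← heq] at e3
  have e5 : (1 - contr ε) ^ κ * len (frame y n) < (1 - contr ε) ^ d * len (frame y n) := by
    calc _ ≤ ε ^ 2 * contr ε * len (frame y n) := by gcongr
      _ ≤ ε ^ 2 * contr ε * (A * len (frame y' (rowIdx A y y' n))) := by gcongr
      _ < _ := e3.trans_le e1
  have e6 := lt_of_mul_lt_mul_right e5 l1.le
  have := (pow_lt_pow_iff_right_of_lt_one₀ hs0 hs1).1 e6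
  omega

theorem lt_mul_rowIdx (n : ℕ) : n < κ * (rowIdx A y y' n + 1) := by
  obtain ⟨hs0, hs1⟩ := rate_lt_one hε
  have h0 := contr_pos hε
  have e1 := (len_frame_bounds hε h n).2
  have e2 := (len_frame_bounds hε h' (rowIdx A y y' n)).1
  have e3 := len_rowIdx_lt hε hA hy h h' n
  have hAr : (1 : ℝ) ≤ A := by exact_mod_cast hA
  have e5 : (1 - contr ε) ^ (κ * (rowIdx A y y' n + 1)) < (1 - contr ε) ^ n := by
    calc (1 - contr ε) ^ (κ * (rowIdx A y y' n + 1))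
        ≤ contr ε ^ (rowIdx A y y' n) * (ε ^ 2 * contr ε) := by
          rw [mul_add, pow_add, mul_one]
          gcongr
          exact rate_pow_le' hε hε1 hκ _
      _ = ε ^ 2 * contr ε * (1 * contr ε ^ (rowIdx A y y' n)) := by ring
      _ ≤ ε ^ 2 * contr ε * (A * len (frame y' (rowIdx A y y' n))) := by gcongr
      _ < _ := e3.trans_le e1
  exact (pow_lt_pow_iff_right_of_lt_one₀ hs0 hs1).1 e5

theorem rowIdx_le {j : ℕ} (hAj : A * (1 - contr ε) ^ (κ * j) ≤ 1) (n : ℕ) :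
    rowIdx A y y' n ≤ κ * (n + j) := by
  obtain ⟨hs0, hs1⟩ := rate_lt_one hε
  have e1 := pow_le_of_contains hε h h' (contains_rowIdx hε hA hy h h' n)
  have e2 := rate_pow_le' hε hε1 hκ n
  have hAr : (0 : ℝ) < A := by exact_mod_cast hA
  by_contra! hlt
  have e3 : (1 - contr ε) ^ rowIdx A y y' n < (1 - contr ε) ^ (κ * (n + j)) :=
    pow_lt_pow_right_of_lt_one₀ hs0 hs1 hlt
  rw [mul_add, pow_add] at e3
  have e4 : (A : ℝ) * (1 - contr ε) ^ rowIdx A y y' n <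
      (A * (1 - contr ε) ^ (κ * j)) * (1 - contr ε) ^ (κ * n) := by
    calc _ < (A : ℝ) * ((1 - contr ε) ^ (κ * n) * (1 - contr ε) ^ (κ * j)) := by gcongr
      _ = _ := by ring
  have e5 : (A * (1 - contr ε) ^ (κ * j)) * (1 - contr ε) ^ (κ * n) ≤ 1 * (1 - contr ε) ^ (κ * n) := by
    gcongr
  linarith

end rowIdx

section transport

variable {ε y y' z z' : ℝ} {A κ n m : ℕ}

theorem frame_zero_eq_of_isFrame (hB : IsFrame (frame y 0) z) : frame z 0 = frame y 0 := by
  have h1 := hB.left_lt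
  have h2 := hB.lt_right
  simp [frame] at h1 h2
  have : ⌊z⌋ = ⌊y⌋ := by rw [Int.floor_eq_iff]; constructor <;> linarith
  apply ext_entry <;> simp [frame, this]

theorem letterMat_injective : Function.Injective letterMat := by
  intro b b' hb
  have h1 := congrArg (fun M : SpecialLinearGroup (Fin 2) ℤ => M 0 1) hb
  clear hb
  cases b <;> cases b' <;> simp_all [letterMat]

theorem letter_eq_of_frame_eq {n n' : ℕ} {G : SpecialLinearGroup (Fin 2) ℤ}
    (h0 : frame z n' = G * frame y n) (h1 : frame z (n' + 1) = G * frame y (n + 1)) :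
    letter z n' = letter y n := by
  rw [frame_succ, frame_succ, h0, ← mul_assoc] at h1
  exact letterMat_injective (mul_left_cancel h1)

variable (hε : 0 < ε) (hA : 0 < A) (hy : y = A * y') (h : Bad ε y) (h' : Bad ε y')
  (hz : z = A * z') (hbz : Bad ε z) (hbz' : Bad ε z')
  (hε1 : ε ≤ 1) (hκ : (1 - contr ε) ^ κ ≤ ε ^ 2 * contr ε)
include hε hA hy h h' hz hbz hε1 hκ

theorem frame_row_eq_of_frame_eq
    (hfar : frame z (n + κ * (m + 2)) = frame y (n + κ * (m + 2))) {k : ℕ}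
    (hk : k ≤ rowIdx A y y' n + m + 1) : frame z' k = frame y' k := by
  have hfr : ∀ k ≤ rowIdx A y y' n + m + 1, IsFrame (frame y' k) z' := fun k hk => by
    have hc := contains_of_le_rowIdx_add hε hA hy h h' hε1 hκ hk
    rw [← hfar] at hc
    exact hc.isFrame hA hz (isFrame_frame hε hbz _) (isFrame_frame hε h' k).right_pos
      (isFrame_frame hε h' k).left_pos
  induction k with
  | zero => exact frame_zero_eq_of_isFrame (hfr 0 hk)
  | succ k ih =>
    exact frame_succ_eq_of_isFrame (ih (by omega)) (hfr (k + 1) hk)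

include hbz'

theorem rowIdx_eq_of_frame_eq (hnear : frame z n = frame y n)
    (hfar : frame z (n + κ * (m + 2)) = frame y (n + κ * (m + 2))) :
    rowIdx A z z' n = rowIdx A y y' n := by
  have hf : ∀ k ≤ rowIdx A y y' n + m + 1, frame z' k = frame y' k := fun k hk =>
    frame_row_eq_of_frame_eq hε hA hy h h' hz hbz hε1 hκ hfar hk
  apply rowIdx_eq hε hA hz hbz hbz'
  · rw [hf _ (by omega), hnear]
    exact contains_rowIdx hε hA hy h h' n
  · rw [hf _ (by omega), hnear]
    intro hc
    have := le_rowIdx hε h h' hc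
    omega

omit hε hA hy h h' hz hbz hbz' hε1 hκ in
theorem contains_mul_iff {G H B B' : SpecialLinearGroup (Fin 2) ℤ} (h00 : G 0 0 = H 0 0)
    (h01 : A * G 0 1 = H 0 1) (h10 : G 1 0 = A * H 1 0) (h11 : G 1 1 = H 1 1) :
    Contains A (G * B') (H * B) ↔ Contains A B' B := by
  have hd := det_entry H
  unfold Contains
  simp only [mul_entry]
  rw [← sub_nonneg, ← sub_nonneg (b := _ * B' 0 1 * _), ← sub_nonneg (b := _ * (H 0 0 * _ + _)),
    ← sub_nonneg (b := B' 1 0 * _)]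
  have e1 : (G 1 0 * B' 0 1 + G 1 1 * B' 1 1) * (H 0 0 * B 0 1 + H 0 1 * B 1 1) -
      A * (G 0 0 * B' 0 1 + G 0 1 * B' 1 1) * (H 1 0 * B 0 1 + H 1 1 * B 1 1) =
      B' 1 1 * B 0 1 - A * B' 0 1 * B 1 1 := by
    rw [h00, h10, h11]
    linear_combination (B' 1 1 * B 0 1 - A * B' 0 1 * B 1 1) * hd +
      (-(B' 1 1 * H 1 0 * B 0 1) - B' 1 1 * H 1 1 * B 1 1) * h01
  have e2 : A * (G 0 0 * B' 0 0 + G 0 1 * B' 1 0) * (H 1 0 * B 0 0 + H 1 1 * B 1 0) -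
      (G 1 0 * B' 0 0 + G 1 1 * B' 1 0) * (H 0 0 * B 0 0 + H 0 1 * B 1 0) =
      A * B' 0 0 * B 1 0 - B' 1 0 * B 0 0 := by
    rw [h00, h10, h11]
    linear_combination (A * B' 0 0 * B 1 0 - B' 1 0 * B 0 0) * hd +
      (B' 1 0 * H 1 0 * B 0 0 + B' 1 0 * H 1 1 * B 1 0) * h01
  rw [e1, e2]

omit hε h h' hz hbz hbz' hε1 hκ in
theorem Within.pos_mul {G H B B' : SpecialLinearGroup (Fin 2) ℤ} (hw : Within A B' B)
    (h10 : G 1 0 = A * H 1 0) (h11 : G 1 1 = H 1 1) (hB : IsFrame B y) (hB' : IsFrame B' y')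
    (hHB : IsFrame (H * B) z) : 0 < (G * B') 1 0 ∧ 0 < (G * B') 1 1 := by
  have hd := det_entry B
  have hA' : (0 : ℝ) < A := by exact_mod_cast hA
  have p1 := hHB.right_pos
  have p2 := hHB.left_pos
  obtain ⟨w1, w2⟩ := hw
  have b1 : (0 : ℝ) < B 1 0 := by exact_mod_cast hB.right_pos
  have b2 : (0 : ℝ) < B 1 1 := by exact_mod_cast hB.left_pos
  have b3 : (0 : ℝ) < B' 1 0 := by exact_mod_cast hB'.right_pos
  have b4 : (0 : ℝ) < B' 1 1 := by exact_mod_cast hB'.left_pos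
  have q1 : 0 < A * B' 0 0 * B 1 1 - B 0 1 * B' 1 0 := by
    have : (0 : ℝ) < A * B' 0 0 * B 1 1 - B 0 1 * B' 1 0 := by
      have e1 := mul_pos (mul_pos hA' b2) hB'.lt_right
      have e2 := mul_pos b3 hB.left_lt
      rw [hy] at e2
      linarith
    exact_mod_cast this
  have q2 : 0 < B 0 0 * B' 1 1 - A * B' 0 1 * B 1 0 := by
    have : (0 : ℝ) < B 0 0 * B' 1 1 - A * B' 0 1 * B 1 0 := by
      have e1 := mul_pos (mul_pos hA' b1) hB'.left_lt
      have e2 := mul_pos b4 hB.lt_right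
      rw [hy] at e2
      linarith
    exact_mod_cast this
  rw [mul_entry] at p1 p2
  simp only [mul_entry, h10, h11]
  constructor
  · have e : A * H 1 0 * B' 0 0 + H 1 1 * B' 1 0 =
        (H 1 0 * B 0 0 + H 1 1 * B 1 0) * (A * B' 0 0 * B 1 1 - B 0 1 * B' 1 0) +
        (H 1 0 * B 0 1 + H 1 1 * B 1 1) * (B 0 0 * B' 1 0 - A * B' 0 0 * B 1 0) := by
      linear_combination (-(A * H 1 0 * B' 0 0) - H 1 1 * B' 1 0) * hd
    rw [e]
    have := mul_pos p1 q1
    have := mul_nonneg p2.le (sub_nonneg.2 w2)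
    linarith
  · have e : A * H 1 0 * B' 0 1 + H 1 1 * B' 1 1 =
        (H 1 0 * B 0 0 + H 1 1 * B 1 0) * (A * B' 0 1 * B 1 1 - B 0 1 * B' 1 1) +
        (H 1 0 * B 0 1 + H 1 1 * B 1 1) * (B 0 0 * B' 1 1 - A * B' 0 1 * B 1 0) := by
      linear_combination (-(A * H 1 0 * B' 0 1) - H 1 1 * B' 1 1) * hd
    rw [e]
    have := mul_pos p2 q2
    have := mul_nonneg p1.le (sub_nonneg.2 w1)
    linarith

/-- Transport of the row frames along a pair of points whose frames differ by a fixed matrix `H`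
that becomes integral after rescaling. -/
theorem rowIdx_transport {G H : SpecialLinearGroup (Fin 2) ℤ} (h00 : G 0 0 = H 0 0)
    (h01 : A * G 0 1 = H 0 1) (h10 : G 1 0 = A * H 1 0) (h11 : G 1 1 = H 1 1)
    (hpre : frame z n = H * frame y n)
    (hmid : frame z (n + κ * (m + 2)) = H * frame y (n + κ * (m + 2)))
    (hpost : frame z (n + κ * (m + 2) + κ * (m + 2)) =
      H * frame y (n + κ * (m + 2) + κ * (m + 2)))
    (hm : m ≤ rowIdx A y y' (n + κ * (m + 2))) :
    m ≤ rowIdx A z z' (n + κ * (m + 2)) ∧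
      frame z' (rowIdx A z z' (n + κ * (m + 2))) =
        G * frame y' (rowIdx A y y' (n + κ * (m + 2))) ∧
      ∀ i ≤ 2 * m, letter z' (rowIdx A z z' (n + κ * (m + 2)) - m + i) =
        letter y' (rowIdx A y y' (n + κ * (m + 2)) - m + i) := by
  set N := n + κ * (m + 2) with hN
  obtain ⟨k₀, hk₀⟩ := Nat.exists_eq_add_of_le hm
  have hfr : ∀ i ≤ 2 * m + 1, IsFrame (G * frame y' (k₀ + i)) z' := fun i hi => by
    have hc := contains_of_le_rowIdx_add (k := k₀ + i) hε hA hy h h' hε1 hκ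
      (show k₀ + i ≤ rowIdx A y y' N + m + 1 by omega)
    have hw : Within A (frame y' (k₀ + i)) (frame y n) :=
      within_of_rowIdx_le (m := m) hε hA hy h h' hε1 hκ (by rw [← hN]; omega)
    have hp := hw.pos_mul hA hy h10 h11 (isFrame_frame hε h n) (isFrame_frame hε h' _)
      (hpre ▸ isFrame_frame hε hbz n)
    rw [← contains_mul_iff h00 h01 h10 h11, ← hpost] at hc
    exact hc.isFrame hA hz (isFrame_frame hε hbz _) hp.1 hp.2
  obtain ⟨k₁, hk₁⟩ := (hfr 0 (by omega)).exists_frame_eq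
  have hall : ∀ i ≤ 2 * m + 1, frame z' (k₁ + i) = G * frame y' (k₀ + i) := fun i hi => by
    induction i with
    | zero => exact hk₁
    | succ i ih =>
      have e : G * frame y' (k₀ + (i + 1)) =
          G * frame y' (k₀ + i) * letterMat (letter y' (k₀ + i)) := by
        rw [← add_assoc, frame_succ, mul_assoc]
      have hf := hfr (i + 1) hi
      rw [e] at hf ⊢
      exact frame_succ_eq_of_isFrame (ih (by omega)) hf
  have hrow : rowIdx A z z' N = k₁ + m := by
    apply rowIdx_eq hε hA hz hbz hbz'
    · rw [hall m (by omega), hmid, contains_mul_iff h00 h01 h10 h11]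
      exact contains_of_le_rowIdx hε hA hy h h' (by omega)
    · rw [add_assoc, hall (m + 1) (by omega), hmid, contains_mul_iff h00 h01 h10 h11]
      intro hc
      have := le_rowIdx hε h h' hc
      omega
  refine ⟨by omega, ?_, fun i hi => ?_⟩
  · rw [hrow, hall m (by omega), hk₀, add_comm m]
  · rw [hrow, hk₀, Nat.add_sub_cancel, Nat.add_sub_cancel_left]
    exact letter_eq_of_frame_eq (hall i (by omega)) (hall (i + 1) (by omega))

end transport

/-- If `a ∤ μ`, the lines `R + aᶜ t (Z₀ R + μ Q) ≡ 0 (mod a²ᶜ)`, `0 ≤ t < aᶜ`, cover the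
`p`-primitive part of a lattice `K ∣ R` of much smaller index. -/
theorem exists_covered_lattice {a c : ℕ} (ha : 2 ≤ a) (hc : 0 < c) {μ : ℤ} (hμ : ¬ (a : ℤ) ∣ μ) :
    ∃ p K : ℕ, p.Prime ∧ 0 < K ∧ p ∣ K ∧ K * 2 ^ c ≤ a ^ (2 * c) ∧
      ∀ Z₀ R Q : ℤ, (K : ℤ) ∣ R → ¬ (p : ℤ) ∣ Q →
        ∃ t < a ^ c, (a : ℤ) ^ (2 * c) ∣ R + a ^ c * t * (Z₀ * R + μ * Q) := by
  have hμ0 : μ ≠ 0 := by rintro rfl; simp at hμ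
  have hndvd : ¬ a ∣ μ.natAbs := by rwa [← Int.natCast_dvd]
  rw [Nat.dvd_iff_prime_pow_dvd_dvd] at hndvd
  push Not at hndvd
  obtain ⟨p, k, hp, hka, hkμ⟩ := hndvd
  obtain ⟨v, b, hpb, hab⟩ := Nat.exists_eq_pow_mul_and_not_dvd (by omega : a ≠ 0) p hp.ne_one
  obtain ⟨e, μ₁, hpμ, hμe⟩ :=
    Nat.exists_eq_pow_mul_and_not_dvd (Int.natAbs_ne_zero.2 hμ0) p hp.ne_one
  have hkv : k ≤ v := by
    rw [hab] at hka
    have hcop : Nat.Coprime (p ^ k) b := Nat.Coprime.pow_left _ ((hp.coprime_iff_not_dvd).2 hpb)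
    exact (Nat.pow_dvd_pow_iff_le_right hp.one_lt).1 (hcop.dvd_of_dvd_mul_right hka)
  have hek : e < k := by
    by_contra! hle
    exact hkμ (hμe ▸ (pow_dvd_pow p hle).mul_right _)
  have hb0 : 0 < b := Nat.pos_of_ne_zero (by rintro rfl; simp at hpb)
  have hp2 := hp.two_le
  have hcv : c * v = (c - 1) * v + v := by
    obtain ⟨c', rfl⟩ := Nat.exists_eq_add_of_le' hc
    simp; ring
  have hcc : c - 1 ≤ (c - 1) * v := Nat.le_mul_of_pos_right _ (by omega)
  refine ⟨p, p ^ (c * v + e) * b ^ (2 * c), hp, by positivity, ?_, ?_, ?_⟩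
  · exact (dvd_pow_self p (by omega)).mul_right _
  · calc p ^ (c * v + e) * b ^ (2 * c) * 2 ^ c ≤ p ^ (c * v + e) * b ^ (2 * c) * p ^ (c * v - e) := by
          refine Nat.mul_le_mul_left _ ?_
          exact (Nat.pow_le_pow_left hp2 c).trans
            (Nat.pow_le_pow_right hp.pos (show c ≤ c * v - e by omega))
      _ = p ^ (c * v + e + (c * v - e)) * b ^ (2 * c) := by rw [pow_add p (c * v + e)]; ring
      _ = p ^ (v * (2 * c)) * b ^ (2 * c) := by
          rw [show c * v + e + (c * v - e) = v * (2 * c) by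
            rw [show v * (2 * c) = c * v + c * v by ring]; omega]
      _ = a ^ (2 * c) := by rw [hab, mul_pow, pow_mul]
  · intro Z₀ R Q hR hQ
    obtain ⟨R₁, hR₁⟩ := hR
    obtain ⟨μ₂, hμ₂⟩ : ((p : ℤ) ^ e) ∣ μ := by
      have : p ^ e ∣ μ.natAbs := hμe ▸ dvd_mul_right _ _
      rw [← Int.natCast_dvd] at this
      exact_mod_cast this
    have hpi : Prime (p : ℤ) := Nat.prime_iff_prime_int.1 hp
    have hpμ₂ : ¬ (p : ℤ) ∣ μ₂ := by
      intro hd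
      apply hpμ
      have h1 : (p : ℤ) ^ (e + 1) ∣ μ := by
        rw [hμ₂, pow_succ]; exact mul_dvd_mul_left _ hd
      have h2 : p ^ (e + 1) ∣ μ.natAbs := by
        rw [← Int.natCast_dvd]; exact_mod_cast h1
      rw [hμe, pow_succ] at h2
      exact Nat.dvd_of_mul_dvd_mul_left (by positivity) h2
    set S₁ : ℤ := Z₀ * p ^ (c * v) * b ^ (2 * c) * R₁ + μ₂ * Q with hS₁
    have hS : Z₀ * R + μ * Q = p ^ e * S₁ := by
      rw [hR₁, hμ₂, hS₁]; push_cast; ring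
    have hpS : ¬ (p : ℤ) ∣ S₁ := by
      intro hd
      have h1 : (p : ℤ) ∣ Z₀ * p ^ (c * v) * b ^ (2 * c) * R₁ := by
        have : (p : ℤ) ∣ p ^ (c * v) := dvd_pow_self _ (by omega)
        exact ((this.mul_left _).mul_right _).mul_right _
      rcases hpi.dvd_or_dvd ((Int.dvd_add_right h1).1 hd) with h2 | h2
      · exact hpμ₂ h2
      · exact hQ h2
    have hpb' : ¬ (p : ℤ) ∣ b := by exact_mod_cast hpb
    have hcop : IsCoprime ((b : ℤ) ^ (2 * c) * S₁) ((p : ℤ) ^ (c * v)) := by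
      apply IsCoprime.symm
      apply IsCoprime.pow_left
      rw [Prime.coprime_iff_not_dvd hpi]
      intro hd
      rcases hpi.dvd_or_dvd hd with h2 | h2
      · exact hpb' (hpi.dvd_of_dvd_pow h2)
      · exact hpS h2
    set P : ℤ := (p : ℤ) ^ (c * v) with hP
    have hPpos : 0 < P := by have := hp.pos; positivity
    obtain ⟨α, β, hαβ⟩ := hcop
    set t₀ := (-(α * R₁ * b ^ (2 * c))) % P with ht₀
    have ht₀0 : 0 ≤ t₀ := Int.emod_nonneg _ hPpos.ne'
    have ht₀1 : t₀ < P := Int.emod_lt_of_pos _ hPpos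
    obtain ⟨u, hu⟩ : P ∣ b ^ (2 * c) * R₁ + b ^ (2 * c) * S₁ * t₀ := by
      have h1 : P ∣ t₀ - (-(α * R₁ * b ^ (2 * c))) := by
        rw [ht₀]; exact Int.dvd_emod_sub_self
      obtain ⟨r, hr⟩ := h1
      refine ⟨b ^ (2 * c) * S₁ * r + β * R₁ * b ^ (2 * c), ?_⟩
      linear_combination b ^ (2 * c) * S₁ * hr - R₁ * b ^ (2 * c) * hαβ
    lift t₀ to ℕ using ht₀0 with t₁
    refine ⟨b ^ c * t₁, ?_, ?_⟩
    · have : t₁ < p ^ (c * v) := by rw [hP] at ht₀1; exact_mod_cast ht₀1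
      calc b ^ c * t₁ < b ^ c * p ^ (c * v) := by gcongr
        _ = a ^ c := by rw [hab, mul_pow, ← pow_mul, mul_comm v c]; ring
    · have hpa : (a : ℤ) = p ^ v * b := by exact_mod_cast hab
      have hbu : (b : ℤ) ^ (2 * c) ∣ u := by
        have h1 : (b : ℤ) ^ (2 * c) ∣ P * u := by
          rw [← hu]; exact ⟨R₁ + S₁ * t₁, by ring⟩
        refine IsCoprime.dvd_of_dvd_mul_left ?_ h1
        apply IsCoprime.symm
        rw [hP]
        exact ((Prime.coprime_iff_not_dvd hpi).2 hpb').pow_left.pow_right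
      obtain ⟨u', rfl⟩ := hbu
      refine ⟨p ^ e * u', ?_⟩
      rw [hS, hR₁, hpa]
      push_cast
      have e1 : ((p : ℤ) ^ v * b) ^ c = P * b ^ c := by rw [mul_pow, ← pow_mul, mul_comm v c, hP]
      have e2 : ((p : ℤ) ^ v * b) ^ (2 * c) = P ^ 2 * b ^ (2 * c) := by
        rw [mul_comm 2 c, pow_mul, e1]; ring
      rw [e1, e2, pow_add, ← hP]
      linear_combination P * p ^ e * hu

/-- Thue's lemma: a linear congruence modulo `K` has a nonzero solution of size `√K`. -/
theorem exists_small_solution {K : ℕ} (hK : 0 < K) (r₁ r₂ : ℤ) :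
    ∃ w₁ w₂ : ℤ, (w₁ ≠ 0 ∨ w₂ ≠ 0) ∧ (K : ℤ) ∣ r₁ * w₁ + r₂ * w₂ ∧
      |(w₁ : ℝ)| ≤ √K ∧ |(w₂ : ℝ)| ≤ √K := by
  have : NeZero K := ⟨hK.ne'⟩
  set s := Nat.sqrt K
  let f : ℕ × ℕ → ZMod K := fun w => (r₁ : ZMod K) * w.1 + r₂ * w.2
  have hcard : (Finset.univ : Finset (ZMod K)).card <
      (Finset.range (s + 1) ×ˢ Finset.range (s + 1)).card := by
    rw [Finset.card_univ, ZMod.card, Finset.card_product, Finset.card_range]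
    exact Nat.lt_succ_sqrt K
  obtain ⟨u, hu, w, hw, hne, heq⟩ := Finset.exists_ne_map_eq_of_card_lt_of_maps_to hcard
    (f := f) (fun _ _ => Finset.mem_univ _)
  simp only [Finset.mem_product, Finset.mem_range] at hu hw
  have hs : (s : ℝ) ≤ √K := Real.nat_sqrt_le_real_sqrt
  have hb : ∀ x y : ℕ, x < s + 1 → y < s + 1 → |(((x : ℤ) - y : ℤ) : ℝ)| ≤ √K := by
    intro x y hx hy
    refine le_trans ?_ hs
    have : |(x : ℤ) - y| ≤ s := by rw [abs_le]; omega
    exact_mod_cast this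
  refine ⟨(u.1 : ℤ) - w.1, (u.2 : ℤ) - w.2, ?_, ?_, hb _ _ hu.1 hw.1, hb _ _ hu.2 hw.2⟩
  · by_contra! hcon
    exact hne (Prod.ext (by omega) (by omega))
  · rw [← ZMod.intCast_zmod_eq_zero_iff_dvd]
    push_cast
    simp only [f] at heq
    linear_combination heq

/-- The sup norm of the vector `(R, Q)` in the coordinates given by the columns of `B`. -/
noncomputable def frameNorm (B : SpecialLinearGroup (Fin 2) ℤ) (R Q : ℝ) : ℝ :=
  max |B 1 1 * R - B 0 1 * Q| |B 0 0 * Q - B 1 0 * R|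

section frameNorm

variable {ε z : ℝ} {B : SpecialLinearGroup (Fin 2) ℤ}

theorem frameNorm_nonneg (R Q : ℝ) : 0 ≤ frameNorm B R Q :=
  (abs_nonneg _).trans (le_max_left _ _)

theorem frameNorm_comb_le (α β R Q R' Q' : ℝ) :
    frameNorm B (α * R + β * R') (α * Q + β * Q') ≤
      |α| * frameNorm B R Q + |β| * frameNorm B R' Q' := by
  have h1 := le_max_left |B 1 1 * R - B 0 1 * Q| |B 0 0 * Q - B 1 0 * R|
  have h2 := le_max_right |B 1 1 * R - B 0 1 * Q| |B 0 0 * Q - B 1 0 * R|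
  have h3 := le_max_left |B 1 1 * R' - B 0 1 * Q'| |B 0 0 * Q' - B 1 0 * R'|
  have h4 := le_max_right |B 1 1 * R' - B 0 1 * Q'| |B 0 0 * Q' - B 1 0 * R'|
  refine max_le ?_ ?_
  · rw [show B 1 1 * (α * R + β * R') - B 0 1 * (α * Q + β * Q') =
      α * (B 1 1 * R - B 0 1 * Q) + β * (B 1 1 * R' - B 0 1 * Q') by ring]
    refine (abs_add_le _ _).trans ?_
    rw [abs_mul, abs_mul]
    unfold frameNorm
    gcongr
  · rw [show B 0 0 * (α * Q + β * Q') - B 1 0 * (α * R + β * R') =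
      α * (B 0 0 * Q - B 1 0 * R) + β * (B 0 0 * Q' - B 1 0 * R') by ring]
    refine (abs_add_le _ _).trans ?_
    rw [abs_mul, abs_mul]
    unfold frameNorm
    gcongr

theorem frameNorm_le_two_mul (b : Bool) (R Q : ℝ) :
    frameNorm B R Q ≤ 2 * frameNorm (B * letterMat b) R Q := by
  have h0 := frameNorm_nonneg (B := B * letterMat b) R Q
  have h1 := le_max_left |(B * letterMat b) 1 1 * R - (B * letterMat b) 0 1 * Q|
    |(B * letterMat b) 0 0 * Q - (B * letterMat b) 1 0 * R|
  have h2 := le_max_right |(B * letterMat b) 1 1 * R - (B * letterMat b) 0 1 * Q|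
    |(B * letterMat b) 0 0 * Q - (B * letterMat b) 1 0 * R|
  change _ ≤ frameNorm (B * letterMat b) R Q at h1 h2
  cases b
  · simp only [mul_letter_false_zero, mul_letter_false_one] at h1 h2
    push_cast at h1 h2
    rw [abs_le] at h1 h2
    apply max_le <;> rw [abs_le] <;> constructor <;> linarith
  · simp only [mul_letter_true_zero, mul_letter_true_one] at h1 h2
    push_cast at h1 h2
    rw [abs_le] at h1 h2
    apply max_le <;> rw [abs_le] <;> constructor <;> linarith

theorem abs_le_frameNorm_mul (hB : IsFrame B z) (R Q : ℝ) :
    |Q| ≤ frameNorm B R Q * (B 1 0 + B 1 1) := by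
  have h1 := le_max_left |B 1 1 * R - B 0 1 * Q| |B 0 0 * Q - B 1 0 * R|
  have h2 := le_max_right |B 1 1 * R - B 0 1 * Q| |B 0 0 * Q - B 1 0 * R|
  have b1 : (0 : ℝ) < B 1 0 := by exact_mod_cast hB.right_pos
  have b2 : (0 : ℝ) < B 1 1 := by exact_mod_cast hB.left_pos
  have hd := det_entry_real B
  have e : Q = B 1 0 * (B 1 1 * R - B 0 1 * Q) + B 1 1 * (B 0 0 * Q - B 1 0 * R) := by
    linear_combination -Q * hd
  calc |Q| = |B 1 0 * (B 1 1 * R - B 0 1 * Q) + B 1 1 * (B 0 0 * Q - B 1 0 * R)| := by rw [← e]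
    _ ≤ B 1 0 * |B 1 1 * R - B 0 1 * Q| + B 1 1 * |B 0 0 * Q - B 1 0 * R| := by
      refine (abs_add_le _ _).trans ?_
      rw [abs_mul, abs_mul, abs_of_pos b1, abs_of_pos b2]
    _ ≤ B 1 0 * frameNorm B R Q + B 1 1 * frameNorm B R Q := by unfold frameNorm; gcongr
    _ = _ := by ring

theorem abs_form_le_frameNorm_mul (hB : IsFrame B z) (R Q : ℝ) :
    |Q * z - R| ≤ frameNorm B R Q * ((B 1 1 * z - B 0 1) + (B 0 0 - B 1 0 * z)) := by
  have h1 := le_max_left |B 1 1 * R - B 0 1 * Q| |B 0 0 * Q - B 1 0 * R|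
  have h2 := le_max_right |B 1 1 * R - B 0 1 * Q| |B 0 0 * Q - B 1 0 * R|
  have b1 := hB.left_lt
  have b2 := hB.lt_right
  have hd := det_entry_real B
  have e : Q * z - R = (B 1 1 * z - B 0 1) * (B 0 0 * Q - B 1 0 * R) -
      (B 0 0 - B 1 0 * z) * (B 1 1 * R - B 0 1 * Q) := by
    linear_combination (R - Q * z) * hd
  rw [e]
  calc _ ≤ (B 1 1 * z - B 0 1) * |B 0 0 * Q - B 1 0 * R| +
        (B 0 0 - B 1 0 * z) * |B 1 1 * R - B 0 1 * Q| := by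
          rw [sub_eq_add_neg]
          refine (abs_add_le _ _).trans ?_
          rw [abs_neg, abs_mul, abs_mul, abs_of_pos b1, abs_of_pos b2]
    _ ≤ (B 1 1 * z - B 0 1) * frameNorm B R Q + (B 0 0 - B 1 0 * z) * frameNorm B R Q := by
      unfold frameNorm; gcongr
    _ = _ := by ring

theorem sq_denom_mul_len_le (hε : 0 < ε) (hB : IsFrame B z) (h : Bad ε z) :
    ((B 1 0 : ℝ) + B 1 1) ^ 2 * len B ≤ (1 + 1 / ε) ^ 2 := by
  have b1 : (0 : ℝ) < B 1 0 := by exact_mod_cast hB.right_pos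
  have b2 : (0 : ℝ) < B 1 1 := by exact_mod_cast hB.left_pos
  have h1 := hB.ratio_le h
  have h2 := hB.ratio_le' h
  have e1 : (B 1 0 : ℝ) + B 1 1 ≤ (1 + 1 / ε) * B 1 0 := by
    rw [add_mul, one_mul, one_div, inv_mul_eq_div, add_le_add_iff_left, le_div_iff₀ hε]; linarith
  have e2 : (B 1 0 : ℝ) + B 1 1 ≤ (1 + 1 / ε) * B 1 1 := by
    rw [add_mul, one_mul, one_div, inv_mul_eq_div, add_comm, add_le_add_iff_left, le_div_iff₀ hε]
    linarith
  rw [len, mul_one_div, div_le_iff₀ (by positivity)]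
  calc ((B 1 0 : ℝ) + B 1 1) ^ 2 = (B 1 0 + B 1 1) * (B 1 0 + B 1 1) := by ring
    _ ≤ ((1 + 1 / ε) * B 1 0) * ((1 + 1 / ε) * B 1 1) := by gcongr
    _ = _ := by ring

theorem sq_form_le_len (hε : 0 < ε) (hB : IsFrame B z) (h : Bad ε z) :
    (((B 1 1 : ℝ) * z - B 0 1) + (B 0 0 - B 1 0 * z)) ^ 2 ≤ (1 + 1 / ε) ^ 2 * len B := by
  have b1 : (0 : ℝ) < B 1 0 := by exact_mod_cast hB.right_pos
  have b2 : (0 : ℝ) < B 1 1 := by exact_mod_cast hB.left_pos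
  have b3 := hB.left_lt
  have b4 := hB.lt_right
  have hd := hB.det_form
  have hl := hB.len_pos
  have e1 : ((B 1 1 : ℝ) * z - B 0 1) + (B 0 0 - B 1 0 * z) ≤ (B 1 0 + B 1 1) * len B := by
    have e2 : ((B 1 0 : ℝ) + B 1 1) * len B = 1 / B 1 1 + 1 / B 1 0 := by
      rw [len]; field_simp
    have e3 : ((B 1 1 : ℝ) * z - B 0 1) ≤ 1 / B 1 0 := by
      rw [le_div_iff₀ b1]; nlinarith [mul_pos b2 b4]
    have e4 : ((B 0 0 : ℝ) - B 1 0 * z) ≤ 1 / B 1 1 := by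
      rw [le_div_iff₀ b2]; nlinarith [mul_pos b1 b3]
    linarith
  calc _ ≤ (((B 1 0 : ℝ) + B 1 1) * len B) ^ 2 := by gcongr
    _ = ((B 1 0 : ℝ) + B 1 1) ^ 2 * len B * len B := by ring
    _ ≤ _ := by gcongr; exact sq_denom_mul_len_le hε hB h

end frameNorm

set_option maxHeartbeats 1000000 in
/-- The `p`-primitive vectors of the lattice `K ∣ R` cannot all be long along a long stretch of
frames of a badly approximable number. -/
theorem exists_short_primitive {ε z Λ : ℝ} {K p n m : ℕ} (hε : 0 < ε) (hε1 : ε ≤ 1)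
    (h : Bad ε z) (hp : p.Prime) (hK : 0 < K) (hΛ : 9 / 4 < Λ)
    (hm : (K : ℝ) ^ 2 * (1 + 1 / ε) ^ 4 * (1 - contr ε) ^ m < ε ^ 2) :
    ∃ s ≤ m, ∃ R Q : ℤ, (K : ℤ) ∣ R ∧ ¬ (p : ℤ) ∣ Q ∧
      frameNorm (frame z (n + s)) R Q ^ 2 < Λ * K := by
  by_contra! H
  have hKr : (1 : ℝ) ≤ K := by exact_mod_cast hK
  have hsq : √(K : ℝ) ^ 2 = K := Real.sq_sqrt (by positivity)
  have hthue : ∀ s : ℕ, ∃ R Q : ℤ, (R ≠ 0 ∨ Q ≠ 0) ∧ (K : ℤ) ∣ R ∧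
      frameNorm (frame z (n + s)) R Q ≤ √K := fun s => by
    set B := frame z (n + s)
    obtain ⟨w₁, w₂, hw, hd, h1, h2⟩ := exists_small_solution hK (B 0 0) (B 0 1)
    have hdet := det_entry_real B
    have hdet' := det_entry B
    refine ⟨B 0 0 * w₁ + B 0 1 * w₂, B 1 0 * w₁ + B 1 1 * w₂, ?_, hd, max_le ?_ ?_⟩
    · by_contra! hcon
      obtain ⟨c1, c2⟩ := hcon
      rcases hw with hw | hw
      · apply hw; linear_combination (-w₁) * hdet' + B 1 1 * c1 - B 0 1 * c2
      · apply hw; linear_combination (-w₂) * hdet' - B 1 0 * c1 + B 0 0 * c2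
    · push_cast
      rw [show (B 1 1 : ℝ) * (B 0 0 * w₁ + B 0 1 * w₂) - B 0 1 * (B 1 0 * w₁ + B 1 1 * w₂) = w₁ by
        linear_combination (w₁ : ℝ) * hdet]
      exact h1
    · push_cast
      rw [show (B 0 0 : ℝ) * (B 1 0 * w₁ + B 1 1 * w₂) - B 1 0 * (B 0 0 * w₁ + B 0 1 * w₂) = w₂ by
        linear_combination (w₂ : ℝ) * hdet]
      exact h2
  choose R Q hne hKR hnorm using hthue
  have hpQ : ∀ s ≤ m, (p : ℤ) ∣ Q s := fun s hs => by
    by_contra hcon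
    have h1 := H s hs (R s) (Q s) (hKR s) hcon
    have h2 : frameNorm (frame z (n + s)) (R s) (Q s) ^ 2 ≤ √K ^ 2 :=
      pow_le_pow_left₀ (frameNorm_nonneg _ _) (hnorm s) 2
    rw [hsq] at h2
    nlinarith
  have hpar : ∀ s < m, R s * Q (s + 1) = R (s + 1) * Q s := fun s hs => by
    by_contra hcon
    have hd : (R s : ℝ) * Q (s + 1) - R (s + 1) * Q s ≠ 0 := by
      rw [sub_ne_zero]; exact_mod_cast hcon
    set d : ℝ := (R s : ℝ) * Q (s + 1) - R (s + 1) * Q s with hdd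
    set α : ℝ := -R (s + 1) / d with hα
    set β : ℝ := R s / d with hβ
    have e1 : α * R s + β * R (s + 1) = 0 := by rw [hα, hβ]; field_simp; ring
    have e2 : α * Q s + β * Q (s + 1) = 1 := by
      rw [hα, hβ]; field_simp; rw [hdd]; ring
    have h1 := H s hs.le (-round α * R s - round β * R (s + 1))
      (1 - round α * Q s - round β * Q (s + 1))
      (dvd_sub ((hKR s).mul_left _) ((hKR _).mul_left _)) (by
        intro hcon
        have h3 : (p : ℤ) ∣ round α * Q s + round β * Q (s + 1) :=
          dvd_add ((hpQ s hs.le).mul_left _) ((hpQ (s + 1) hs).mul_left _)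
        have h4 := dvd_add hcon h3
        rw [show 1 - round α * Q s - round β * Q (s + 1) +
          (round α * Q s + round β * Q (s + 1)) = 1 by ring] at h4
        have h5 := Int.natCast_dvd.1 h4
        exact hp.one_lt.ne' (Nat.dvd_one.1 (by simpa using h5)))
    push_cast at h1
    rw [show -(round α : ℝ) * R s - round β * R (s + 1) =
        (α - round α) * R s + (β - round β) * R (s + 1) by linear_combination -e1,
      show (1 : ℝ) - round α * Q s - round β * Q (s + 1) =
        (α - round α) * Q s + (β - round β) * Q (s + 1) by linear_combination -e2] at h1
    have h2 := frameNorm_comb_le (B := frame z (n + s)) (α - round α) (β - round β)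
      (R s) (Q s) (R (s + 1)) (Q (s + 1))
    have h3 := abs_sub_round α
    have h4 := abs_sub_round β
    have h5 := frameNorm_le_two_mul (B := frame z (n + s)) (letter z (n + s)) (R (s + 1)) (Q (s + 1))
    rw [← frame_succ, add_assoc] at h5
    have h6 : frameNorm (frame z (n + s)) ((α - round α) * R s + (β - round β) * R (s + 1))
        ((α - round α) * Q s + (β - round β) * Q (s + 1)) ≤ 3 / 2 * √K := by
      refine h2.trans ?_
      calc _ ≤ 1 / 2 * √K + 1 / 2 * (2 * √K) :=
            add_le_add (mul_le_mul h3 (hnorm s) (frameNorm_nonneg _ _) (by norm_num))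
              (mul_le_mul h4 (h5.trans (mul_le_mul_of_nonneg_left (hnorm (s + 1)) (by norm_num)))
                (frameNorm_nonneg _ _) (by norm_num))
        _ = _ := by ring
    have h7 := pow_le_pow_left₀ (frameNorm_nonneg _ _) h6 2
    rw [mul_pow, hsq] at h7
    nlinarith
  have hpar0 : ∀ s ≤ m, R 0 * Q s = R s * Q 0 := fun s hs => by
    induction s with
    | zero => rfl
    | succ s ih =>
      have i1 := ih (by omega)
      have i2 := hpar s (by omega)
      rcases hne s with h0 | h0
      · apply mul_left_cancel₀ h0
        linear_combination R 0 * i2 + R (s + 1) * i1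
      · apply mul_left_cancel₀ h0
        linear_combination Q (s + 1) * i1 + Q 0 * i2
  have hp0 := hpar0 m le_rfl
  have hf0 := isFrame_frame hε h (n + 0)
  have hfm := isFrame_frame hε h (n + m)
  have n0 := hnorm 0
  have nm := hnorm m
  have u1 := abs_le_frameNorm_mul hf0 (R 0) (Q 0)
  have u2 := abs_form_le_frameNorm_mul hfm (R m) (Q m)
  have u3 := sq_denom_mul_len_le hε hf0 h
  have u4 := sq_form_le_len hε hfm h
  have u5 := (len_frame_add_bounds hε h (n + 0) m).2
  rw [add_zero] at u5 u3 u1 n0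
  have l0 := hf0.len_pos
  rw [add_zero] at l0
  have hX : (0 : ℝ) ≤ frame z n 1 0 + frame z n 1 1 := by
    have := hf0.right_pos
    have := hf0.left_pos
    rw [add_zero] at *
    have h1 : (0 : ℝ) < frame z n 1 0 := by exact_mod_cast hf0.right_pos
    have h2 : (0 : ℝ) < frame z n 1 1 := by exact_mod_cast hf0.left_pos
    positivity
  have hY : (0 : ℝ) ≤ ((frame z (n + m) 1 1 : ℝ) * z - frame z (n + m) 0 1) +
      (frame z (n + m) 0 0 - frame z (n + m) 1 0 * z) := by
    have := hfm.left_lt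
    have := hfm.lt_right
    positivity
  set X : ℝ := frame z n 1 0 + frame z n 1 1
  set Y : ℝ := ((frame z (n + m) 1 1 : ℝ) * z - frame z (n + m) 0 1) +
      (frame z (n + m) 0 0 - frame z (n + m) 1 0 * z)
  set C : ℝ := 1 + 1 / ε with hC
  have hC1 : 1 ≤ C := by rw [hC]; have : 0 < 1 / ε := by positivity
                         linarith
  have hs0 : 0 ≤ (1 - contr ε) ^ m := pow_nonneg (by linarith [contr_lt_one hε]) _
  have v1 : |(Q 0 : ℝ)| ≤ √K * X := u1.trans (by gcongr)
  have v2 : |(Q m : ℝ) * z - R m| ≤ √K * Y := u2.trans (by gcongr)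
  have v3 : Y ^ 2 ≤ C ^ 2 * ((1 - contr ε) ^ m * len (frame z n)) := u4.trans (by gcongr)
  have v4 : (X * Y) ^ 2 ≤ C ^ 4 * (1 - contr ε) ^ m := by
    calc (X * Y) ^ 2 = X ^ 2 * Y ^ 2 := by ring
      _ ≤ X ^ 2 * (C ^ 2 * ((1 - contr ε) ^ m * len (frame z n))) := by gcongr
      _ = (X ^ 2 * len (frame z n)) * C ^ 2 * (1 - contr ε) ^ m := by ring
      _ ≤ C ^ 2 * C ^ 2 * (1 - contr ε) ^ m := by gcongr
      _ = _ := by ring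
  rcases eq_or_ne (Q 0) 0 with hQ0 | hQ0
  · have hR0 : R 0 ≠ 0 := by
      rcases hne 0 with h0 | h0
      · exact h0
      · exact absurd hQ0 h0
    have hQm : Q m = 0 := by
      rw [hQ0, mul_zero] at hp0
      exact (mul_eq_zero.1 hp0).resolve_left hR0
    have hRm : R m ≠ 0 := by
      rcases hne m with h0 | h0
      · exact h0
      · exact absurd hQm h0
    have hKle : (K : ℝ) ≤ |(R m : ℝ)| := by
      have := Int.le_of_dvd (abs_pos.2 hRm) ((dvd_abs _ _).2 (hKR m))
      exact_mod_cast this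
    rw [hQm] at v2
    simp only [Int.cast_zero, zero_mul, zero_sub, abs_neg] at v2
    have h1 : (K : ℝ) ^ 2 ≤ (√K * Y) ^ 2 := pow_le_pow_left₀ (by positivity) (hKle.trans v2) 2
    rw [mul_pow, hsq] at h1
    have hlen1 : len (frame z n) ≤ 1 := by
      refine (len_frame_bounds hε h n).2.trans (pow_le_one₀ ?_ ?_) <;>
        linarith [contr_lt_one hε, contr_pos hε]
    have h2 : Y ^ 2 ≤ (K : ℝ) ^ 2 * C ^ 4 * (1 - contr ε) ^ m := by
      calc Y ^ 2 ≤ C ^ 2 * ((1 - contr ε) ^ m * 1) := v3.trans (by gcongr)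
        _ = 1 * C ^ 2 * (1 - contr ε) ^ m := by ring
        _ ≤ (K : ℝ) ^ 2 * C ^ 4 * (1 - contr ε) ^ m := by
          gcongr
          · exact one_le_pow₀ hKr
          · omega
    have h3 : ε ^ 2 ≤ 1 := pow_le_one₀ hε.le hε1
    nlinarith
  · have hg : 0 < Int.gcd (R 0) (Q 0) := Int.gcd_pos_of_ne_zero_right _ hQ0
    obtain ⟨R', Q', hcop, hR', hQ'⟩ := Int.exists_gcd_one hg
    obtain ⟨g, hgg⟩ : ∃ g : ℤ, (Int.gcd (R 0) (Q 0) : ℤ) = g := ⟨_, rfl⟩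
    rw [hgg] at hR' hQ'
    have hgp : 0 < g := by rw [← hgg]; exact_mod_cast hg
    have hg1 : (1 : ℝ) ≤ g := by exact_mod_cast hgp
    have hgz : g ≠ 0 := hgp.ne'
    have hQ'0 : Q' ≠ 0 := by rintro rfl; simp at hQ'; exact hQ0 hQ'
    have hp1 : R' * Q m = R m * Q' := by
      apply mul_left_cancel₀ hgz
      linear_combination hp0 - Q m * hR' + R m * hQ'
    have hcop' : IsCoprime Q' R' := (Int.isCoprime_iff_gcd_eq_one.2 hcop).symm
    obtain ⟨k, hk⟩ : Q' ∣ Q m := hcop'.dvd_of_dvd_mul_left ⟨R m, by rw [hp1]; ring⟩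
    have hk' : R m = k * R' := by
      apply mul_right_cancel₀ hQ'0
      rw [← hp1, hk]; ring
    have hk0 : k ≠ 0 := by
      rintro rfl
      rcases hne m with h0 | h0
      · exact h0 (by rw [hk']; ring)
      · exact h0 (by rw [hk]; ring)
    have hk1 : (1 : ℝ) ≤ |(k : ℝ)| := by exact_mod_cast Int.one_le_abs hk0
    have hb : ε ≤ |(Q' : ℝ)| * |(Q' : ℝ) * z - R'| := by
      rcases lt_or_gt_of_ne hQ'0 with hneg | hpos
      · have := h (-Q') (by omega) (-R')
        rw [abs_of_neg (by exact_mod_cast hneg : (Q' : ℝ) < 0)]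
        push_cast at this
        rwa [show (-(Q' : ℝ)) * z - -R' = -(Q' * z - R') by ring, abs_neg] at this
      · have := h Q' hpos R'
        rwa [abs_of_pos (by exact_mod_cast hpos : (0 : ℝ) < Q')]
    have f1 : |(Q' : ℝ)| ≤ √K * X := by
      refine le_trans ?_ v1
      rw [hQ']; push_cast
      rw [abs_mul, abs_of_pos (by linarith : (0 : ℝ) < g)]
      exact le_mul_of_one_le_right (abs_nonneg _) hg1
    have f2 : |(Q' : ℝ) * z - R'| ≤ √K * Y := by
      refine le_trans ?_ v2
      rw [hk, hk']; push_cast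
      rw [show (Q' : ℝ) * k * z - k * R' = k * (Q' * z - R') by ring, abs_mul]
      exact le_mul_of_one_le_left (abs_nonneg _) hk1
    have f3 : ε ≤ K * (X * Y) := by
      calc ε ≤ (√K * X) * (√K * Y) := hb.trans (by gcongr)
        _ = √K ^ 2 * (X * Y) := by ring
        _ = _ := by rw [hsq]
    have f4 : ε ^ 2 ≤ (K * (X * Y)) ^ 2 := pow_le_pow_left₀ hε.le f3 2
    rw [mul_pow] at f4
    have f5 : (K : ℝ) ^ 2 * (X * Y) ^ 2 ≤ K ^ 2 * (C ^ 4 * (1 - contr ε) ^ m) := by gcongr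
    nlinarith

/-- Reduction of an integral matrix modulo `M`. -/
noncomputable def red (M : ℕ) :
    SpecialLinearGroup (Fin 2) ℤ →* SpecialLinearGroup (Fin 2) (ZMod M) :=
  SpecialLinearGroup.map (Int.castRingHom (ZMod M))

theorem red_apply (M : ℕ) (B : SpecialLinearGroup (Fin 2) ℤ) (i j : Fin 2) :
    red M B i j = (B i j : ZMod M) := rfl

theorem dvd_sub_of_red_eq {M : ℕ} {B C : SpecialLinearGroup (Fin 2) ℤ} (h : red M B = red M C)
    (i j : Fin 2) : (M : ℤ) ∣ B i j - C i j := by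
  have := congrArg (fun X : SpecialLinearGroup (Fin 2) (ZMod M) => X i j) h
  simp only [red_apply] at this
  rw [← ZMod.intCast_zmod_eq_zero_iff_dvd]
  push_cast
  rw [this, sub_self]

theorem red_eq_of_dvd_sub {M : ℕ} {B C : SpecialLinearGroup (Fin 2) ℤ}
    (h : ∀ i j, (M : ℤ) ∣ B i j - C i j) : red M B = red M C := by
  ext i j
  have := (ZMod.intCast_zmod_eq_zero_iff_dvd _ _).2 (h i j)
  push_cast at this
  rw [red_apply, red_apply]
  exact sub_eq_zero.1 this

theorem dvd_of_red_eq_one {M : ℕ} {G : SpecialLinearGroup (Fin 2) ℤ} (hG : red M G = 1) :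
    (M : ℤ) ∣ G 0 0 - 1 ∧ (M : ℤ) ∣ G 0 1 ∧ (M : ℤ) ∣ G 1 0 ∧ (M : ℤ) ∣ G 1 1 - 1 := by
  have hG' : red M G = red M 1 := by rw [hG, map_one]
  have h01 := dvd_sub_of_red_eq hG' 0 1
  have h10 := dvd_sub_of_red_eq hG' 1 0
  rw [show (1 : SpecialLinearGroup (Fin 2) ℤ) 0 1 = 0 from rfl, sub_zero] at h01
  rw [show (1 : SpecialLinearGroup (Fin 2) ℤ) 1 0 = 0 from rfl, sub_zero] at h10
  exact ⟨dvd_sub_of_red_eq hG' 0 0, h01, h10, dvd_sub_of_red_eq hG' 1 1⟩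

theorem dvd_pow_entry {M : ℕ} {G : SpecialLinearGroup (Fin 2) ℤ} (hG : red M G = 1) (t : ℕ) :
    (M : ℤ) ^ 2 ∣ (G ^ t) 0 0 - (1 + t * (G 0 0 - 1)) ∧ (M : ℤ) ^ 2 ∣ (G ^ t) 0 1 - t * G 0 1 := by
  obtain ⟨⟨z00, h00⟩, ⟨z01, h01⟩, ⟨z10, h10⟩, ⟨z11, h11⟩⟩ := dvd_of_red_eq_one hG
  induction t with
  | zero => simp
  | succ t ih =>
    obtain ⟨⟨u, hu⟩, ⟨v, hv⟩⟩ := ih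
    rw [pow_succ G t, mul_entry, mul_entry]
    rw [sub_eq_iff_eq_add] at hu hv
    rw [hu, hv]
    rw [sub_eq_iff_eq_add] at h00 h11
    rw [h00, h01, h10, h11]
    push_cast
    constructor
    · exact ⟨u * (M * z00 + 1) + v * M * z10 + t * z00 ^ 2 + t * z01 * z10, by ring⟩
    · exact ⟨u * M * z01 + v * (M * z11 + 1) + t * z00 * z01 + t * z01 * z11, by ring⟩

theorem frame_add_eq_of_letter_eq {y z : ℝ} {k n m : ℕ} {P Q : SpecialLinearGroup (Fin 2) ℤ}
    (h0 : P * frame y k = Q * frame z n) (h : ∀ s < m, letter y (k + s) = letter z (n + s)) {s : ℕ}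
    (hs : s ≤ m) : P * frame y (k + s) = Q * frame z (n + s) := by
  induction s with
  | zero => exact h0
  | succ s ih =>
    rw [← add_assoc, ← add_assoc, frame_succ, frame_succ, h s hs, ← mul_assoc, ← mul_assoc,
      ih (by omega)]

theorem red_frame_add_eq_of_letter_eq {M : ℕ} {y z : ℝ} {k n m : ℕ}
    {Q : SpecialLinearGroup (Fin 2) ℤ} (h0 : red M (frame y k) = red M (Q * frame z n))
    (h : ∀ s < m, letter y (k + s) = letter z (n + s)) {s : ℕ}
    (hs : s ≤ m) : red M (frame y (k + s)) = red M (Q * frame z (n + s)) := by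
  induction s with
  | zero => exact h0
  | succ s ih =>
    rw [← add_assoc, ← add_assoc, frame_succ, frame_succ, h s hs, ← mul_assoc, map_mul, map_mul,
      ih (by omega)]

/-- The frames of a badly approximable number cannot be moved, modulo `a ^ (2 * c)`, by all
the powers of a matrix that is trivial modulo `a ^ c` and moves the cusp modulo `a ^ (c + 1)`. -/
theorem false_of_forall_pow_frame {ε z : ℝ} {a c m n : ℕ} (ha : 2 ≤ a) (hc : 0 < c) (hε : 0 < ε)
    (hε1 : ε ≤ 1) (hgap : 9 / 4 < gap ε * 2 ^ c)
    (hm : ((a : ℝ) ^ (2 * c)) ^ 2 * (1 + 1 / ε) ^ 4 * (1 - contr ε) ^ m < ε ^ 2)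
    (hz : Bad ε z) {G : SpecialLinearGroup (Fin 2) ℤ} (hG : red (a ^ c) G = 1)
    (hG01 : ¬ (a : ℤ) ^ (c + 1) ∣ G 0 1)
    (H : ∀ t < a ^ c, ∃ (y y' : ℝ) (k : ℕ), y = (a ^ (2 * c) : ℕ) * y' ∧ Bad ε y ∧ Bad ε y' ∧
      red (a ^ (2 * c)) (frame y k) = red (a ^ (2 * c)) (G ^ t * frame z n) ∧
      ∀ s < m, letter y (k + s) = letter z (n + s)) : False := by
  obtain ⟨⟨ζ, hζ⟩, ⟨μ, hμ⟩, -⟩ := dvd_of_red_eq_one hG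
  push_cast at hζ hμ
  have hμa : ¬ (a : ℤ) ∣ μ := fun hd => hG01 (by
    rw [hμ, pow_succ]; exact mul_dvd_mul_left _ hd)
  obtain ⟨p, K, hp, hK, -, hKa, hcov⟩ := exists_covered_lattice ha hc hμa
  have hs := rate_lt_one hε
  have hKr : (K : ℝ) * 2 ^ c ≤ a ^ (2 * c) := by exact_mod_cast hKa
  have hKle : (K : ℝ) ≤ a ^ (2 * c) := by
    refine le_trans ?_ hKr
    exact le_mul_of_one_le_right (by positivity) (one_le_pow₀ (by norm_num))
  have hmK : (K : ℝ) ^ 2 * (1 + 1 / ε) ^ 4 * (1 - contr ε) ^ m < ε ^ 2 := by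
    refine lt_of_le_of_lt ?_ hm
    have := pow_nonneg hs.1.le m
    gcongr
  obtain ⟨s, hsm, R, Q, hKR, hpQ, hlt⟩ :=
    exists_short_primitive (n := n) hε hε1 hz hp hK hgap hmK
  obtain ⟨t, ht, hdvd⟩ := hcov ζ R Q hKR hpQ
  obtain ⟨y, y', k, hy, hby, hby', hred, hlet⟩ := H t ht
  have hr := red_frame_add_eq_of_letter_eq hred hlet hsm
  set B := frame z (n + s) with hB
  have hdB := det_entry B
  set w₁ : ℤ := B 1 1 * R - B 0 1 * Q with hw₁
  set w₂ : ℤ := B 0 0 * Q - B 1 0 * R with hw₂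
  have hQ0 : Q ≠ 0 := by rintro rfl; simp at hpQ
  have hw : w₁ ≠ 0 ∨ w₂ ≠ 0 := by
    by_contra! hcon
    apply hQ0
    linear_combination (-Q) * hdB + B 1 0 * hcon.1 + B 1 1 * hcon.2
  have hfr := isFrame_frame hε hby (k + s)
  have key : ((a ^ (2 * c) : ℕ) : ℤ) ∣ frame y (k + s) 0 0 * w₁ + frame y (k + s) 0 1 * w₂ := by
    have e0 := dvd_sub_of_red_eq hr 0 0
    have e1 := dvd_sub_of_red_eq hr 0 1
    obtain ⟨f0, f1⟩ := dvd_pow_entry hG t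
    rw [mul_entry] at e0 e1
    push_cast at *
    rw [← pow_mul, mul_comm c 2] at f0 f1
    have := dvd_add (dvd_add (dvd_add (e0.mul_right w₁) (e1.mul_right w₂))
      (dvd_add (f0.mul_right R) (f1.mul_right Q))) hdvd
    rw [hζ, hμ] at this
    refine this.trans (dvd_of_eq ?_)
    linear_combination (-(G ^ t) 0 0 * R - (G ^ t) 0 1 * Q) * hdB
  have hmain := gap_mul_le_sq hε hε1 (by positivity) hy hby hby' hfr hw key
    (M := frameNorm B R Q) (by rw [hw₁]; push_cast; exact le_max_left _ _)
    (by rw [hw₂]; push_cast; exact le_max_right _ _)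
  push_cast at hmain
  have hg := gap_pos hε
  nlinarith

section pell

theorem three_mul_le_two_mul_of_pell {t t' s b b' : ℤ} (ht : 2 < t) (htt : t < t') (hb : 0 < b)
    (hb' : 0 < b') (h : (t ^ 2 - 4) * b' ^ 2 = (t' ^ 2 - 4) * b ^ 2)
    (hs : 2 * s * b = t * t' * b - b' * (t ^ 2 - 4)) : 3 * t ≤ 2 * t' := by
  have hD : 0 < t ^ 2 - 4 := by nlinarith
  have hb2 : 0 < b ^ 2 := by positivity
  have hS : t' * b < t * b' := by
    have e : (t ^ 2 - 4) * ((t * b') ^ 2 - (t' * b) ^ 2) = 4 * (t' ^ 2 - t ^ 2) * b ^ 2 := by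
      linear_combination t ^ 2 * h
    have e1 : 0 < t' ^ 2 - t ^ 2 := by nlinarith
    have e2 : 0 < (t ^ 2 - 4) * ((t * b') ^ 2 - (t' * b) ^ 2) := by rw [e]; positivity
    have e3 : 0 < (t * b') ^ 2 - (t' * b) ^ 2 := (mul_pos_iff_of_pos_left hD).1 e2
    exact lt_of_pow_lt_pow_left₀ 2 (by nlinarith) (by linarith)
  have hsq : 4 * b ^ 2 * (s ^ 2 - 4) = (t ^ 2 - 4) * (t * b' - t' * b) ^ 2 := by
    linear_combination (2 * s * b + t * t' * b - b' * (t ^ 2 - 4)) * hs - 4 * h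
  have hs4 : 0 < s ^ 2 - 4 := by
    have e : 0 < 4 * b ^ 2 * (s ^ 2 - 4) := by
      rw [hsq]; exact mul_pos hD (pow_pos (by linarith) 2)
    exact (mul_pos_iff_of_pos_left (by positivity)).1 e
  have hs0 : 0 < s := by
    have e1 : b' * (t ^ 2 - 4) < t * t' * b := by
      refine lt_of_pow_lt_pow_left₀ 2 (by have : 0 < t' := by linarith
                                          positivity) ?_
      have : 0 < t' ^ 2 - 4 + t ^ 2 - 4 := by nlinarith
      nlinarith
    have e2 : 0 < s * (2 * b) := by linarith
    exact (mul_pos_iff_of_pos_right (by linarith)).1 e2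
  have hs3 : 3 ≤ s := by nlinarith
  have e : 4 * t' * b = 2 * t * s * b + (t ^ 2 - 4) * (t * b' - t' * b) := by
    linear_combination (-t) * hs
  have e1 : 0 < (t ^ 2 - 4) * (t * b' - t' * b) := mul_pos hD (by linarith)
  have e2 : 3 * (t * b) ≤ s * (t * b) := by gcongr
  have e3 : 3 * t * b ≤ 2 * t' * b := by linarith
  exact le_of_mul_le_mul_right e3 hb

theorem abs_eq_of_pell {t t' s b b' : ℤ} (hb : b ≠ 0) (hsb : SignType.sign b = SignType.sign b')
    (hst : SignType.sign t = SignType.sign t')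
    (hlog : Nat.log 2 (t.natAbs ^ 2) = Nat.log 2 (t'.natAbs ^ 2))
    (h : (t ^ 2 - 4) * b' ^ 2 = (t' ^ 2 - 4) * b ^ 2)
    (hs : 2 * s * b = t * t' * b - b' * (t ^ 2 - 4))
    (hs' : 2 * s * b' = t * t' * b' - b * (t' ^ 2 - 4)) : t = t' := by
  wlog hlt : |t| < |t'| generalizing t t' b b'
  · rcases (not_lt.1 hlt).eq_or_lt with heq | hlt
    · rcases abs_eq_abs.1 heq with e | e
      · exact e.symm
      · rw [e, Left.sign_neg] at hst
        rw [e]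
        rcases lt_trichotomy t 0 with ht | ht | ht <;> simp_all
    · refine (this ?_ hsb.symm hst.symm hlog.symm h.symm ?_ ?_ hlt).symm
      · rintro rfl
        simp [sign_eq_zero_iff] at hsb
        exact hb hsb
      · linarith
      · linarith
  exfalso
  have ht0 : t ≠ 0 := by
    rintro rfl
    simp only [sign_zero] at hst
    have := sign_eq_zero_iff.1 hst.symm
    rw [this] at hlt
    exact lt_irrefl _ hlt
  have htpos : 0 < |t| := abs_pos.2 ht0
  have htt : t * t' = |t| * |t'| := by
    rcases lt_or_gt_of_ne ht0 with hneg | hpos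
    · have h2 : t' < 0 := by rw [← sign_eq_neg_one_iff, ← hst, sign_eq_neg_one_iff]; exact hneg
      rw [abs_of_neg hneg, abs_of_neg h2]; ring
    · have h2 : 0 < t' := by rw [← sign_eq_one_iff, ← hst, sign_eq_one_iff]; exact hpos
      rw [abs_of_pos hpos, abs_of_pos h2]
  have hbb : 0 < |b| ∧ 0 < |b'| ∧ ∃ σ : ℤ, σ ^ 2 = 1 ∧ b = σ * |b| ∧ b' = σ * |b'| := by
    rcases lt_or_gt_of_ne hb with hneg | hpos
    · have h2 : b' < 0 := by rw [← sign_eq_neg_one_iff, ← hsb, sign_eq_neg_one_iff]; exact hneg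
      refine ⟨abs_pos.2 hb, abs_pos.2 h2.ne, -1, by norm_num, ?_, ?_⟩
      · rw [abs_of_neg hneg]; ring
      · rw [abs_of_neg h2]; ring
    · have h2 : 0 < b' := by rw [← sign_eq_one_iff, ← hsb, sign_eq_one_iff]; exact hpos
      refine ⟨abs_pos.2 hb, abs_pos.2 h2.ne', 1, by norm_num, ?_, ?_⟩
      · rw [abs_of_pos hpos]; ring
      · rw [abs_of_pos h2]; ring
  obtain ⟨hb1, hb2, σ, hσ, eb, eb'⟩ := hbb
  have hsq : 2 * |t| ^ 2 ≤ |t'| ^ 2 := by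
    rcases le_or_gt |t| 2 with hle | hgt
    · have : |t| = 1 ∨ |t| = 2 := by omega
      rcases this with e | e <;> rw [e] at hlt ⊢ <;> nlinarith
    · have := three_mul_le_two_mul_of_pell (s := s) hgt hlt hb1 hb2
        (by rw [sq_abs, sq_abs, sq_abs, sq_abs]; exact h) (by
          rw [← htt, sq_abs]
          rw [eb, eb'] at hs
          linear_combination σ * hs + (t * t' * |b| - |b'| * (t ^ 2 - 4) - 2 * s * |b|) * hσ)
      nlinarith
  have hnat : 2 * t.natAbs ^ 2 ≤ t'.natAbs ^ 2 := by
    zify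
    simpa using hsq
  have hpos : t.natAbs ^ 2 ≠ 0 := pow_ne_zero _ (Int.natAbs_ne_zero.2 ht0)
  have := Nat.log_mono_right (b := 2) hnat
  rw [mul_comm, Nat.log_mul_base (by norm_num) hpos] at this
  omega

theorem eq_of_pell {b c d t b' c' d' t' s : ℤ} (hb : b ≠ 0) (c1 : b * d' = b' * d)
    (c2 : b * c' = b' * c) (ds : t ^ 2 - 4 = d ^ 2 + 4 * b * c)
    (ds' : t' ^ 2 - 4 = d' ^ 2 + 4 * b' * c') (h4 : t ^ 2 ≠ 4)
    (hs : 2 * s = t * t' - d * d' - 2 * b' * c - 2 * b * c')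
    (hsb : SignType.sign b = SignType.sign b') (hst : SignType.sign t = SignType.sign t')
    (hlog : Nat.log 2 (t.natAbs ^ 2) = Nat.log 2 (t'.natAbs ^ 2)) :
    t = t' ∧ b = b' ∧ c = c' ∧ d = d' := by
  have hrel : (t ^ 2 - 4) * b' ^ 2 = (t' ^ 2 - 4) * b ^ 2 := by
    rw [ds, ds']
    linear_combination (-(b * d') - b' * d) * c1 - 4 * b * b' * c2
  have htt : t = t' := by
    refine abs_eq_of_pell (s := s) hb hsb hst hlog hrel ?_ ?_
    · rw [ds]
      linear_combination b * hs - d * c1 - 2 * b * c2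
    · rw [ds']
      linear_combination b' * hs + d' * c1 + 2 * b' * c2
  subst htt
  have hbb : b = b' := by
    have e := mul_left_cancel₀ (sub_ne_zero.2 h4) hrel
    rcases sq_eq_sq_iff_eq_or_eq_neg.1 e with e3 | e3
    · exact e3.symm
    · rw [e3, Left.sign_neg] at hsb
      rcases lt_trichotomy b 0 with hl | hl | hl
      · rw [sign_neg hl] at hsb; exact absurd hsb (by decide)
      · exact absurd hl hb
      · rw [sign_pos hl] at hsb; exact absurd hsb (by decide)
  subst hbb
  exact ⟨rfl, rfl, (mul_left_cancel₀ hb c2).symm, (mul_left_cancel₀ hb c1).symm⟩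

end pell

/-- Signs and size of the trace: enough to pin an element of a rank one group of units. -/
noncomputable def pellKey (h : SpecialLinearGroup (Fin 2) ℤ) : SignType × SignType × SignType × ℕ :=
  (SignType.sign (h 0 1), SignType.sign (h 1 0), SignType.sign (h 0 0 + h 1 1),
    Nat.log 2 ((h 0 0 + h 1 1).natAbs ^ 2))

theorem eq_of_pellKey_eq {h h' : SpecialLinearGroup (Fin 2) ℤ}
    (c1 : h 0 1 * (h' 1 1 - h' 0 0) = h' 0 1 * (h 1 1 - h 0 0))
    (c2 : h 0 1 * h' 1 0 = h' 0 1 * h 1 0)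
    (c3 : h 1 0 * (h' 1 1 - h' 0 0) = h' 1 0 * (h 1 1 - h 0 0))
    (hp : (h 0 0 + h 1 1) ^ 2 = 4 → h 0 1 = 0 ∧ h 1 0 = 0)
    (hkey : pellKey h = pellKey h') : h = h' := by
  simp only [pellKey, Prod.mk.injEq] at hkey
  obtain ⟨k1, k2, k3, k4⟩ := hkey
  have d := det_entry h
  have d' := det_entry h'
  by_cases hz : h 0 1 = 0 ∧ h 1 0 = 0
  · obtain ⟨z1, z2⟩ := hz
    have z1' : h' 0 1 = 0 := by rw [z1, sign_zero] at k1; exact sign_eq_zero_iff.1 k1.symm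
    have z2' : h' 1 0 = 0 := by rw [z2, sign_zero] at k2; exact sign_eq_zero_iff.1 k2.symm
    rw [z1, zero_mul, sub_zero] at d
    rw [z1', zero_mul, sub_zero] at d'
    apply ext_entry _ _ _ (z1.trans z1'.symm) (z2.trans z2'.symm)
    all_goals
      rcases Int.eq_one_or_neg_one_of_mul_eq_one' d with ⟨e1, e2⟩ | ⟨e1, e2⟩ <;>
      rcases Int.eq_one_or_neg_one_of_mul_eq_one' d' with ⟨e1', e2'⟩ | ⟨e1', e2'⟩ <;>
      rw [e1, e2, e1', e2'] at k3 <;> simp_all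
  · have h4 : (h 0 0 + h 1 1) ^ 2 ≠ 4 := fun e => hz (hp e)
    set t := h 0 0 + h 1 1 with ht
    set t' := h' 0 0 + h' 1 1 with ht'
    have ds : t ^ 2 - 4 = (h 1 1 - h 0 0) ^ 2 + 4 * h 0 1 * h 1 0 := by
      rw [ht]; linear_combination 4 * d
    have ds' : t' ^ 2 - 4 = (h' 1 1 - h' 0 0) ^ 2 + 4 * h' 0 1 * h' 1 0 := by
      rw [ht']; linear_combination 4 * d'
    set s := h' 0 0 * h 1 1 - h' 0 1 * h 1 0 - h' 1 0 * h 0 1 + h' 1 1 * h 0 0 with hs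
    have hs2 : 2 * s = t * t' - (h 1 1 - h 0 0) * (h' 1 1 - h' 0 0) - 2 * h' 0 1 * h 1 0 -
        2 * h 0 1 * h' 1 0 := by rw [hs, ht, ht']; ring
    by_cases hb : h 0 1 = 0
    · obtain ⟨e1, e2, e3, e4⟩ := eq_of_pell (s := s) (c := h 0 1) (c' := h' 0 1)
        (fun hc => hz ⟨hb, hc⟩) c3
        (by linear_combination -c2) (by rw [ds]; ring) (by rw [ds']; ring) h4
        (by rw [hs2]; ring) k2 k3 k4
      exact ext_entry _ _ (by omega) e3 e2 (by omega)
    · obtain ⟨e1, e2, e3, e4⟩ := eq_of_pell (s := s) hb c1 c2 ds ds' h4 hs2 k1 k3 k4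
      exact ext_entry _ _ (by omega) e2 e3 (by omega)

section forms

variable {ρ₁ ρ₂ M Y : ℤ}

theorem cross_eq_zero_of_dvd (hcop : IsCoprime ρ₁ ρ₂)
    (hlin : ∀ w₁ w₂ : ℤ, M ∣ ρ₁ * w₁ + ρ₂ * w₂ → |w₁| ≤ Y → |w₂| ≤ Y → w₁ = 0 ∧ w₂ = 0)
    {q₀ q₁ q₂ r₀ r₁ r₂ : ℤ} (hq : M ∣ q₀ * ρ₁ ^ 2 + q₁ * ρ₁ * ρ₂ + q₂ * ρ₂ ^ 2)
    (hr : M ∣ r₀ * ρ₁ ^ 2 + r₁ * ρ₁ * ρ₂ + r₂ * ρ₂ ^ 2)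
    (hu : |q₀ * r₁ - r₀ * q₁| ≤ Y) (hv : |q₀ * r₂ - r₀ * q₂| ≤ Y) (hw : |q₁ * r₂ - r₁ * q₂| ≤ Y) :
    q₀ * r₁ = r₀ * q₁ ∧ q₀ * r₂ = r₀ * q₂ ∧ q₁ * r₂ = r₁ * q₂ := by
  set u := q₀ * r₁ - r₀ * q₁ with hu'
  set v := q₀ * r₂ - r₀ * q₂ with hv'
  set w := q₁ * r₂ - r₁ * q₂ with hw'
  have d1 : M ∣ ρ₂ * (ρ₁ * u + ρ₂ * v) := by
    refine (dvd_sub (hr.mul_left q₀) (hq.mul_left r₀)).trans (dvd_of_eq ?_)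
    rw [hu', hv']; ring
  have d2 : M ∣ ρ₁ * (ρ₁ * v + ρ₂ * w) := by
    refine (dvd_sub (hq.mul_left r₂) (hr.mul_left q₂)).trans (dvd_of_eq ?_)
    rw [hw', hv']; ring
  have d3 : M ∣ ρ₁ ^ 2 * u - ρ₂ ^ 2 * w := by
    refine (dvd_sub (hq.mul_left r₁) (hr.mul_left q₁)).trans (dvd_of_eq ?_)
    rw [hw', hu']; ring
  have d4 : M ∣ ρ₂ ^ 2 * (ρ₁ * v + ρ₂ * w) := by
    refine (dvd_sub (d1.mul_left ρ₁) (d3.mul_left ρ₂)).trans (dvd_of_eq ?_)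
    ring
  have d5 : M ∣ ρ₁ ^ 2 * (ρ₁ * u + ρ₂ * v) := by
    refine (dvd_add (d2.mul_left ρ₂) (d3.mul_left ρ₁)).trans (dvd_of_eq ?_)
    ring
  have e1 : M ∣ ρ₁ * v + ρ₂ * w := by
    obtain ⟨α, β, hαβ⟩ : IsCoprime ρ₁ (ρ₂ ^ 2) := hcop.pow_right
    refine (dvd_add (d2.mul_left α) (d4.mul_left β)).trans (dvd_of_eq ?_)
    linear_combination (ρ₁ * v + ρ₂ * w) * hαβ
  have e2 : M ∣ ρ₁ * u + ρ₂ * v := by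
    obtain ⟨α, β, hαβ⟩ : IsCoprime (ρ₁ ^ 2) ρ₂ := hcop.pow_left
    refine (dvd_add (d5.mul_left α) (d1.mul_left β)).trans (dvd_of_eq ?_)
    linear_combination (ρ₁ * u + ρ₂ * v) * hαβ
  obtain ⟨f1, f2⟩ := hlin _ _ e1 hv hw
  obtain ⟨f3, -⟩ := hlin _ _ e2 hu hv
  exact ⟨sub_eq_zero.1 f3, sub_eq_zero.1 f1, sub_eq_zero.1 f2⟩

theorem coeff_eq_zero_of_disc_eq_zero
    (hlin : ∀ w₁ w₂ : ℤ, M ∣ ρ₁ * w₁ + ρ₂ * w₂ → |w₁| ≤ Y → |w₂| ≤ Y → w₁ = 0 ∧ w₂ = 0)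
    {q₀ q₁ q₂ : ℤ} (hq : M ^ 2 ∣ q₀ * ρ₁ ^ 2 + q₁ * ρ₁ * ρ₂ + q₂ * ρ₂ ^ 2)
    (hdisc : q₁ ^ 2 - 4 * q₀ * q₂ = 0) (h0 : |2 * q₀| ≤ Y) (h1 : |q₁| ≤ Y) (h2 : |2 * q₂| ≤ Y) :
    q₀ = 0 ∧ q₂ = 0 := by
  have d1 : M ∣ ρ₁ * (2 * q₀) + ρ₂ * q₁ := by
    rw [← Int.pow_dvd_pow_iff (n := 2) (by norm_num)]
    refine (hq.mul_left (4 * q₀)).trans (dvd_of_eq ?_)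
    linear_combination (-ρ₂ ^ 2) * hdisc
  have d2 : M ∣ ρ₁ * q₁ + ρ₂ * (2 * q₂) := by
    rw [← Int.pow_dvd_pow_iff (n := 2) (by norm_num)]
    refine (hq.mul_left (4 * q₂)).trans (dvd_of_eq ?_)
    linear_combination (-ρ₁ ^ 2) * hdisc
  have e1 := (hlin _ _ d1 h0 h1).1
  have e2 := (hlin _ _ d2 h1 h2).2
  omega

end forms

theorem inv_mul_frame_bounds (y : ℝ) (n T : ℕ) (i j : Fin 2) :
    0 ≤ ((frame y n)⁻¹ * frame y (n + T)) i j ∧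
      ((frame y n)⁻¹ * frame y (n + T)) i j ≤ 2 ^ T := by
  induction T generalizing i j with
  | zero =>
    rw [add_zero, inv_mul_cancel]
    fin_cases i <;> fin_cases j <;> simp
  | succ T ih =>
    rw [← add_assoc, frame_succ, ← mul_assoc]
    set P := (frame y n)⁻¹ * frame y (n + T)
    have h0 := ih i 0
    have h1 := ih i 1
    cases letter y (n + T) <;> fin_cases j
    · rw [show (⟨0, by norm_num⟩ : Fin 2) = 0 from rfl, mul_letter_false_zero, pow_succ]; omega
    · rw [show (⟨1, by norm_num⟩ : Fin 2) = 1 from rfl, mul_letter_false_one, pow_succ]; omega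
    · rw [show (⟨0, by norm_num⟩ : Fin 2) = 0 from rfl, mul_letter_true_zero, pow_succ]; omega
    · rw [show (⟨1, by norm_num⟩ : Fin 2) = 1 from rfl, mul_letter_true_one, pow_succ]; omega

/-- The matrix comparing the expansions of `z` and `y` over the stretch `[n, n + T)`. -/
noncomputable def transition (y z : ℝ) (n T : ℕ) : SpecialLinearGroup (Fin 2) ℤ :=
  (frame y n)⁻¹ * frame z (n + T) * ((frame y n)⁻¹ * frame y (n + T))⁻¹

section transition

variable {ε y y' z z' : ℝ} {A n T : ℕ}

theorem abs_transition_le (hz : frame z n = frame y n) (i j : Fin 2) :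
    |transition y z n T i j| ≤ 2 * 4 ^ T := by
  rw [transition, ← hz, mul_entry]
  have a0 := inv_mul_frame_bounds z n T i 0
  have a1 := inv_mul_frame_bounds z n T i 1
  rw [hz] at a0 a1 ⊢
  set P := (frame y n)⁻¹ * frame z (n + T)
  have hb : ∀ k : Fin 2, |((frame y n)⁻¹ * frame y (n + T))⁻¹ k j| ≤ 2 ^ T := fun k => by
    have b00 := inv_mul_frame_bounds y n T 0 0
    have b01 := inv_mul_frame_bounds y n T 0 1
    have b10 := inv_mul_frame_bounds y n T 1 0
    have b11 := inv_mul_frame_bounds y n T 1 1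
    set R := (frame y n)⁻¹ * frame y (n + T)
    fin_cases k <;> fin_cases j <;>
      simp only [Fin.zero_eta, Fin.mk_one, Fin.isValue, inv_entry_zero_zero, inv_entry_zero_one,
        inv_entry_one_zero, inv_entry_one_one, abs_neg] <;> rw [abs_of_nonneg] <;> omega
  have b0 := hb 0
  have b1 := hb 1
  refine (abs_add_le _ _).trans ?_
  rw [abs_mul, abs_mul, abs_of_nonneg a0.1, abs_of_nonneg a1.1]
  calc _ ≤ (2 : ℤ) ^ T * 2 ^ T + 2 ^ T * 2 ^ T :=
        add_le_add (mul_le_mul a0.2 b0 (abs_nonneg _) (by positivity))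
          (mul_le_mul a1.2 b1 (abs_nonneg _) (by positivity))
    _ = 2 * 4 ^ T := by rw [← mul_pow]; ring

theorem conj_transition :
    frame y n * transition y z n T * (frame y n)⁻¹ =
      frame z (n + T) * (frame y (n + T))⁻¹ := by
  rw [transition]; group

theorem conj_transition_entry :
    (frame z (n + T) * (frame y (n + T))⁻¹) 0 1 =
      transition y z n T 0 1 * frame y n 0 0 ^ 2 +
      (transition y z n T 1 1 - transition y z n T 0 0) * frame y n 0 0 * frame y n 0 1 +
      (-transition y z n T 1 0) * frame y n 0 1 ^ 2 := by
  rw [← conj_transition (z := z), mul_entry, mul_entry, mul_entry, inv_entry_zero_one,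
    inv_entry_one_one]
  ring

theorem log_pellKey_transition_lt (hz : frame z n = frame y n) :
    (pellKey (transition y z n T)).2.2.2 < 4 * T + 5 := by
  have h0 := abs_transition_le (T := T) hz 0 0
  have h1 := abs_transition_le (T := T) hz 1 1
  simp only [pellKey]
  set t := transition y z n T 0 0 + transition y z n T 1 1
  have ht : |t| ≤ 4 * 4 ^ T := (abs_add_le _ _).trans (by linarith)
  have ht' : t.natAbs ≤ 4 * 4 ^ T := by zify; exact ht
  have : t.natAbs ^ 2 ≤ 2 ^ (4 * T + 4) := by
    calc t.natAbs ^ 2 ≤ (4 * 4 ^ T) ^ 2 := by gcongr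
      _ = 2 ^ (4 * T + 4) := by
        rw [show 4 = 2 ^ 2 by norm_num, ← pow_mul, ← pow_add, ← pow_mul]; congr 1; ring
  have := Nat.log_mono_right (b := 2) this
  rw [Nat.log_pow (by norm_num)] at this
  omega

/-- Few expansions over a stretch of length `T` are compatible with a congruence of the top rows
to a modulus that is large in terms of `T`. -/
theorem frame_eq_of_pellKey_transition_eq (hε : 0 < ε) (hε1 : ε ≤ 1) (hA : 0 < A)
    (hy : y = A * y') (h : Bad ε y) (h' : Bad ε y')
    (hT : (32 * 16 ^ T : ℝ) ^ 2 < gap ε * A) (hz : frame z n = frame y n)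
    (hz' : frame z' n = frame y n)
    (hdvd : (A : ℤ) ^ 2 ∣ (frame z (n + T) * (frame y (n + T))⁻¹) 0 1)
    (hdvd' : (A : ℤ) ^ 2 ∣ (frame z' (n + T) * (frame y (n + T))⁻¹) 0 1)
    (hkey : pellKey (transition y z n T) = pellKey (transition y z' n T)) :
    frame z (n + T) = frame z' (n + T) := by
  have hfr := isFrame_frame hε h n
  have hlin : ∀ w₁ w₂ : ℤ, (A : ℤ) ∣ frame y n 0 0 * w₁ + frame y n 0 1 * w₂ →
      |w₁| ≤ 32 * 16 ^ T → |w₂| ≤ 32 * 16 ^ T → w₁ = 0 ∧ w₂ = 0 := fun w₁ w₂ hd h1 h2 => by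
    by_contra hcon
    rw [not_and_or] at hcon
    have := gap_mul_le_sq hε hε1 hA hy h h' hfr hcon hd (M := 32 * 16 ^ T)
      (by exact_mod_cast h1) (by exact_mod_cast h2)
    linarith
  have hcop : IsCoprime (frame y n 0 0) (frame y n 0 1) :=
    ⟨frame y n 1 1, -frame y n 1 0, by linear_combination det_entry (frame y n)⟩
  rw [conj_transition_entry] at hdvd hdvd'
  have b := abs_transition_le (T := T) hz
  have b' := abs_transition_le (T := T) hz'
  set g := transition y z n T with hg
  set g' := transition y z' n T with hg'
  have e4 : (0 : ℤ) < 4 ^ T := by positivity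
  have e16 : (16 : ℤ) ^ T = 4 ^ T * 4 ^ T := by rw [← mul_pow]; norm_num
  have d : |g 1 1 - g 0 0| ≤ 4 * 4 ^ T := by
    have h1 := abs_le.1 (b 1 1)
    have h2 := abs_le.1 (b 0 0)
    rw [abs_le]; constructor <;> linarith
  have d' : |g' 1 1 - g' 0 0| ≤ 4 * 4 ^ T := by
    have h1 := abs_le.1 (b' 1 1)
    have h2 := abs_le.1 (b' 0 0)
    rw [abs_le]; constructor <;> linarith
  have b4 : ∀ i j, |g i j| ≤ 4 * 4 ^ T := fun i j => (b i j).trans (by linarith)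
  have b4' : ∀ i j, |g' i j| ≤ 4 * 4 ^ T := fun i j => (b' i j).trans (by linarith)
  have cross : ∀ p q r s : ℤ, |p| ≤ 4 * 4 ^ T → |q| ≤ 4 * 4 ^ T → |r| ≤ 4 * 4 ^ T →
      |s| ≤ 4 * 4 ^ T → |p * q - r * s| ≤ 32 * 16 ^ T := fun p q r s hp hq hr hs => by
    have i1 : |p| * |q| ≤ (4 * 4 ^ T) * (4 * 4 ^ T) :=
      mul_le_mul hp hq (abs_nonneg _) (by positivity)
    have i2 : |r| * |s| ≤ (4 * 4 ^ T) * (4 * 4 ^ T) :=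
      mul_le_mul hr hs (abs_nonneg _) (by positivity)
    calc |p * q - r * s| ≤ |p * q| + |r * s| := by
          rw [sub_eq_add_neg, ← abs_neg (r * s)]; exact abs_add_le _ _
      _ ≤ _ := by rw [abs_mul, abs_mul, e16]; linarith
  have n10 : |(-g 1 0)| ≤ 4 * 4 ^ T := by rw [abs_neg]; exact b4 1 0
  have n10' : |(-g' 1 0)| ≤ 4 * 4 ^ T := by rw [abs_neg]; exact b4' 1 0
  have hAA : (A : ℤ) ∣ (A : ℤ) ^ 2 := dvd_pow_self _ (by norm_num)
  obtain ⟨c1, c2, c3⟩ := cross_eq_zero_of_dvd hcop hlin (hAA.trans hdvd) (hAA.trans hdvd')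
    (cross _ _ _ _ (b4 0 1) d' (b4' 0 1) d) (cross _ _ _ _ (b4 0 1) n10' (b4' 0 1) n10)
    (cross _ _ _ _ d n10' d' n10)
  have hpar : (g 0 0 + g 1 1) ^ 2 = 4 → g 0 1 = 0 ∧ g 1 0 = 0 := fun h4 => by
    have small : ∀ i j, |2 * g i j| ≤ 32 * 16 ^ T := fun i j => by
      rw [abs_mul, abs_two, e16]
      nlinarith [b i j]
    obtain ⟨i1, i2⟩ := coeff_eq_zero_of_disc_eq_zero hlin hdvd
      (by linear_combination h4 - 4 * det_entry g) (small 0 1) (d.trans (by rw [e16]; nlinarith))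
      (by rw [mul_neg, abs_neg]; exact small 1 0)
    exact ⟨i1, by omega⟩
  have heq : g = g' := eq_of_pellKey_eq c1 (by linear_combination -c2) (by linear_combination c3)
    hpar hkey
  rw [hg, hg', transition, transition] at heq
  exact mul_left_cancel (mul_right_cancel heq)

end transition

end PAdicLittlewood

namespace PAdicLittlewood

section entropy

open Finset Classical

variable {E K : Type*} [Fintype E] [Fintype K] {f g : E → E → Prop}

/-- The size of the class of `x` under the relation `f`. -/
noncomputable def cnt (f : E → E → Prop) (x : E) : ℝ := ((univ.filter (f x)).card : ℝ)

theorem one_le_cnt (hf : ∀ x, f x x) (x : E) : 1 ≤ cnt f x := by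
  have : 0 < (univ.filter (f x)).card := card_pos.2 ⟨x, by simpa using hf x⟩
  unfold cnt
  exact_mod_cast this

theorem cnt_mono (h : ∀ x y, g x y → f x y) (x : E) : cnt g x ≤ cnt f x := by
  unfold cnt
  exact_mod_cast card_le_card fun y hy => by simpa using h x y (by simpa using hy)

theorem sum_cnt_div_le (hf : ∀ x y, f x y → f y x) (key : E → E → K)
    (hkey : ∀ x y z, f x y → f x z → key x y = key x z → g y z) :
    ∑ x, cnt f x / cnt g x ≤ Fintype.card K * Fintype.card E := by
  have hfiber : ∀ x k, ∑ y with f x y ∧ key x y = k, (cnt g y)⁻¹ ≤ 1 := fun x k => by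
    set S := univ.filter fun y => f x y ∧ key x y = k with hS
    rcases S.eq_empty_or_nonempty with h0 | h0
    · simp [h0]
    have hpos : (0 : ℝ) < S.card := by exact_mod_cast card_pos.2 h0
    calc ∑ y ∈ S, (cnt g y)⁻¹ ≤ ∑ _y ∈ S, (S.card : ℝ)⁻¹ := by
          refine sum_le_sum fun y hy => inv_anti₀ hpos ?_
          unfold cnt
          refine Nat.cast_le.2 (card_le_card fun z hz => ?_)
          simp only [hS, mem_filter, mem_univ, true_and] at hy hz ⊢
          exact hkey x y z hy.1 hz.1 (hy.2.trans hz.2.symm)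
      _ = 1 := by simp [hpos.ne']
  have hclass : ∀ x, ∑ y with f x y, (cnt g y)⁻¹ ≤ Fintype.card K := fun x => by
    rw [← sum_fiberwise (univ.filter (f x)) (key x)]
    calc ∑ k, ∑ y ∈ (univ.filter (f x)).filter (key x · = k), (cnt g y)⁻¹ ≤ ∑ _k : K, (1 : ℝ) :=
          sum_le_sum fun k _ => by rw [filter_filter]; exact hfiber x k
      _ = Fintype.card K := by simp
  calc ∑ x, cnt f x / cnt g x = ∑ x, ∑ y with f x y, (cnt g x)⁻¹ := by
        refine sum_congr rfl fun x _ => ?_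
        rw [sum_const, nsmul_eq_mul, div_eq_mul_inv, cnt]
    _ = ∑ x, ∑ y with f x y, (cnt g y)⁻¹ := by
        simp only [sum_filter]
        rw [sum_comm]
        refine sum_congr rfl fun x _ => sum_congr rfl fun y _ => ?_
        rw [show f y x ↔ f x y from ⟨hf _ _, hf _ _⟩]
    _ ≤ ∑ _x : E, (Fintype.card K : ℝ) := sum_le_sum fun x _ => hclass x
    _ = Fintype.card K * Fintype.card E := by simp [mul_comm]

theorem sum_log_cnt_sub_le [Nonempty K] (hf : ∀ x y, f x y → f y x) (hf' : ∀ x, f x x)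
    (hg' : ∀ x, g x x) (key : E → E → K)
    (hkey : ∀ x y z, f x y → f x z → key x y = key x z → g y z) :
    ∑ x, (Real.log (cnt f x) - Real.log (cnt g x)) ≤
      Real.log (Fintype.card K) * Fintype.card E := by
  have hK : (0 : ℝ) < Fintype.card K := by exact_mod_cast Fintype.card_pos
  have hpt : ∀ x, Real.log (cnt f x) - Real.log (cnt g x) ≤
      Real.log (Fintype.card K) + (cnt f x / cnt g x / Fintype.card K - 1) := fun x => by
    have h1 : 0 < cnt f x := by linarith [one_le_cnt hf' x]
    have h2 : 0 < cnt g x := by linarith [one_le_cnt hg' x]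
    have h3 := Real.log_le_sub_one_of_pos (x := cnt f x / cnt g x / Fintype.card K) (by positivity)
    rw [Real.log_div (by positivity) hK.ne', Real.log_div h1.ne' h2.ne'] at h3
    linarith
  refine (sum_le_sum fun x _ => hpt x).trans ?_
  rw [sum_add_distrib, sum_sub_distrib, ← sum_div]
  have h := sum_cnt_div_le hf key hkey
  have h' : (∑ x, cnt f x / cnt g x) / Fintype.card K ≤ Fintype.card E := by
    rw [div_le_iff₀ hK]; linarith
  simp only [sum_const, card_univ, nsmul_eq_mul, mul_one]
  linarith

theorem log_le_mul_one_sub_inv {A t : ℝ} (hA : 1 ≤ A) (ht : 1 ≤ t) :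
    Real.log t ≤ A * (1 - t⁻¹) + 2 / √A * t := by
  have ht0 : 0 < t := by linarith
  have hsA : 1 ≤ √A := Real.one_le_sqrt.2 hA
  have hsA2 : √A * √A = A := Real.mul_self_sqrt (by linarith)
  rcases le_total t A with h | h
  · have h1 := Real.log_le_sub_one_of_pos ht0
    have h2 : t - 1 ≤ A * (1 - t⁻¹) := by
      have : t - 1 = t * (1 - t⁻¹) := by field_simp
      rw [this]
      exact mul_le_mul_of_nonneg_right h (by linarith [inv_le_one_of_one_le₀ ht])
    have : 0 ≤ 2 / √A * t := by positivity
    linarith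
  · have h1 : 0 ≤ A * (1 - t⁻¹) := mul_nonneg (by linarith) (by linarith [inv_le_one_of_one_le₀ ht])
    have hst : √A ≤ √t := Real.sqrt_le_sqrt h
    have hst2 : √t * √t = t := Real.mul_self_sqrt ht0.le
    have hst0 : 0 < √t := by linarith
    have h2 : Real.log t ≤ 2 * √t := by
      have := Real.log_le_sub_one_of_pos hst0
      rw [Real.log_sqrt ht0.le] at this
      linarith
    have h3 : 2 * √t ≤ 2 / √A * t := by
      rw [div_mul_eq_mul_div, le_div_iff₀ (by linarith)]
      nlinarith
    linarith

theorem sum_log_cnt_sub_le_of_le {A : ℝ} (hA : 1 ≤ A) (hf : ∀ x y, f x y → f y x)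
    (hg' : ∀ x, g x x) (hgf : ∀ x y, g x y → f x y) (key : E → E → K)
    (hkey : ∀ x y z, f x y → f x z → key x y = key x z → g y z) :
    ∑ x, (Real.log (cnt f x) - Real.log (cnt g x)) ≤
      A * ∑ x, (1 - cnt g x / cnt f x) + 2 / √A * (Fintype.card K * Fintype.card E) := by
  have hpt : ∀ x, Real.log (cnt f x) - Real.log (cnt g x) ≤
      A * (1 - cnt g x / cnt f x) + 2 / √A * (cnt f x / cnt g x) := fun x => by
    have h2 := one_le_cnt hg' x
    have h1 := cnt_mono hgf x
    have h3 := log_le_mul_one_sub_inv hA (t := cnt f x / cnt g x)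
      ((one_le_div (by linarith)).2 h1)
    rwa [Real.log_div (by linarith) (by linarith), inv_div] at h3
  refine (sum_le_sum fun x _ => hpt x).trans ?_
  rw [sum_add_distrib, ← mul_sum, ← mul_sum]
  gcongr
  exact sum_cnt_div_le hf key hkey

/-- A symmetric weight of total mass at most one per point cannot charge pairs away from a small
set of points. -/
theorem sum_one_sub_cnt_div_le (hf : ∀ x y, f x y → f y x)
    (hft : ∀ x y z, f x y → f y z → f x z) (hf' : ∀ x, f x x) (hg : ∀ x y, g x y → g y x)
    (hgf : ∀ x y, g x y → f x y) (b : E → ℝ) (hb0 : ∀ x, 0 ≤ b x)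
    (hb : ∀ x y, f x y → ¬ g x y → 1 ≤ b x + b y) :
    ∑ x, (1 - cnt g x / cnt f x) ≤ 2 * ∑ x, b x := by
  have hpos : ∀ x, 0 < cnt f x := fun x => by linarith [one_le_cnt hf' x]
  have hcf : ∀ x y, f x y → cnt f x = cnt f y := fun x y h => by
    unfold cnt
    congr 2
    ext z
    simp only [mem_filter, mem_univ, true_and]
    exact ⟨fun h1 => hft _ _ _ (hf _ _ h) h1, fun h1 => hft _ _ _ h h1⟩
  set W : E → Finset E := fun x => univ.filter fun y => f x y ∧ ¬ g x y with hW
  have hcard : ∀ x, ((W x).card : ℝ) = cnt f x - cnt g x := fun x => by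
    have h1 := card_filter_add_card_filter_not (s := univ.filter (f x)) (g x)
    rw [filter_filter, filter_filter] at h1
    have h2 : (univ.filter fun y => f x y ∧ g x y) = univ.filter (g x) := by
      ext y
      simp only [mem_filter, mem_univ, true_and, and_iff_right_iff_imp]
      exact hgf x y
    rw [h2] at h1
    unfold cnt
    rw [← h1, hW]; push_cast; ring
  calc ∑ x, (1 - cnt g x / cnt f x) = ∑ x, ∑ y ∈ W x, (cnt f x)⁻¹ := by
        refine sum_congr rfl fun x _ => ?_
        rw [sum_const, nsmul_eq_mul, hcard]
        have := (hpos x).ne'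
        field_simp
    _ ≤ ∑ x, ∑ y ∈ W x, ((cnt f x)⁻¹ * b x + (cnt f x)⁻¹ * b y) := by
        refine sum_le_sum fun x _ => sum_le_sum fun y hy => ?_
        simp only [hW, mem_filter, mem_univ, true_and] at hy
        have := hb x y hy.1 hy.2
        have h0 := inv_pos.2 (hpos x)
        nlinarith
    _ = ∑ x, ∑ y ∈ W x, (cnt f x)⁻¹ * b x + ∑ x, ∑ y ∈ W x, (cnt f x)⁻¹ * b y := by
        simp only [sum_add_distrib]
    _ = 2 * ∑ x, ∑ y ∈ W x, (cnt f x)⁻¹ * b x := by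
        rw [two_mul]; congr 1
        simp only [hW, sum_filter]
        rw [sum_comm]
        refine sum_congr rfl fun x _ => sum_congr rfl fun y _ => ?_
        rw [show g y x ↔ g x y from ⟨hg _ _, hg _ _⟩, show f y x ↔ f x y from ⟨hf _ _, hf _ _⟩]
        split_ifs with h
        · rw [hcf x y h.1]
        · rfl
    _ ≤ 2 * ∑ x, b x := by
        refine mul_le_mul_of_nonneg_left (sum_le_sum fun x _ => ?_) zero_le_two
        rw [sum_const, nsmul_eq_mul, hcard, ← mul_assoc]
        refine mul_le_of_le_one_left (hb0 x) ?_
        rw [← div_eq_mul_inv, div_le_one (hpos x)]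
        unfold cnt
        have : (0 : ℝ) ≤ ((univ.filter (g x)).card : ℝ) := Nat.cast_nonneg _
        linarith

end entropy

section energy

open Finset Classical

variable {Ω : Type*} [Fintype Ω] {r r' : Ω → Ω → Prop}

/-- The average of `f` over the class of `p`. -/
noncomputable def avg (r : Ω → Ω → Prop) (f : Ω → ℝ) (p : Ω) : ℝ :=
  (∑ q with r p q, f q) / cnt r p

theorem filter_eq_of_rel (hr : Equivalence r) {p q : Ω} (h : r p q) :
    univ.filter (r p) = univ.filter (r q) := by
  ext z
  simp only [mem_filter, mem_univ, true_and]
  exact ⟨fun h1 => hr.trans (hr.symm h) h1, fun h1 => hr.trans h h1⟩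

theorem cnt_eq_of_rel (hr : Equivalence r) {p q : Ω} (h : r p q) : cnt r p = cnt r q := by
  unfold cnt; rw [filter_eq_of_rel hr h]

theorem cnt_pos_of_equivalence (hr : Equivalence r) (p : Ω) : 0 < cnt r p := by
  linarith [one_le_cnt hr.refl p]

theorem avg_eq_of_rel (hr : Equivalence r) (f : Ω → ℝ) {p q : Ω} (h : r p q) :
    avg r f p = avg r f q := by
  unfold avg; rw [filter_eq_of_rel hr h, cnt_eq_of_rel hr h]

theorem sum_avg_mul (hr : Equivalence r) (f g : Ω → ℝ) (hg : ∀ p q, r p q → g p = g q) :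
    ∑ p, avg r f p * g p = ∑ p, f p * g p := by
  calc ∑ p, avg r f p * g p = ∑ p, ∑ q with r p q, f q * g q / cnt r q := by
        refine sum_congr rfl fun p _ => ?_
        rw [avg, div_mul_eq_mul_div, sum_mul, sum_div]
        refine sum_congr rfl fun q hq => ?_
        have h : r p q := by simpa using hq
        rw [hg p q h, cnt_eq_of_rel hr h]
    _ = ∑ q, ∑ p with r q p, f q * g q / cnt r q := by
        simp only [sum_filter]
        rw [sum_comm]
        refine sum_congr rfl fun p _ => sum_congr rfl fun q _ => ?_
        rw [show r p q ↔ r q p from ⟨hr.symm, hr.symm⟩]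
    _ = ∑ p, f p * g p := by
        refine sum_congr rfl fun q _ => ?_
        rw [sum_const, nsmul_eq_mul]
        change cnt r q * _ = _
        have := (cnt_pos_of_equivalence hr q).ne'
        field_simp

theorem avg_sub (f g : Ω → ℝ) (p : Ω) :
    avg r (fun q => f q - g q) p = avg r f p - avg r g p := by
  simp only [avg, sum_sub_distrib, sub_div]

theorem avg_of_invariant (hr : Equivalence r) (g : Ω → ℝ) (hg : ∀ p q, r p q → g p = g q) (p : Ω) :
    avg r g p = g p := by
  rw [avg, sum_congr rfl fun q hq => (hg p q (by simpa using hq)).symm, sum_const, nsmul_eq_mul]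
  change cnt r p * _ / _ = _
  have := (cnt_pos_of_equivalence hr p).ne'
  field_simp

theorem avg_avg (hr : Equivalence r) (hr' : Equivalence r') (hfine : ∀ p q, r' p q → r p q)
    (f : Ω → ℝ) (p : Ω) : avg r (avg r' f) p = avg r f p := by
  have h1 := sum_avg_mul hr' f (fun q => if r p q then 1 else 0) fun q q' h => by
    rw [show r p q ↔ r p q' from
      ⟨fun h1 => hr.trans h1 (hfine _ _ h), fun h1 => hr.trans h1 (hr.symm (hfine _ _ h))⟩]
  simp only [mul_ite, mul_one, mul_zero, ← sum_filter] at h1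
  rw [avg, avg, h1]

theorem avg_sq_le (hr : Equivalence r) (f : Ω → ℝ) (p : Ω) :
    avg r f p ^ 2 ≤ avg r (fun q => f q ^ 2) p := by
  have hp := cnt_pos_of_equivalence hr p
  rw [avg, avg, div_pow, div_le_div_iff₀ (by positivity) hp]
  have h := sq_sum_le_card_mul_sum_sq (s := univ.filter (r p)) (f := f)
  change _ ≤ cnt r p * _ at h
  nlinarith

/-- The energy of `f` with respect to the partition `r`. -/
noncomputable def energy (r : Ω → Ω → Prop) (f : Ω → ℝ) : ℝ := ∑ p, avg r f p ^ 2

theorem energy_nonneg (r : Ω → Ω → Prop) (f : Ω → ℝ) : 0 ≤ energy r f :=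
  sum_nonneg fun _ _ => sq_nonneg _

theorem energy_le (hr : Equivalence r) (f : Ω → ℝ) : energy r f ≤ ∑ p, f p ^ 2 := by
  refine (sum_le_sum fun p _ => avg_sq_le hr f p).trans (le_of_eq ?_)
  have := sum_avg_mul hr (fun q => f q ^ 2) (fun _ => 1) fun _ _ _ => rfl
  simpa using this

theorem sum_avg_sub_sq (hr : Equivalence r) (hr' : Equivalence r')
    (hfine : ∀ p q, r' p q → r p q) (f : Ω → ℝ) :
    ∑ p, (avg r' f p - avg r f p) ^ 2 = energy r' f - energy r f := by
  have h1 := sum_avg_mul hr' f (avg r f) fun p q h => avg_eq_of_rel hr f (hfine _ _ h)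
  have h2 := sum_avg_mul hr f (avg r f) fun p q h => avg_eq_of_rel hr f h
  have h3 : ∀ p, (avg r' f p - avg r f p) ^ 2 =
      avg r' f p ^ 2 - 2 * (avg r' f p * avg r f p) + avg r f p * avg r f p := fun p => by ring
  simp only [h3, sum_add_distrib, sum_sub_distrib, ← mul_sum, h1, h2, energy]
  rw [← h2]
  simp only [← sq]
  ring

theorem energy_mono (hr : Equivalence r) (hr' : Equivalence r')
    (hfine : ∀ p q, r' p q → r p q) (f : Ω → ℝ) : energy r f ≤ energy r' f := by
  have := sum_avg_sub_sq hr hr' hfine f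
  have h0 : 0 ≤ ∑ p, (avg r' f p - avg r f p) ^ 2 := sum_nonneg fun _ _ => sq_nonneg _
  linarith

/-- Doob's maximal inequality for a finite chain of partitions. -/
theorem card_exists_avg_sub_gt_le {M : ℕ} {s : ℕ → Ω → Ω → Prop} (hs : ∀ k, Equivalence (s k))
    (hchain : ∀ k p q, s (k + 1) p q → s k p q) (f : Ω → ℝ) {η : ℝ} (hη : 0 < η) :
    ((univ.filter fun p => ∃ k ≤ M, η < |avg (s k) f p - avg (s 0) f p|).card : ℝ) * η ^ 2 ≤
      energy (s M) f - energy (s 0) f := by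
  have hmono : ∀ {j k : ℕ}, j ≤ k → ∀ p q, s k p q → s j p q := fun {j k} hjk => by
    induction hjk with
    | refl => exact fun _ _ h => h
    | step _ ih => exact fun p q h => ih p q (hchain _ p q h)
  set X : ℕ → Ω → ℝ := fun k p => avg (s k) f p - avg (s 0) f p with hX
  set bad : Ω → Prop := fun p => ∃ k ≤ M, η < |X k p| with hbad
  set first : ℕ → Ω → Prop := fun k p => η < |X k p| ∧ ∀ j < k, ¬ η < |X j p| with hfirst
  have hinv : ∀ k j, j ≤ k → ∀ p q, s k p q → X j p = X j q := fun k j hjk p q h => by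
    simp only [hX]
    rw [avg_eq_of_rel (hs j) f (hmono hjk p q h), avg_eq_of_rel (hs 0) f (hmono k.zero_le p q h)]
  have hfirst_inv : ∀ k p q, s k p q → (first k p ↔ first k q) := fun k p q h => by
    simp only [hfirst]
    rw [hinv k k le_rfl p q h]
    refine and_congr_right fun _ => forall₂_congr fun j hj => ?_
    rw [hinv k j hj.le p q h]
  have hXavg : ∀ k ≤ M, ∀ p, X k p = avg (s k) (X M) p := fun k hk p => by
    simp only [hX]
    rw [avg_sub, avg_avg (hs k) (hs M) (hmono hk), avg_of_invariant (hs k) (avg (s 0) f)]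
    exact fun p q h => avg_eq_of_rel (hs 0) f (hmono k.zero_le p q h)
  have hk : ∀ k ≤ M, ((univ.filter (first k)).card : ℝ) * η ^ 2 ≤
      ∑ p, X M p ^ 2 * if first k p then 1 else 0 := fun k hk => by
    rw [← sum_avg_mul (hs k) (fun p => X M p ^ 2) (fun p => if first k p then 1 else 0)
      fun p q h => if_congr (hfirst_inv k p q h) rfl rfl]
    rw [← nsmul_eq_mul, ← sum_const, sum_filter]
    refine sum_le_sum fun p _ => ?_
    by_cases hp : first k p
    swap
    · rw [if_neg hp, if_neg hp, mul_zero]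
    rw [if_pos hp, if_pos hp, mul_one]
    have h1 : η < |X k p| := hp.1
    refine le_trans ?_ (avg_sq_le (hs k) (X M) p)
    rw [← hXavg k hk p, ← sq_abs (X k p)]
    exact pow_le_pow_left₀ hη.le h1.le 2
  have huniq : ∀ p, ∑ k ∈ range (M + 1), (if first k p then (1 : ℝ) else 0) ≤ 1 := fun p => by
    rw [← sum_filter, sum_const, nsmul_eq_mul, mul_one]
    have : ((range (M + 1)).filter fun k => first k p).card ≤ 1 := by
      refine card_le_one.2 fun j hj k hk => ?_
      simp only [mem_filter] at hj hk
      by_contra hne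
      rcases lt_or_gt_of_ne hne with h | h
      · exact hk.2.2 j h hj.2.1
      · exact hj.2.2 k h hk.2.1
    exact_mod_cast this
  have hcover : univ.filter bad ⊆ (range (M + 1)).biUnion fun k => univ.filter (first k) := by
    intro p hp
    have hp' : ∃ k, k ≤ M ∧ η < |X k p| := by simpa [hbad] using hp
    simp only [mem_biUnion, mem_range, mem_filter, mem_univ, true_and]
    refine ⟨Nat.find hp', ?_, (Nat.find_spec hp').2, fun j hj hj' => ?_⟩
    · have := (Nat.find_spec hp').1; omega
    · exact Nat.find_min hp' hj ⟨hj.le.trans (Nat.find_spec hp').1, hj'⟩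
  calc ((univ.filter bad).card : ℝ) * η ^ 2
      ≤ (∑ k ∈ range (M + 1), ((univ.filter (first k)).card : ℝ)) * η ^ 2 := by
        gcongr
        exact_mod_cast (card_le_card hcover).trans card_biUnion_le
    _ ≤ ∑ k ∈ range (M + 1), ∑ p, X M p ^ 2 * if first k p then 1 else 0 := by
        rw [sum_mul]
        exact sum_le_sum fun k hk' => hk k (by simp at hk'; omega)
    _ = ∑ p, X M p ^ 2 * ∑ k ∈ range (M + 1), if first k p then (1 : ℝ) else 0 := by
        rw [sum_comm]; simp only [mul_sum]
    _ ≤ ∑ p, X M p ^ 2 := sum_le_sum fun p _ => mul_le_of_le_one_right (sq_nonneg _) (huniq p)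
    _ = energy (s M) f - energy (s 0) f := sum_avg_sub_sq (hs 0) (hs M) (hmono M.zero_le) f

theorem card_avg_indicator_lt_le {G : Type*} [Fintype G] (hr : Equivalence r) (D : Ω → G)
    {ρ : ℝ} (hρ : 0 ≤ ρ) :
    ((univ.filter fun p => avg r (fun q => if D q = D p then 1 else 0) p < ρ).card : ℝ) ≤
      Fintype.card G * ρ * Fintype.card Ω := by
  have hd : ∀ d : G, ∑ p, (if D p = d then (1 : ℝ) else 0) *
      (if avg r (fun q => if D q = d then 1 else 0) p < ρ then 1 else 0) ≤
        ρ * Fintype.card Ω := fun d => by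
    rw [← sum_avg_mul hr (fun p => if D p = d then (1 : ℝ) else 0) _
      fun p q h => by rw [avg_eq_of_rel hr _ h]]
    calc _ ≤ ∑ _p : Ω, ρ := sum_le_sum fun p _ => by
          split_ifs with h
          · linarith
          · simpa using hρ
      _ = ρ * Fintype.card Ω := by simp [mul_comm]
  calc _ = ∑ p, (if avg r (fun q => if D q = D p then 1 else 0) p < ρ then (1 : ℝ) else 0) := by
        rw [← sum_filter, sum_const, nsmul_eq_mul, mul_one]
    _ = ∑ p, ∑ d : G, (if D p = d then (1 : ℝ) else 0) *
      (if avg r (fun q => if D q = d then 1 else 0) p < ρ then 1 else 0) := by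
        refine sum_congr rfl fun p _ => ?_
        simp only [ite_mul, one_mul, zero_mul]
        rw [sum_ite_eq]
        simp
    _ ≤ ∑ _d : G, ρ * Fintype.card Ω := by
        rw [sum_comm]; exact sum_le_sum fun d _ => hd d
    _ = Fintype.card G * ρ * Fintype.card Ω := by simp [mul_assoc]

end energy

section windows

open Finset Classical

variable {ι G : Type*} {N : ℕ}

/-- The letter of the orbit `x` at position `k`, or `none` outside of `[0, N)`. -/
def extLetter (N : ℕ) (lett : ι → ℕ → Bool) (x : ι) (k : ℤ) : Option Bool :=
  if 0 ≤ k ∧ k < N then some (lett x k.toNat) else none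

/-- Two positions are related if their letters in the window from `-s` to `t` agree. -/
def SameWindow (lett : ι → ℕ → Bool) (s t : ℕ) (p q : ι × Fin N) : Prop :=
  ∀ i : ℤ, -s ≤ i → i ≤ t →
    extLetter N lett p.1 (p.2 + i) = extLetter N lett q.1 (q.2 + i)

variable {lett : ι → ℕ → Bool} {D : ι → ℕ → G} {gen : Bool → G}

theorem sameWindow_equivalence (s t : ℕ) :
    Equivalence (SameWindow (N := N) lett s t) where
  refl _ _ _ _ := rfl
  symm h i h1 h2 := (h i h1 h2).symm
  trans h h' i h1 h2 := (h i h1 h2).trans (h' i h1 h2)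

theorem SameWindow.mono {s t s' t' : ℕ} (hs : s ≤ s') (ht : t ≤ t') {p q : ι × Fin N}
    (h : SameWindow lett s' t' p q) : SameWindow lett s t p q :=
  fun i h1 h2 => h i (by omega) (by omega)

theorem extLetter_eq_some {x : ι} {k : ℕ} (hk : k < N) :
    extLetter N lett x k = some (lett x k) := by
  rw [extLetter, if_pos ⟨by omega, by omega⟩]; simp

theorem extLetter_eq_none_iff {x : ι} {k : ℤ} :
    extLetter N lett x k = none ↔ ¬ (0 ≤ k ∧ k < N) := by
  unfold extLetter; split_ifs with h <;> simp [h]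

theorem SameWindow.lt_of_lt {s t i : ℕ} {p q : ι × Fin N} (h : SameWindow lett s t p q)
    (hi : i ≤ t) (hp : p.2 + i < N) : (q.2 : ℕ) + i < N := by
  by_contra hq
  have h1 := h i (by omega) (by omega)
  rw [(extLetter_eq_none_iff (x := q.1)).2 (show ¬ (0 ≤ _ ∧ _ < (N : ℤ)) by omega),
    extLetter_eq_none_iff] at h1
  exact h1 (by omega)

theorem SameWindow.letter_eq {s t i : ℕ} {p q : ι × Fin N} (h : SameWindow lett s t p q)
    (hi : i ≤ t) (hp : p.2 + i < N) : lett p.1 (p.2 + i) = lett q.1 (q.2 + i) := by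
  have hq := h.lt_of_lt hi hp
  have h1 := h i (by omega) (by omega)
  rw [← Nat.cast_add, ← Nat.cast_add, extLetter_eq_some hp, extLetter_eq_some hq] at h1
  exact Option.some.inj h1

theorem cocycle_eq_of_letter_eq [Group G] (hD : ∀ x n, D x (n + 1) = D x n * gen (lett x n)) {x y : ι}
    {n k : ℕ} {τ : ℕ} (h : ∀ i < τ, lett x (n + i) = lett y (k + i)) :
    (D x n)⁻¹ * D x (n + τ) = (D y k)⁻¹ * D y (k + τ) := by
  induction τ with
  | zero => simp
  | succ τ ih =>
    rw [← add_assoc, ← add_assoc, hD, hD, ← mul_assoc, ← mul_assoc, ih fun i hi => h i (by omega),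
      h τ (by omega)]

variable [Fintype ι]

/-- The proportion of the value `d` in the window class of `p`. -/
noncomputable def prop (lett : ι → ℕ → Bool) (D : ι → ℕ → G) (s t : ℕ) (d : G) (p : ι × Fin N) :
    ℝ :=
  avg (SameWindow lett s t) (fun q => if D q.1 q.2 = d then 1 else 0) p

theorem prop_shift [Group G] (hD : ∀ x n, D x (n + 1) = D x n * gen (lett x n)) {x : ι} {n τ m : ℕ}
    (hn : n < N) (hτ : n + τ < N) (d : G) :
    prop lett D m (m + τ) d (x, (⟨n, hn⟩ : Fin N)) =
      prop lett D (m + τ) m (d * ((D x n)⁻¹ * D x (n + τ))) (x, (⟨n + τ, hτ⟩ : Fin N)) := by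
  set p : ι × Fin N := (x, ⟨n, hn⟩) with hp
  set p' : ι × Fin N := (x, ⟨n + τ, hτ⟩) with hp'
  set S := univ.filter (SameWindow lett m (m + τ) p) with hS
  set S' := univ.filter (SameWindow lett (m + τ) m p') with hS'
  have hup : ∀ q ∈ S, (q.2 : ℕ) + τ < N := fun q hq => by
    rw [hS, mem_filter] at hq
    exact hq.2.lt_of_lt (by omega) hτ
  have hdown : ∀ q ∈ S', τ ≤ (q.2 : ℕ) := fun q hq => by
    rw [hS', mem_filter] at hq
    have h1 := hq.2 (-τ) (by omega) (by omega)
    by_contra hcon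
    rw [(extLetter_eq_none_iff (x := q.1)).2 (show ¬ (0 ≤ _ ∧ _ < (N : ℤ)) by omega),
      extLetter_eq_none_iff] at h1
    refine h1 ?_
    simp only [hp']
    omega
  have hmap : ∀ q (hq : q ∈ S), (q.1, (⟨q.2 + τ, hup q hq⟩ : Fin N)) ∈ S' := fun q hq => by
    have hq' := (mem_filter.1 hq).2
    refine mem_filter.2 ⟨mem_univ _, fun i h1 h2 => ?_⟩
    have := hq' (i + τ) (by push_cast at h1; omega) (by push_cast; omega)
    simp only [hp, hp'] at this ⊢
    push_cast
    rw [show (n : ℤ) + τ + i = n + (i + τ) by ring, this]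
    congr 1; ring
  have hmap' : ∀ q (hq : q ∈ S'), (q.1, (⟨q.2 - τ, by omega⟩ : Fin N)) ∈ S := fun q hq => by
    have hq' := (mem_filter.1 hq).2
    have hle := hdown q hq
    refine mem_filter.2 ⟨mem_univ _, fun i h1 h2 => ?_⟩
    have := hq' (i - τ) (by push_cast; omega) (by push_cast at h2; omega)
    simp only [hp, hp'] at this ⊢
    push_cast [hle] at this ⊢
    rw [show (n : ℤ) + i = n + τ + (i - τ) by ring, this]
    congr 1; ring
  have hsum : ∑ q ∈ S, (if D q.1 q.2 = d then (1 : ℝ) else 0) =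
      ∑ q ∈ S', if D q.1 q.2 = d * ((D x n)⁻¹ * D x (n + τ)) then (1 : ℝ) else 0 := by
    refine sum_bij' (fun q hq => (q.1, (⟨q.2 + τ, hup q hq⟩ : Fin N)))
      (fun q _ => (q.1, (⟨q.2 - τ, by omega⟩ : Fin N))) hmap hmap' (fun q hq => by simp)
      (fun q hq => ?_) (fun q hq => ?_)
    · ext <;> simp [hdown q hq]
    · have hq' := (mem_filter.1 hq).2
      have h1 : (D x n)⁻¹ * D x (n + τ) = (D q.1 q.2)⁻¹ * D q.1 (q.2 + τ) :=
        cocycle_eq_of_letter_eq hD fun i hi =>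
          hq'.letter_eq (by omega) (by simp only [hp]; omega)
      rw [h1]
      refine if_congr ?_ rfl rfl
      simp only
      constructor
      · intro h; rw [← h]; group
      · intro h
        rw [← mul_assoc] at h
        have h2 := mul_right_cancel ((one_mul _).trans h)
        exact (mul_inv_eq_one.1 h2.symm).symm
  have hcard : S.card = S'.card := by
    refine card_bij' (fun q hq => (q.1, (⟨q.2 + τ, hup q hq⟩ : Fin N)))
      (fun q _ => (q.1, (⟨q.2 - τ, by omega⟩ : Fin N))) hmap hmap' (fun q hq => by simp)
      (fun q hq => ?_)
    ext <;> simp [hdown q hq]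
  simp only [prop, avg, cnt]
  rw [← hS, ← hS', hcard, hsum]

theorem sum_energy_indicator_le [Fintype G] (s : ℕ) :
    ∑ d : G, energy (SameWindow (N := N) lett s s)
      (fun q => if D q.1 q.2 = d then 1 else 0) ≤ Fintype.card (ι × Fin N) := by
  calc _ ≤ ∑ d : G, ∑ q : ι × Fin N, (if D q.1 q.2 = d then (1 : ℝ) else 0) ^ 2 :=
        sum_le_sum fun d _ => energy_le (sameWindow_equivalence s s) _
    _ = ∑ _q : ι × Fin N, (1 : ℝ) := by
        rw [sum_comm]
        refine sum_congr rfl fun q _ => ?_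
        simp
    _ = Fintype.card (ι × Fin N) := by simp

theorem exists_small_increment {I : ℕ} (hI : 0 < I) (e : ℕ → ℝ) {V : ℝ}
    (h0 : 0 ≤ e 0) (hV : e I ≤ V) : ∃ i < I, e (i + 1) - e i ≤ V / I := by
  by_contra! hcon
  have h1 : ∑ i ∈ range I, (V / I : ℝ) < ∑ i ∈ range I, (e (i + 1) - e i) :=
    sum_lt_sum_of_nonempty ⟨0, by simpa using hI⟩ fun i hi => hcon i (by simpa using hi)
  rw [sum_range_sub, sum_const, card_range, nsmul_eq_mul, mul_div_cancel₀] at h1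
  · linarith
  · exact_mod_cast ne_of_gt hI

/-- Off a small set of positions, the distribution of the cocycle given the window of one of the
scales `m i` is almost invariant along the orbits. -/
theorem exists_good [Group G] [Fintype G]
    (hD : ∀ x n, D x (n + 1) = D x n * gen (lett x n)) {I : ℕ} (hI : 0 < I)
    {m : ℕ → ℕ} (hm : Monotone m) {η ρ : ℝ} (hη : 0 < η) (hρ : 0 ≤ ρ) :
    ∃ i < I, ∃ bad : Finset (ι × Fin N),
      (bad.card : ℝ) ≤ (2 / (I * η ^ 2) + Fintype.card G * ρ) * Fintype.card (ι × Fin N) ∧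
      (∀ x n τ, ∀ (hn : n < N) (hτ : n + τ < N), (x, (⟨n, hn⟩ : Fin N)) ∉ bad →
        (x, (⟨n + τ, hτ⟩ : Fin N)) ∉ bad → τ ≤ m (i + 1) - m i → ∀ d,
        |prop lett D (m i) (m i) d (x, (⟨n, hn⟩ : Fin N)) -
          prop lett D (m i) (m i) (d * ((D x n)⁻¹ * D x (n + τ)))
            (x, (⟨n + τ, hτ⟩ : Fin N))| ≤ 2 * η) ∧
      ∀ p ∉ bad, ρ ≤ prop lett D (m i) (m i) (D p.1 p.2) p := by
  set ind : G → ι × Fin N → ℝ := fun d q => if D q.1 q.2 = d then 1 else 0 with hind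
  set R : ℕ → ℕ → ι × Fin N → ι × Fin N → Prop := fun s t => SameWindow lett s t with hR
  obtain ⟨i, hi, hinc⟩ := exists_small_increment hI
    (fun i => ∑ d : G, energy (R (m i) (m i)) (ind d)) (V := Fintype.card (ι × Fin N))
    (sum_nonneg fun _ _ => energy_nonneg _ _) (sum_energy_indicator_le _)
  set M := m (i + 1) - m i with hM
  have hmi : m i + M = m (i + 1) := by have := hm (Nat.le_add_right i 1); omega
  set F : G → Finset (ι × Fin N) := fun d => univ.filter fun p => ∃ k ≤ M,
    η < |avg (R (m i) (m i + k)) (ind d) p - avg (R (m i) (m i + 0)) (ind d) p| with hF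
  set P : G → Finset (ι × Fin N) := fun d => univ.filter fun p => ∃ k ≤ M,
    η < |avg (R (m i + k) (m i)) (ind d) p - avg (R (m i + 0) (m i)) (ind d) p| with hP
  set Q : Finset (ι × Fin N) := univ.filter fun p =>
    avg (R (m i) (m i)) (fun q => if D q.1 q.2 = D p.1 p.2 then 1 else 0) p < ρ with hQ
  have hη2 : 0 < η ^ 2 := by positivity
  have hFc : ∀ d, ((F d).card : ℝ) * η ^ 2 ≤
      energy (R (m (i + 1)) (m (i + 1))) (ind d) - energy (R (m i) (m i)) (ind d) := fun d => by
    have h1 := card_exists_avg_sub_gt_le (M := M) (s := fun k => R (m i) (m i + k))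
      (fun k => sameWindow_equivalence _ _)
      (fun k p q h => SameWindow.mono le_rfl (by omega) h) (ind d) hη
    have h2 := energy_mono (sameWindow_equivalence (m i) (m i + M))
      (sameWindow_equivalence (m (i + 1)) (m (i + 1)))
      (fun p q h => SameWindow.mono (N := N) (lett := lett) (by omega) hmi.le h) (ind d)
    simp only [add_zero] at h1
    simp only [hF, add_zero]
    linarith
  have hPc : ∀ d, ((P d).card : ℝ) * η ^ 2 ≤
      energy (R (m (i + 1)) (m (i + 1))) (ind d) - energy (R (m i) (m i)) (ind d) := fun d => by
    have h1 := card_exists_avg_sub_gt_le (M := M) (s := fun k => R (m i + k) (m i))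
      (fun k => sameWindow_equivalence _ _)
      (fun k p q h => SameWindow.mono (by omega) le_rfl h) (ind d) hη
    have h2 := energy_mono (sameWindow_equivalence (m i + M) (m i))
      (sameWindow_equivalence (m (i + 1)) (m (i + 1)))
      (fun p q h => SameWindow.mono (N := N) (lett := lett) hmi.le (by omega) h) (ind d)
    simp only [add_zero] at h1
    simp only [hP, add_zero]
    linarith
  refine ⟨i, hi, univ.biUnion F ∪ univ.biUnion P ∪ Q, ?_, ?_, ?_⟩
  · have hQc : (Q.card : ℝ) ≤ Fintype.card G * ρ * Fintype.card (ι × Fin N) :=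
      card_avg_indicator_lt_le (sameWindow_equivalence (m i) (m i))
        (fun p : ι × Fin N => D p.1 p.2) hρ
    have hsum : ∀ S : G → Finset (ι × Fin N), (∀ d, ((S d).card : ℝ) * η ^ 2 ≤
        energy (R (m (i + 1)) (m (i + 1))) (ind d) - energy (R (m i) (m i)) (ind d)) →
        ((univ.biUnion S).card : ℝ) ≤ Fintype.card (ι × Fin N) / I / η ^ 2 := fun S hS => by
      rw [le_div_iff₀ hη2]
      calc ((univ.biUnion S).card : ℝ) * η ^ 2 ≤ (∑ d, ((S d).card : ℝ)) * η ^ 2 := by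
            gcongr; exact_mod_cast card_biUnion_le
        _ ≤ ∑ d, (energy (R (m (i + 1)) (m (i + 1))) (ind d) -
              energy (R (m i) (m i)) (ind d)) := by
            rw [sum_mul]; exact sum_le_sum fun d _ => hS d
        _ ≤ _ := by rw [sum_sub_distrib]; exact hinc
    have h1 := hsum F hFc
    have h2 := hsum P hPc
    have h3 : ((univ.biUnion F ∪ univ.biUnion P ∪ Q).card : ℝ) ≤
        (univ.biUnion F).card + (univ.biUnion P).card + Q.card := by
      exact_mod_cast (card_union_le _ _).trans (Nat.add_le_add_right (card_union_le _ _) _)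
    have h4 : (2 / (I * η ^ 2) + Fintype.card G * ρ) * Fintype.card (ι × Fin N) =
        Fintype.card (ι × Fin N) / I / η ^ 2 + Fintype.card (ι × Fin N) / I / η ^ 2 +
          Fintype.card G * ρ * Fintype.card (ι × Fin N) := by
      have : (I : ℝ) ≠ 0 := by exact_mod_cast hI.ne'
      field_simp; ring
    linarith
  · intro x n τ hn hτ h1 h2 hτM d
    simp only [mem_union, mem_biUnion, mem_univ, true_and, not_or, not_exists] at h1 h2
    have h3 := h1.1.1 d
    have h4 := h2.1.2 (d * ((D x n)⁻¹ * D x (n + τ)))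
    simp only [hF, hP, mem_filter, mem_univ, true_and, not_exists, not_and, not_lt,
      add_zero] at h3 h4
    have h5 := abs_le.1 (h3 τ hτM)
    have h6 := abs_le.1 (h4 τ hτM)
    have h7 := prop_shift hD (x := x) hn hτ (m := m i) d
    simp only [prop] at h7 ⊢
    simp only [hR, hind] at h5 h6
    rw [abs_le]
    constructor <;> linarith
  · intro p hp
    simp only [mem_union, not_or, hQ, mem_filter, mem_univ, true_and, not_lt] at hp
    exact hp.2

/-- If two pairs of positions off `bad` on two orbits have the same windows and the same initial
value of the cocycle, then all small powers of the holonomy occur inside the final window class. -/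
def PowersOccur [Group G] (lett : ι → ℕ → Bool) (D : ι → ℕ → G) (m M t₀ : ℕ)
    (bad : Finset (ι × Fin N)) : Prop :=
  ∀ p ∉ bad, ∀ p' ∉ bad, ∀ q ∉ bad, ∀ q' ∉ bad, p'.1 = p.1 → q'.1 = q.1 →
    p.2 ≤ p'.2 → q.2 ≤ q'.2 → p'.2 + m ≤ p.2 + M → q'.2 + m ≤ q.2 + M →
    SameWindow lett m m p q → SameWindow lett m m p' q' → D p.1 p.2 = D q.1 q.2 →
    ∀ t < t₀, ∃ w, SameWindow lett m m p' w ∧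
      D w.1 w.2 = (D q'.1 q'.2 * (D p'.1 p'.2)⁻¹) ^ t * D p'.1 p'.2

theorem exists_powersOccur [Group G] [Fintype G]
    (hD : ∀ x n, D x (n + 1) = D x n * gen (lett x n)) {I : ℕ} (hI : 0 < I)
    {m : ℕ → ℕ} (hm : Monotone m) {η ρ : ℝ} (hη : 0 < η) {t₀ : ℕ} (ht₀ : 4 * η * t₀ ≤ ρ) :
    ∃ i < I, ∃ bad : Finset (ι × Fin N),
      (bad.card : ℝ) ≤ (2 / (I * η ^ 2) + Fintype.card G * ρ) * Fintype.card (ι × Fin N) ∧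
      PowersOccur lett D (m i) (m (i + 1)) t₀ bad := by
  have hρ : 0 ≤ ρ := le_trans (by positivity) ht₀
  obtain ⟨i, hi, bad, hcard, hshift, hlow⟩ := exists_good (N := N) hD hI hm hη hρ
  refine ⟨i, hi, bad, hcard, ?_⟩
  have hshift' : ∀ p ∉ bad, ∀ p' ∉ bad, p'.1 = p.1 → p.2 ≤ p'.2 →
      p'.2 + m i ≤ p.2 + m (i + 1) → ∀ d, |prop lett D (m i) (m i) d p -
        prop lett D (m i) (m i) (d * ((D p.1 p.2)⁻¹ * D p'.1 p'.2)) p'| ≤ 2 * η := by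
    rintro ⟨x, n, hn⟩ hp ⟨x', n', hn'⟩ hp' (rfl : x' = x) hle hM d
    obtain ⟨τ, rfl⟩ : ∃ τ, n' = n + τ := ⟨n' - n, by simp at hle; omega⟩
    exact hshift x' n τ hn hn' hp hp' (by simp at hM; omega) d
  intro p hp p' hp' q hq q' hq' h1 h1' hle hle' hM hM' hpq hpq' hDpq t htt
  have ht : 4 * η * t < ρ := by
    have : (t : ℝ) < t₀ := by exact_mod_cast htt
    nlinarith
  set g := (D p'.1 p'.2)⁻¹ * D q'.1 q'.2 with hg
  have heq := sameWindow_equivalence (N := N) (lett := lett) (m i) (m i)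
  have hν : ∀ d, prop lett D (m i) (m i) d p = prop lett D (m i) (m i) d q :=
    fun d => avg_eq_of_rel heq _ hpq
  have hν' : ∀ d, prop lett D (m i) (m i) d p' = prop lett D (m i) (m i) d q' :=
    fun d => avg_eq_of_rel heq _ hpq'
  have hstep : ∀ d, prop lett D (m i) (m i) d p' ≤
      prop lett D (m i) (m i) (d * g) p' + 4 * η := fun d => by
    set d' := d * (D p'.1 p'.2)⁻¹ * D p.1 p.2 with hd'
    have e1 := abs_le.1 (hshift' p hp p' hp' h1 hle hM d')
    have e2 := abs_le.1 (hshift' q hq q' hq' h1' hle' hM' d')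
    rw [show d' * ((D p.1 p.2)⁻¹ * D p'.1 p'.2) = d by rw [hd']; group] at e1
    rw [← hDpq, show d' * ((D p.1 p.2)⁻¹ * D q'.1 q'.2) = d * g by rw [hd', hg]; group,
      ← hν, ← hν'] at e2
    linarith [e1.1, e1.2, e2.1, e2.2]
  have hpow : ∀ s : ℕ, ρ - 4 * η * s ≤
      prop lett D (m i) (m i) (D p'.1 p'.2 * g ^ s) p' := fun s => by
    induction s with
    | zero => simpa using hlow p' hp'
    | succ s ih =>
      have := hstep (D p'.1 p'.2 * g ^ s)
      rw [mul_assoc, ← pow_succ] at this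
      push_cast
      linarith
  have hpos : 0 < prop lett D (m i) (m i) (D p'.1 p'.2 * g ^ t) p' := by linarith [hpow t]
  have hne : ∑ w with SameWindow lett (m i) (m i) p' w,
      (if D w.1 w.2 = D p'.1 p'.2 * g ^ t then (1 : ℝ) else 0) ≠ 0 := fun h0 => by
    rw [prop, avg, h0, zero_div] at hpos
    exact lt_irrefl _ hpos
  obtain ⟨w, hw, hw'⟩ := exists_ne_zero_of_sum_ne_zero hne
  refine ⟨w, (mem_filter.1 hw).2, ?_⟩
  have h2 : D w.1 w.2 = D p'.1 p'.2 * g ^ t := by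
    by_contra h
    exact hw' (if_neg h)
  rw [h2, show D q'.1 q'.2 * (D p'.1 p'.2)⁻¹ = D p'.1 p'.2 * g * (D p'.1 p'.2)⁻¹ by
    rw [hg]; group, conj_pow]
  group

end windows

end PAdicLittlewood

namespace PAdicLittlewood

open Matrix Matrix.SpecialLinearGroup

section branch

/-- The expansions of `y` and `z` agree up to `n + w` and on the window of radius `w` around
`n + T + w`, and the frames at `n + T + w` differ by an element of `Γ(a ^ c) ∩ Γ⁰(a ^ k)`. -/
structure Twin (a c w T k n : ℕ) (y z : ℝ) : Prop where
  near : frame z n = frame y n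
  far : frame z (n + w) = frame y (n + w)
  window : ∀ s < w + w, letter z (n + T + s) = letter y (n + T + s)
  red_eq : red (a ^ c) (frame z (n + T + w)) = red (a ^ c) (frame y (n + T + w))
  dvd : (a : ℤ) ^ k ∣ (frame z (n + T + w) * (frame y (n + T + w))⁻¹) 0 1

variable {a c w T k n : ℕ} {x y z : ℝ}

theorem Twin.refl (y : ℝ) : Twin a c w T k n y y :=
  ⟨rfl, rfl, fun _ _ => rfl, rfl, by rw [mul_inv_cancel]; exact dvd_zero _⟩

theorem Twin.symm (h : Twin a c w T k n y z) : Twin a c w T k n z y :=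
  ⟨h.near.symm, h.far.symm, fun s hs => (h.window s hs).symm, h.red_eq.symm, by
    have h1 := h.dvd
    rw [← inv_inv (frame y (n + T + w) * _), inv_entry_zero_one, _root_.mul_inv_rev, inv_inv]
    exact h1.neg_right⟩

theorem Twin.trans (h : Twin a c w T k n x y) (h' : Twin a c w T k n y z) :
    Twin a c w T k n x z :=
  ⟨h'.near.trans h.near, h'.far.trans h.far, fun s hs => (h'.window s hs).trans (h.window s hs),
    h'.red_eq.trans h.red_eq, by
    have e : frame z (n + T + w) * (frame x (n + T + w))⁻¹ =
        (frame z (n + T + w) * (frame y (n + T + w))⁻¹) *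
          (frame y (n + T + w) * (frame x (n + T + w))⁻¹) := by group
    rw [e, mul_entry]
    exact dvd_add (h.dvd.mul_left _) (h'.dvd.mul_right _)⟩

theorem Twin.mono {k' : ℕ} (hk : k' ≤ k) (h : Twin a c w T k n y z) : Twin a c w T k' n y z :=
  ⟨h.near, h.far, h.window, h.red_eq, (pow_dvd_pow _ hk).trans h.dvd⟩

theorem Twin.frame_eq_mul (h : Twin a c w T k n y z) {s : ℕ} (hs : s ≤ w + w) :
    frame z (n + T + s) =
      (frame z (n + T + w) * (frame y (n + T + w))⁻¹) * frame y (n + T + s) := by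
  have key : ∀ s ≤ w + w, (frame z (n + T))⁻¹ * frame z (n + T + s) =
      (frame y (n + T))⁻¹ * frame y (n + T + s) := fun s hs =>
    cocycle_eq_of_letter_eq (D := frame) (gen := letterMat) frame_succ
      fun i hi => h.window i (by omega)
  have h1 := key s hs
  have h2 := key w (by omega)
  rw [inv_mul_eq_iff_eq_mul] at h1 h2
  rw [h1, h2]
  group

/-- The matrix in the row `j` steps above corresponding to an element of `Γ⁰(a ^ j)`. -/
theorem exists_conj_lift {H : SpecialLinearGroup (Fin 2) ℤ} {j : ℕ}
    (hH : red (a ^ c) H = 1) (hdvd : (a : ℤ) ^ (c + j) ∣ H 0 1)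
    (hndvd : ¬ (a : ℤ) ^ (c + j + 1) ∣ H 0 1) :
    ∃ G : SpecialLinearGroup (Fin 2) ℤ, G 0 0 = H 0 0 ∧ ((a ^ j : ℕ) : ℤ) * G 0 1 = H 0 1 ∧
      G 1 0 = ((a ^ j : ℕ) : ℤ) * H 1 0 ∧ G 1 1 = H 1 1 ∧ red (a ^ c) G = 1 ∧
      ¬ (a : ℤ) ^ (c + 1) ∣ G 0 1 := by
  obtain ⟨u, hu⟩ := hdvd
  obtain ⟨h00, -, h10, h11⟩ := dvd_of_red_eq_one hH
  have hdet := det_entry H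
  have hu' : H 0 1 = (a : ℤ) ^ j * (a ^ c * u) := by rw [hu]; ring
  refine ⟨⟨!![H 0 0, a ^ c * u; a ^ j * H 1 0, H 1 1], ?_⟩, rfl, ?_, ?_, rfl, ?_, ?_⟩
  · rw [Matrix.det_fin_two_of]
    rw [hu'] at hdet
    linear_combination hdet
  · refine Eq.trans ?_ hu'.symm
    rw [Nat.cast_pow]; rfl
  · rw [Nat.cast_pow]; rfl
  · rw [← map_one (red (a ^ c))]
    refine red_eq_of_dvd_sub fun i j' => ?_
    push_cast at h00 h10 h11 ⊢
    fin_cases i <;> fin_cases j'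
    · exact h00
    · change (a : ℤ) ^ c ∣ a ^ c * u - 0
      rw [sub_zero]; exact dvd_mul_right _ _
    · change (a : ℤ) ^ c ∣ a ^ j * H 1 0 - 0
      rw [sub_zero]; exact h10.mul_left _
    · exact h11
  · rintro ⟨v, hv⟩
    change (a : ℤ) ^ c * u = a ^ (c + 1) * v at hv
    refine hndvd ⟨v, ?_⟩
    rw [hu', hv]; ring

variable {E : Type*} {L N m M κ j : ℕ} {ε : ℝ} {X : E → ℝ}

/-- The orbit points considered: the rows `2 * c, …, 2 * c + L - 1` of the points `X e`. -/
noncomputable def orbitPt (a c : ℕ) (X : E → ℝ) (p : E × Fin L) : ℝ :=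
  (a : ℝ) ^ (2 * c + (p.2 : ℕ)) * X p.1

/-- At a branching pair one of the four positions in the row above is bad. -/
theorem mem_bad_of_twin {m₀ : ℕ} (ha : 2 ≤ a) (hc : 0 < c) (hε : 0 < ε) (hε1 : ε ≤ 1)
    (hgap : 9 / 4 < gap ε * 2 ^ c)
    (hm₀ : ((a : ℝ) ^ (2 * c)) ^ 2 * (1 + 1 / ε) ^ 4 * (1 - contr ε) ^ m₀ < ε ^ 2) (hmm : m₀ ≤ m)
    (hκ : (1 - contr ε) ^ κ ≤ ε ^ 2 * contr ε) (hκa : a * (1 - contr ε) ^ κ ≤ 1)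
    (hX : ∀ e l, Bad ε ((a : ℝ) ^ l * X e)) {bad : Finset ((E × Fin L) × Fin N)}
    (hbad : PowersOccur (fun p => letter (orbitPt a c X p))
      (fun p k => red (a ^ (2 * c)) (frame (orbitPt a c X p) k)) m M (a ^ c) bad)
    (hw : w = κ * (m + 2)) (hM : m + κ * (T + w + 1) ≤ M) (hN : κ * (n + T + w + j) + m < N)
    {e e' : E} {l : Fin L} {y z : ℝ} (hy : y = (a ^ j : ℕ) * orbitPt a c X (e, l))
    (hz : z = (a ^ j : ℕ) * orbitPt a c X (e', l))
    (htwin : Twin a c w T (c + j) n y z) (hnot : ¬ Twin a c w T (c + j + 1) n y z)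
    {f : E → ℕ → ℕ} (hf : ∀ e i, f e i =
      rowIdx (a ^ j) ((a ^ j : ℕ) * orbitPt a c X (e, l)) (orbitPt a c X (e, l)) i)
    (h1 : f e n < N) (h2 : f e (n + T + w) < N) (h3 : f e' n < N) (h4 : f e' (n + T + w) < N) :
    ((e, l), (⟨f e n, h1⟩ : Fin N)) ∈ bad ∨ ((e, l), (⟨f e (n + T + w), h2⟩ : Fin N)) ∈ bad ∨
      ((e', l), (⟨f e' n, h3⟩ : Fin N)) ∈ bad ∨
      ((e', l), (⟨f e' (n + T + w), h4⟩ : Fin N)) ∈ bad := by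
  by_contra! hcon
  obtain ⟨g1, g2, g3, g4⟩ := hcon
  set y' := orbitPt a c X (e, l) with hy'
  set z' := orbitPt a c X (e', l) with hz'
  have hA : 0 < a ^ j := pow_pos (by omega) _
  have hbady' : Bad ε y' := hX _ _
  have hbadz' : Bad ε z' := hX _ _
  have hrow_bad : ∀ e, Bad ε ((a ^ j : ℕ) * orbitPt a c X (e, l)) := fun e => by
    have := hX e (j + (2 * c + l))
    rwa [pow_add, mul_assoc, ← Nat.cast_pow a j] at this
  have hbady : Bad ε y := hy ▸ hrow_bad e
  have hbadz : Bad ε z := hz ▸ hrow_bad e'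
  have hfe : ∀ i, f e i = rowIdx (a ^ j) y y' i := fun i => by rw [hf, hy]
  have hfe' : ∀ i, f e' i = rowIdx (a ^ j) z z' i := fun i => by rw [hf, hz]
  have hAj : ((a ^ j : ℕ) : ℝ) * (1 - contr ε) ^ (κ * j) ≤ 1 := by
    rw [pow_mul, Nat.cast_pow, ← mul_pow]
    exact pow_le_one₀ (mul_nonneg (Nat.cast_nonneg _)
      (pow_nonneg (by linarith [contr_lt_one hε]) _)) hκa
  have bnd_y := rowIdx_le hε hA hy hbady hbady' hε1 hκ hAj
  have bnd_z := rowIdx_le hε hA hz hbadz hbadz' hε1 hκ hAj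
  set H := frame z (n + T + w) * (frame y (n + T + w))⁻¹ with hH
  have hredH : red (a ^ c) H = 1 := by
    rw [hH, map_mul, map_inv, htwin.red_eq, mul_inv_cancel]
  have hndvd : ¬ (a : ℤ) ^ (c + j + 1) ∣ H 0 1 := fun h =>
    hnot ⟨htwin.near, htwin.far, htwin.window, htwin.red_eq, h⟩
  obtain ⟨G, G00, G01, G10, G11, hredG, hG01⟩ :=
    exists_conj_lift hredH htwin.dvd hndvd
  have hfar := htwin.far
  rw [hw] at hfar
  have hpre := htwin.frame_eq_mul (s := 0) (by omega)
  have hmid := htwin.frame_eq_mul (s := w) (by omega)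
  have hpost := htwin.frame_eq_mul (s := w + w) (by omega)
  rw [← hH] at hpre hmid hpost
  rw [← add_assoc] at hpost
  have hmΦ : m ≤ rowIdx (a ^ j) y y' (n + T + w) := by
    have := lt_mul_rowIdx hε hA hy hbady hbady' hε1 hκ (n + T + w)
    rw [hw] at this ⊢
    have h5 : κ * (m + 2) < κ * (rowIdx (a ^ j) y y' (n + T + κ * (m + 2)) + 1) := by omega
    have := Nat.lt_of_mul_lt_mul_left h5
    omega
  have htr := rowIdx_transport hε hA hy hbady hbady' hz hbadz hbadz' hε1 hκ G00 G01 G10 G11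
    (n := n + T) (m := m) hpre (by rw [← hw]; exact hmid) (by rw [← hw]; exact hpost)
    (by rw [← hw]; exact hmΦ)
  rw [← hw] at htr
  obtain ⟨hmΦ', hframe, hlett⟩ := htr
  have hidx := rowIdx_eq_of_frame_eq hε hA hy hbady hbady' hz hbadz hbadz' hε1 hκ htwin.near hfar
  have hrow : ∀ k ≤ rowIdx (a ^ j) y y' n + m + 1, frame z' k = frame y' k := fun k hk =>
    frame_row_eq_of_frame_eq hε hA hy hbady hbady' hz hbadz hε1 hκ hfar hk
  have hbound : ∀ {y y' : ℝ} (_ : y = (a ^ j : ℕ) * y') (_ : Bad ε y) (_ : Bad ε y'),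
      rowIdx (a ^ j) y y' (n + T + w) + m ≤ rowIdx (a ^ j) y y' n + M := fun hy h h' => by
    have := rowIdx_add_le hε hA hy h h' hε1 hκ n (T + w)
    rw [← add_assoc] at this
    omega
  refine false_of_forall_pow_frame ha hc hε hε1 hgap hm₀ hbady' hredG hG01
    (n := rowIdx (a ^ j) y y' (n + T + w)) fun t ht => ?_
  obtain ⟨v, hv1, hv2⟩ := hbad _ g1 _ g2 _ g3 _ g4 rfl rfl
    (by simp only [Fin.mk_le_mk, hfe]
        exact rowIdx_mono hε hA hy hbady hbady' (by omega))
    (by simp only [Fin.mk_le_mk, hfe']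
        exact rowIdx_mono hε hA hz hbadz hbadz' (by omega))
    (by simp only [hfe]; exact hbound hy hbady hbady')
    (by simp only [hfe']; exact hbound hz hbadz hbadz')
    (by
      intro i hi1 hi2
      simp only [extLetter, hfe, hfe', hidx]
      split_ifs with hr
      · congr 1
        refine (letter_eq_of_frame_eq (G := 1) ?_ ?_).symm
        · rw [one_mul]; exact hrow _ (by omega)
        · rw [one_mul]; exact hrow _ (by omega)
      · rfl)
    (by
      intro i hi1 hi2
      simp only [extLetter, hfe, hfe']
      have b1 := bnd_y (n + T + w)
      have b2 := bnd_z (n + T + w)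
      rw [if_pos ⟨by omega, by omega⟩, if_pos ⟨by omega, by omega⟩]
      congr 1
      have := hlett (i + m).toNat (by omega)
      rw [show (((rowIdx (a ^ j) y y' (n + T + w) : ℕ) : ℤ) + i).toNat =
          rowIdx (a ^ j) y y' (n + T + w) - m + (i + m).toNat by omega,
        show (((rowIdx (a ^ j) z z' (n + T + w) : ℕ) : ℤ) + i).toNat =
          rowIdx (a ^ j) z z' (n + T + w) - m + (i + m).toNat by omega]
      exact this.symm)
    (by
      simp only [hfe, hfe', hidx]
      rw [hrow _ (by omega)])
    t ht
  refine ⟨orbitPt a c X v.1, (a : ℝ) ^ (v.1.2 : ℕ) * X v.1.1, v.2, ?_, hX _ _, hX _ _, ?_, ?_⟩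
  · rw [orbitPt, pow_add, mul_assoc]; push_cast; rfl
  · simp only [hfe, hfe', ← hy', ← hz'] at hv2
    rw [hv2]
    rw [hframe, map_mul, map_mul, map_pow, mul_inv_cancel_right]
  · intro s hs
    have hlt : rowIdx (a ^ j) y y' (n + T + w) + s < N := by
      have b1 := bnd_y (n + T + w)
      omega
    have := hv1.letter_eq (i := s) (by omega) (by simp only [hfe]; exact hlt)
    simp only [hfe] at this
    exact this.symm

end branch

section counting

open Finset

variable {E : Type*} [Fintype E] {Y : E → ℝ} {a c w T n : ℕ} {ε : ℝ}

theorem frame_eq_of_floor_eq {y z : ℝ} (h0 : ⌊y⌋ = ⌊z⌋) (h : ∀ s < n, letter y s = letter z s) :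
    frame y n = frame z n := by
  have h1 : frame y 0 = frame z 0 := Subtype.ext (by simp only [frame, h0])
  have := frame_add_eq_of_letter_eq (P := 1) (Q := 1) (k := 0) (n := 0) (y := y) (z := z) (m := n)
    (by rw [h1]) (by simpa using h) le_rfl
  simpa using this

theorem IsFrame.abs_sub_le {B : SpecialLinearGroup (Fin 2) ℤ} {y z : ℝ} (hy : IsFrame B y)
    (hz : IsFrame B z) : |y - z| ≤ len B := by
  have key : ∀ {y z : ℝ}, IsFrame B y → IsFrame B z → y - z ≤ len B := fun {y z} hy hz => by
    have h1 : (0 : ℝ) < B 1 0 := by exact_mod_cast hy.right_pos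
    have h2 : (0 : ℝ) < B 1 1 := by exact_mod_cast hy.left_pos
    have h3 := det_entry_real B
    have h4 := hy.lt_right
    have h5 := hz.left_lt
    rw [len, le_div_iff₀ (by positivity)]
    nlinarith
  rw [abs_le]
  constructor
  · linarith [key hz hy]
  · exact key hy hz

/-- Points whose frames at level `n` agree. -/
def SameFrame (Y : E → ℝ) (n : ℕ) (e e' : E) : Prop := frame (Y e') n = frame (Y e) n

/-- The keys separating the points of a frame class up to `Twin` of level `c`. -/
abbrev TwinKey (a c w : ℕ) : Type :=
  (Fin w → Bool) × (Fin (w + w) → Bool) × SpecialLinearGroup (Fin 2) (ZMod (a ^ c))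

/-- The keys separating the points of a deep `Twin` class. -/
abbrev PellKey (T : ℕ) : Type := SignType × SignType × SignType × Fin (4 * T + 5)

theorem card_pellKey (T : ℕ) : Fintype.card (PellKey T) = 27 * (4 * T + 5) := by
  simp only [PellKey, Fintype.card_prod, Fintype.card_fin]
  rw [show Fintype.card SignType = 3 from rfl]
  ring

open Classical in
theorem sum_log_sameFrame_sub_twin_le [Fintype (TwinKey a c w)] :
    ∑ e, (Real.log (cnt (SameFrame Y n) e) -
      Real.log (cnt (fun e e' => Twin a c w T c n (Y e) (Y e')) e)) ≤
        Real.log (Fintype.card (TwinKey a c w)) * Fintype.card E := by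
  refine sum_log_cnt_sub_le (fun x y h => h.symm) (fun x => rfl) (fun x => Twin.refl _)
    (fun _ e => ((fun s => letter (Y e) (n + s), fun s => letter (Y e) (n + T + s),
      red (a ^ c) (frame (Y e) (n + T + w))) : TwinKey a c w)) fun x y z hy hz hkey => ?_
  simp only [Prod.mk.injEq] at hkey
  obtain ⟨k1, k2, k3⟩ := hkey
  have hyz : frame (Y z) n = frame (Y y) n := hz.trans hy.symm
  refine ⟨hyz, ?_, fun s hs => (congrFun k2 ⟨s, hs⟩).symm, k3.symm, ?_⟩
  · have := frame_add_eq_of_letter_eq (P := 1) (Q := 1) (k := n) (n := n) (y := Y z) (z := Y y)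
      (m := w) (by rw [hyz]) (fun s hs => (congrFun k1 ⟨s, hs⟩).symm) le_rfl
    simpa using this
  · have h1 : red (a ^ c) (frame (Y z) (n + T + w) * (frame (Y y) (n + T + w))⁻¹) = 1 := by
      rw [map_mul, map_inv, k3, mul_inv_cancel]
    exact_mod_cast (dvd_of_red_eq_one h1).2.1

open Classical in
theorem sum_log_twin_sub_twin_le [NeZero a] {A : ℝ} (hA : 1 ≤ A) (k : ℕ) :
    ∑ e, (Real.log (cnt (fun e e' => Twin a c w T k n (Y e) (Y e')) e) -
      Real.log (cnt (fun e e' => Twin a c w T (k + 1) n (Y e) (Y e')) e)) ≤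
        A * ∑ e, (1 - cnt (fun e e' => Twin a c w T (k + 1) n (Y e) (Y e')) e /
          cnt (fun e e' => Twin a c w T k n (Y e) (Y e')) e) +
        2 / √A * (a ^ 2 * Fintype.card E) := by
  have hcard : ((Fintype.card (ZMod a × ZMod a) : ℕ) : ℝ) = a ^ 2 := by
    rw [Fintype.card_prod, ZMod.card]; push_cast; ring
  rw [← hcard]
  set H : E → E → SpecialLinearGroup (Fin 2) ℤ :=
    fun e e' => frame (Y e') (n + T + w) * (frame (Y e) (n + T + w))⁻¹ with hH
  refine sum_log_cnt_sub_le_of_le hA (fun x y h => h.symm) (fun x => Twin.refl _)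
    (fun x y h => h.mono (Nat.le_succ k))
    (fun e e' => (((H e e' 0 0 : ℤ) : ZMod a), ((H e e' 0 1 / (a : ℤ) ^ k : ℤ) : ZMod a)))
    fun x y z hy hz hkey => ?_
  have hyz := hy.symm.trans hz
  refine ⟨hyz.near, hyz.far, hyz.window, hyz.red_eq, ?_⟩
  simp only [Prod.mk.injEq] at hkey
  obtain ⟨k1, k2⟩ := hkey
  have ha : (a : ℤ) ^ k ≠ 0 := pow_ne_zero _ (by exact_mod_cast NeZero.ne a)
  obtain ⟨u, hu⟩ := hy.dvd
  obtain ⟨v, hv⟩ := hz.dvd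
  change H x y 0 1 = _ at hu
  change H x z 0 1 = _ at hv
  rw [hu, hv, Int.mul_ediv_cancel_left _ ha, Int.mul_ediv_cancel_left _ ha] at k2
  have d1 := (ZMod.intCast_eq_intCast_iff_dvd_sub _ _ _).1 k1
  have d2 := (ZMod.intCast_eq_intCast_iff_dvd_sub _ _ _).1 k2
  have e1 : frame (Y z) (n + T + w) * (frame (Y y) (n + T + w))⁻¹ = H x z * (H x y)⁻¹ := by
    simp only [hH]; group
  rw [e1, mul_entry, inv_entry_zero_one, inv_entry_one_one, hu, hv, pow_succ]
  refine (mul_dvd_mul_left ((a : ℤ) ^ k)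
    (dvd_sub (d2.mul_left (H x y 0 0)) (d1.mul_left u))).trans (dvd_of_eq ?_)
  ring

open Classical in
theorem sum_log_twin_sub_sameFrame_le {J A : ℕ} {Y' : E → ℝ} (hε : 0 < ε) (hε1 : ε ≤ 1)
    (hA : 0 < A) (hY : ∀ e, Y e = A * Y' e) (hb : ∀ e, Bad ε (Y e)) (hb' : ∀ e, Bad ε (Y' e))
    (hT : (32 * 16 ^ (T + w) : ℝ) ^ 2 < gap ε * A) (hJ : (A : ℤ) ^ 2 ∣ (a : ℤ) ^ J) :
    ∑ e, (Real.log (cnt (fun e e' => Twin a c w T J n (Y e) (Y e')) e) -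
      Real.log (cnt (SameFrame Y (n + T + w)) e)) ≤
        Real.log (27 * (4 * (T + w : ℕ) + 5) : ℕ) * Fintype.card E := by
  rw [← card_pellKey]
  refine sum_log_cnt_sub_le (fun x y h => h.symm) (fun x => Twin.refl _) (fun x => rfl)
    (fun e e' => (((pellKey (transition (Y e) (Y e') n (T + w))).1,
      (pellKey (transition (Y e) (Y e') n (T + w))).2.1,
      (pellKey (transition (Y e) (Y e') n (T + w))).2.2.1,
      Fin.ofNat _ (pellKey (transition (Y e) (Y e') n (T + w))).2.2.2) : PellKey (T + w)))
    fun x y z hy hz hkey => ?_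
  simp only [Prod.mk.injEq] at hkey
  obtain ⟨k1, k2, k3, k4⟩ := hkey
  have k4' := congrArg Fin.val k4
  simp only [Fin.val_ofNat] at k4'
  rw [Nat.mod_eq_of_lt (log_pellKey_transition_lt hy.near),
    Nat.mod_eq_of_lt (log_pellKey_transition_lt hz.near)] at k4'
  have h1 := hJ.trans hy.dvd
  have h2 := hJ.trans hz.dvd
  rw [add_assoc] at h1 h2
  unfold SameFrame
  rw [add_assoc]
  exact (frame_eq_of_pellKey_transition_eq hε hε1 hA (hY x) (hb x) (hb' x) hT hy.near hz.near h1 h2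
    (Prod.ext k1 (Prod.ext k2 (Prod.ext k3 k4')))).symm

/-- The number of points in terms of the sizes of the frame classes. -/
theorem card_mul_log_le_sum [NeZero a] {X : E → ℝ} (hX : ∀ e, 0 ≤ X e ∧ X e < 1) (l : ℕ) :
    Fintype.card E * (Real.log (Fintype.card E) - l * Real.log a - n * Real.log 2) ≤
      ∑ e, Real.log (cnt (SameFrame (fun e => (a : ℝ) ^ l * X e) n) e) := by
  have hlt : ∀ e, ⌊(a : ℝ) ^ l * X e⌋.toNat < a ^ l := fun e => by
    have ha : (0 : ℝ) < (a : ℝ) ^ l :=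
      pow_pos (by exact_mod_cast Nat.pos_of_ne_zero (NeZero.ne a)) _
    rw [Int.toNat_lt (Int.floor_nonneg.2 (mul_nonneg ha.le (hX e).1)), Int.floor_lt]
    push_cast
    nlinarith [hX e]
  have : Nonempty (Fin (a ^ l)) := ⟨⟨0, pow_pos (Nat.pos_of_ne_zero (NeZero.ne a)) _⟩⟩
  have h := sum_log_cnt_sub_le (f := fun _ _ : E => True)
    (g := SameFrame (fun e => (a : ℝ) ^ l * X e) n) (fun _ _ h => h) (fun _ => trivial)
    (fun _ => rfl) (fun _ e => ((⟨⌊(a : ℝ) ^ l * X e⌋.toNat, hlt e⟩,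
      fun s => letter ((a : ℝ) ^ l * X e) s) : Fin (a ^ l) × (Fin n → Bool)))
    fun x y z _ _ hkey => by
      simp only [Prod.mk.injEq, Fin.mk.injEq] at hkey
      refine frame_eq_of_floor_eq ?_ fun s hs => (congrFun hkey.2 ⟨s, hs⟩).symm
      have hn : ∀ e, 0 ≤ ⌊(a : ℝ) ^ l * X e⌋ := fun e =>
        Int.floor_nonneg.2 (mul_nonneg (by positivity) (hX e).1)
      have := hn y
      have := hn z
      beta_reduce
      omega
  have hcnt : ∀ e : E, cnt (fun _ _ : E => True) e = Fintype.card E := fun e => by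
    simp [cnt]
  simp only [hcnt, sum_sub_distrib, sum_const, card_univ, nsmul_eq_mul, Fintype.card_prod,
    Fintype.card_fin, Fintype.card_fun, Fintype.card_bool] at h
  push_cast at h
  rw [Real.log_mul (by have := NeZero.ne a; positivity) (by positivity), Real.log_pow,
    Real.log_pow] at h
  linarith

theorem log_cnt_sameFrame_eq_zero {η : ℝ} (hε : 0 < ε) (hb : ∀ e, Bad ε (Y e))
    (hsep : ∀ e e', e ≠ e' → η ≤ |Y e - Y e'|) (hn : (1 - contr ε) ^ n < η) (e : E) :
    Real.log (cnt (SameFrame Y n) e) = 0 := by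
  classical
  have : univ.filter (SameFrame Y n e) = {e} := by
    ext e'
    simp only [mem_filter, mem_univ, true_and, mem_singleton]
    refine ⟨fun h => ?_, fun h => by rw [h]; rfl⟩
    by_contra hne
    have h1 := hsep e' e hne
    have h2 := (isFrame_frame hε (hb e') n)
    rw [h] at h2
    have h3 := h2.abs_sub_le (isFrame_frame hε (hb e) n)
    have h4 := (len_frame_bounds hε (hb e) n).2
    linarith
  rw [cnt]
  convert Real.log_one
  rw [← Nat.cast_one, Nat.cast_inj]
  convert card_singleton e

end counting

section rows

open Finset

variable {E : Type*} [Fintype E] {X : E → ℝ} {a c w T n : ℕ} {ε : ℝ}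

/-- The total proportion of the `Twin` classes of level `k` lost at level `k + 1`. -/
noncomputable def drop (a c w T n k : ℕ) (Y : E → ℝ) : ℝ :=
  ∑ e, (1 - cnt (fun e e' => Twin a c w T (k + 1) n (Y e) (Y e')) e /
    cnt (fun e e' => Twin a c w T k n (Y e) (Y e')) e)

theorem sum_log_sameFrame_sub_le [NeZero a] [Fintype (TwinKey a c w)] {J l : ℕ} {A : ℝ}
    (hA : 1 ≤ A) (hε : 0 < ε) (hε1 : ε ≤ 1) (hX : ∀ e l, Bad ε ((a : ℝ) ^ l * X e))
    (hJl : J ≤ l) (hT : (32 * 16 ^ (T + w) : ℝ) ^ 2 < gap ε * a ^ J) :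
    ∑ e, (Real.log (cnt (SameFrame (fun e => (a : ℝ) ^ l * X e) n) e) -
      Real.log (cnt (SameFrame (fun e => (a : ℝ) ^ l * X e) (n + T + w)) e)) ≤
        (Real.log (Fintype.card (TwinKey a c w)) + Real.log (27 * (4 * (T + w : ℕ) + 5) : ℕ) +
          (2 * J : ℕ) * (2 / √A * a ^ 2)) * Fintype.card E +
        A * ∑ j ∈ range (2 * J), drop a c w T n (c + j) (fun e => (a : ℝ) ^ l * X e) := by
  classical
  set Y : E → ℝ := fun e => (a : ℝ) ^ l * X e with hY
  have h1 := sum_log_sameFrame_sub_twin_le (Y := Y) (a := a) (c := c) (w := w) (T := T) (n := n)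
  have h3 := sum_log_twin_sub_sameFrame_le (Y := Y) (a := a) (c := c) (w := w) (T := T) (n := n)
    (J := c + 2 * J) (A := a ^ J) (Y' := fun e => (a : ℝ) ^ (l - J) * X e) hε hε1
    (pow_pos (Nat.pos_of_ne_zero (NeZero.ne a)) _)
    (fun e => by
      simp only [hY]
      rw [← mul_assoc, Nat.cast_pow, ← pow_add, Nat.add_sub_cancel' hJl])
    (fun e => hX e l) (fun e => hX e _) (by push_cast; exact hT)
    (by push_cast; rw [← pow_mul]; exact pow_dvd_pow _ (by omega))
  set Z : ℕ → ℝ := fun k => ∑ e, Real.log (cnt (fun e e' => Twin a c w T k n (Y e) (Y e')) e)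
    with hZ
  have h2 : Z c - Z (c + 2 * J) ≤ ∑ j ∈ range (2 * J),
      (A * drop a c w T n (c + j) Y + 2 / √A * (a ^ 2 * Fintype.card E)) := by
    have := sum_range_sub' (fun j => Z (c + j)) (2 * J)
    rw [add_zero] at this
    rw [← this]
    refine sum_le_sum fun j _ => ?_
    have := sum_log_twin_sub_twin_le (Y := Y) (a := a) (c := c) (w := w) (T := T) (n := n) hA
      (c + j)
    rw [sum_sub_distrib] at this
    exact this
  rw [sum_add_distrib, ← mul_sum, sum_const, card_range, nsmul_eq_mul] at h2
  rw [sum_sub_distrib] at h1 h3 ⊢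
  have e1 : Z c = ∑ e, Real.log (cnt (fun e e' => Twin a c w T c n (Y e) (Y e')) e) := rfl
  have e2 : Z (c + 2 * J) =
    ∑ e, Real.log (cnt (fun e e' => Twin a c w T (c + 2 * J) n (Y e) (Y e')) e) := rfl
  rw [← e1] at h1
  rw [← e2] at h3
  linear_combination h1 + h2 + h3

theorem card_mul_log_le [NeZero a] [Fintype (TwinKey a c w)] {J l N : ℕ} {A η : ℝ}
    (hA : 1 ≤ A) (hε : 0 < ε) (hε1 : ε ≤ 1) (hX : ∀ e l, Bad ε ((a : ℝ) ^ l * X e))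
    (hX1 : ∀ e, 0 ≤ X e ∧ X e < 1) (hsep : ∀ e e', e ≠ e' → η ≤ |X e - X e'|)
    (hN : (1 - contr ε) ^ N < η)
    (hJl : J ≤ l) (hT : (32 * 16 ^ (T + w) : ℝ) ^ 2 < gap ε * a ^ J) :
    (T + w : ℕ) * (Fintype.card E *
      (Real.log (Fintype.card E) - l * Real.log a - (T + w : ℕ) * Real.log 2)) ≤
        N * ((Real.log (Fintype.card (TwinKey a c w)) +
          Real.log (27 * (4 * (T + w : ℕ) + 5) : ℕ) +
          (2 * J : ℕ) * (2 / √A * a ^ 2)) * Fintype.card E) +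
        A * ∑ n ∈ range N, ∑ j ∈ range (2 * J),
          drop a c w T n (c + j) (fun e => (a : ℝ) ^ l * X e) := by
  have ha : 1 ≤ a := Nat.pos_of_ne_zero (NeZero.ne a)
  set Y : E → ℝ := fun e => (a : ℝ) ^ l * X e with hY
  set S : ℕ → ℝ := fun n => ∑ e, Real.log (cnt (SameFrame Y n) e) with hS
  have hS0 : ∀ n, N ≤ n → S n = 0 := fun n hn => by
    refine sum_eq_zero fun e _ => log_cnt_sameFrame_eq_zero (η := η) hε (fun e => hX e l)
      (fun e e' hne => ?_) (lt_of_le_of_lt ?_ hN) e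
    · refine (hsep e e' hne).trans ?_
      have h1 : (1 : ℝ) ≤ (a : ℝ) ^ l := one_le_pow₀ (by exact_mod_cast ha)
      rw [← mul_sub, abs_mul, abs_of_nonneg (zero_le_one.trans h1)]
      exact le_mul_of_one_le_left (abs_nonneg _) h1
    · exact pow_le_pow_of_le_one (rate_lt_one hε).1.le (rate_lt_one hε).2.le hn
  have h1 : ∑ n ∈ range (T + w), S n = ∑ n ∈ range N, (S n - S (n + T + w)) := by
    have e1 := sum_range_add S N (T + w)
    have e2 := sum_range_add S (T + w) N
    rw [add_comm (T + w) N, e1] at e2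
    rw [sum_eq_zero (s := range (T + w)) (f := fun x => S (N + x))
      fun i _ => hS0 _ (by omega), add_zero] at e2
    rw [sum_sub_distrib, e2, add_sub_assoc, ← sum_sub_distrib, left_eq_add]
    exact sum_eq_zero fun n _ => by rw [add_assoc n, add_comm n, sub_self]
  have h2 : (T + w : ℕ) * (Fintype.card E *
      (Real.log (Fintype.card E) - l * Real.log a - (T + w : ℕ) * Real.log 2)) ≤
        ∑ n ∈ range (T + w), S n := by
    rw [← nsmul_eq_mul]
    nth_rewrite 1 [← card_range (T + w)]
    refine card_nsmul_le_sum _ _ _ fun n hn => le_trans ?_ (card_mul_log_le_sum hX1 l)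
    have : (n : ℝ) ≤ (T + w : ℕ) := by exact_mod_cast (mem_range.1 hn).le
    have := Real.log_nonneg one_le_two
    gcongr
  refine h2.trans (h1.le.trans ?_)
  rw [mul_sum, ← nsmul_eq_mul]
  nth_rewrite 2 [← card_range N]
  rw [← sum_const, ← sum_add_distrib]
  refine sum_le_sum fun n _ => ?_
  have := sum_log_sameFrame_sub_le (n := n) (c := c) hA hε hε1 hX hJl hT
  rw [sum_sub_distrib] at this
  exact this

theorem card_filter_mem_le {κ N : ℕ} {g : ℕ → ℕ} (hg : ∀ n n', g n = g n' → n' < n + κ)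
    (S : Finset ℕ) : ((range N).filter (g · ∈ S)).card ≤ κ * S.card := by
  refine card_le_mul_card_image_of_maps_to (f := g) (fun n hn => (mem_filter.1 hn).2) κ
    fun i _ => ?_
  set F := ((range N).filter (g · ∈ S)).filter (g · = i) with hF
  rcases F.eq_empty_or_nonempty with h0 | h0
  · simp [h0]
  have hmin := (mem_filter.1 (F.min'_mem h0)).2
  calc F.card ≤ (Ico (F.min' h0) (F.min' h0 + κ)).card := by
        refine card_le_card fun n hn => mem_Ico.2 ⟨F.min'_le n hn, hg _ _ ?_⟩
        rw [hmin, (mem_filter.1 hn).2]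
    _ = κ := by simp

section badRow

open Classical in
/-- The bad indices on the orbit `p`. -/
noncomputable def badRow {ι : Type*} {N : ℕ} (bad : Finset (ι × Fin N)) (p : ι) : Finset ℕ :=
  (bad.filter (·.1 = p)).image fun q => (q.2 : ℕ)

theorem mem_badRow {ι : Type*} {N : ℕ} {bad : Finset (ι × Fin N)} {p : ι} {i : Fin N}
    (h : (p, i) ∈ bad) : (i : ℕ) ∈ badRow bad p := by
  classical
  exact mem_image.2 ⟨(p, i), mem_filter.2 ⟨h, rfl⟩, rfl⟩

theorem sum_card_badRow_le {ι : Type*} [Fintype ι] {N : ℕ} (bad : Finset (ι × Fin N)) :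
    ∑ p, (badRow bad p).card ≤ bad.card := by
  classical
  rw [card_eq_sum_card_fiberwise (f := Prod.fst) (t := univ) fun _ _ => mem_coe.2 (mem_univ _)]
  exact sum_le_sum fun p _ => card_image_le

end badRow

variable {m M N L κ j m₀ : ℕ} {bad : Finset ((E × Fin L) × Fin N)}

/-- The losses along a row are controlled by the bad positions of the row `j` steps above. -/
theorem sum_drop_le (ha : 2 ≤ a) (hc : 0 < c) (hε : 0 < ε) (hε1 : ε ≤ 1)
    (hgap : 9 / 4 < gap ε * 2 ^ c)
    (hm₀ : ((a : ℝ) ^ (2 * c)) ^ 2 * (1 + 1 / ε) ^ 4 * (1 - contr ε) ^ m₀ < ε ^ 2) (hmm : m₀ ≤ m)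
    (hκ : (1 - contr ε) ^ κ ≤ ε ^ 2 * contr ε) (hκa : a * (1 - contr ε) ^ κ ≤ 1)
    (hX : ∀ e l, Bad ε ((a : ℝ) ^ l * X e))
    (hbad : PowersOccur (fun p => letter (orbitPt a c X p))
      (fun p k => red (a ^ (2 * c)) (frame (orbitPt a c X p) k)) m M (a ^ c) bad)
    (hw : w = κ * (m + 2)) (hM : m + κ * (T + w + 1) ≤ M) {N' : ℕ}
    (hN : κ * (N' + T + w + j) + m < N) (l : Fin L) :
    ∑ n ∈ range N', drop a c w T n (c + j) (fun e => (a : ℝ) ^ (2 * c + l + j) * X e) ≤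
      4 * κ * ∑ e, ((badRow bad (e, l)).card : ℝ) := by
  classical
  have hA : 0 < a ^ j := pow_pos (by omega) _
  set Y : E → ℝ := fun e => (a : ℝ) ^ (2 * c + l + j) * X e with hY
  have hYe : ∀ e, Y e = (a ^ j : ℕ) * orbitPt a c X (e, l) := fun e => by
    simp only [hY, orbitPt]
    push_cast
    ring
  have hbY : ∀ e, Bad ε (Y e) := fun e => hX _ _
  have hbY' : ∀ e, Bad ε (orbitPt a c X (e, l)) := fun e => hX _ _
  have hAj : ((a ^ j : ℕ) : ℝ) * (1 - contr ε) ^ (κ * j) ≤ 1 := by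
    rw [pow_mul, Nat.cast_pow, ← mul_pow]
    exact pow_le_one₀ (mul_nonneg (Nat.cast_nonneg _)
      (pow_nonneg (by linarith [contr_lt_one hε]) _)) hκa
  set f : E → ℕ → ℕ := fun e i => rowIdx (a ^ j) (Y e) (orbitPt a c X (e, l)) i with hf
  have hfN : ∀ e, ∀ i ≤ N' + T + w, f e i < N := fun e i hi => by
    have h1 := rowIdx_le hε hA (hYe e) (hbY e) (hbY' e) hε1 hκ hAj i
    have h2 : κ * (i + j) ≤ κ * (N' + T + w + j) := Nat.mul_le_mul_left _ (by omega)
    simp only [hf]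
    omega
  set b : E → ℕ → ℝ := fun e i => if f e i ∈ badRow bad (e, l) then 1 else 0 with hbdef
  have hb0 : ∀ e i, 0 ≤ b e i := fun e i => by simp only [hbdef]; split_ifs <;> norm_num
  have hb1 : ∀ e i (h : f e i < N), ((e, l), (⟨f e i, h⟩ : Fin N)) ∈ bad → b e i = 1 :=
    fun e i h hmem => if_pos (mem_badRow hmem)
  have hdrop : ∀ n ∈ range N',
      drop a c w T n (c + j) Y ≤ 2 * ∑ e, (b e n + b e (n + T + w)) := fun n hn => by
    have hn' := mem_range.1 hn
    refine sum_one_sub_cnt_div_le (f := fun e e' => Twin a c w T (c + j) n (Y e) (Y e'))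
      (g := fun e e' => Twin a c w T (c + j + 1) n (Y e) (Y e')) (fun x y h => h.symm)
      (fun x y z h h' => h.trans h') (fun x => Twin.refl _) (fun x y h => h.symm)
      (fun x y h => h.mono (Nat.le_succ _)) (fun e => b e n + b e (n + T + w))
      (fun e => add_nonneg (hb0 _ _) (hb0 _ _)) fun e e' htwin hnot => ?_
    have hN' : κ * (n + T + w + j) + m < N := by
      have h2 : κ * (n + T + w + j) ≤ κ * (N' + T + w + j) := Nat.mul_le_mul_left _ (by omega)
      omega
    have p1 := hb0 e n
    have p2 := hb0 e (n + T + w)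
    have p3 := hb0 e' n
    have p4 := hb0 e' (n + T + w)
    rcases mem_bad_of_twin ha hc hε hε1 hgap hm₀ hmm hκ hκa hX hbad hw hM hN' (hYe e) (hYe e')
      htwin hnot (f := f) (fun e i => by simp only [hf, hYe]) (hfN e n (by omega))
      (hfN e _ (by omega)) (hfN e' n (by omega)) (hfN e' _ (by omega)) with h | h | h | h
    · have := hb1 _ _ _ h
      linarith
    · have := hb1 _ _ _ h
      linarith
    · have := hb1 _ _ _ h
      linarith
    · have := hb1 _ _ _ h
      linarith
  have hfib : ∀ e s, ∑ n ∈ range N', b e (n + s) ≤ κ * (badRow bad (e, l)).card := fun e s => by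
    simp only [hbdef]
    rw [sum_boole]
    exact_mod_cast card_filter_mem_le (g := fun n => f e (n + s)) (fun n n' h => by
      have := lt_add_of_rowIdx_eq hε hA (hYe e) (hbY e) (hbY' e) hε1 hκ h
      omega) (badRow bad (e, l))
  calc ∑ n ∈ range N', drop a c w T n (c + j) Y
      ≤ ∑ n ∈ range N', 2 * ∑ e, (b e n + b e (n + T + w)) := sum_le_sum hdrop
    _ = 2 * ∑ e, (∑ n ∈ range N', b e (n + 0) + ∑ n ∈ range N', b e (n + (T + w))) := by
        rw [← mul_sum, sum_comm]
        simp only [sum_add_distrib, add_zero, add_assoc]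
    _ ≤ 2 * ∑ e, (κ * ((badRow bad (e, l)).card : ℝ) + κ * (badRow bad (e, l)).card) := by
        gcongr with e
        · exact hfib e 0
        · exact hfib e _
    _ = 4 * κ * ∑ e, ((badRow bad (e, l)).card : ℝ) := by
        rw [mul_sum, mul_sum]
        exact sum_congr rfl fun e _ => by ring

end rows

section combined

open Finset

variable {E : Type*} [Fintype E] {X : E → ℝ} {a c w T m M N κ m₀ J R : ℕ} {ε : ℝ}
  {L : ℕ} {bad : Finset ((E × Fin L) × Fin N)}

/-- The entropy carried by all the rows is bounded in terms of the number of bad positions. -/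
theorem mul_card_mul_log_le [NeZero a] [Fintype (TwinKey a c w)]
    (ha : 2 ≤ a) (hc : 0 < c) (hε : 0 < ε) (hε1 : ε ≤ 1)
    (hgap : 9 / 4 < gap ε * 2 ^ c)
    (hm₀ : ((a : ℝ) ^ (2 * c)) ^ 2 * (1 + 1 / ε) ^ 4 * (1 - contr ε) ^ m₀ < ε ^ 2) (hmm : m₀ ≤ m)
    (hκ : (1 - contr ε) ^ κ ≤ ε ^ 2 * contr ε) (hκa : a * (1 - contr ε) ^ κ ≤ 1)
    (hX : ∀ e l, Bad ε ((a : ℝ) ^ l * X e))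
    (hX1 : ∀ e, 0 ≤ X e ∧ X e < 1) {η : ℝ} (hsep : ∀ e e', e ≠ e' → η ≤ |X e - X e'|)
    (hbad : PowersOccur (fun p => letter (orbitPt a c X p))
      (fun p k => red (a ^ (2 * c)) (frame (orbitPt a c X p) k)) m M (a ^ c) bad)
    (hL : 2 * J + R = L) (hw : w = κ * (m + 2)) (hM : m + κ * (T + w + 1) ≤ M) {N' : ℕ}
    (hN : κ * (N' + T + w + 2 * J) + m < N)
    (hN' : (1 - contr ε) ^ N' < η) (hT : (32 * 16 ^ (T + w) : ℝ) ^ 2 < gap ε * a ^ J)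
    {A : ℝ} (hA : 1 ≤ A) :
    R * ((T + w : ℕ) * (Fintype.card E * (Real.log (Fintype.card E) -
      (2 * c + 2 * J + R : ℕ) * Real.log a - (T + w : ℕ) * Real.log 2))) ≤
        R * (N' * ((Real.log (Fintype.card (TwinKey a c w)) +
          Real.log (27 * (4 * (T + w : ℕ) + 5) : ℕ) +
          (2 * J : ℕ) * (2 / √A * a ^ 2)) * Fintype.card E)) +
        A * ((2 * J : ℕ) * (4 * κ * bad.card)) := by
  subst hL
  have hrow : ∀ r ∈ range R, (T + w : ℕ) * (Fintype.card E * (Real.log (Fintype.card E) -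
      (2 * c + 2 * J + R : ℕ) * Real.log a - (T + w : ℕ) * Real.log 2)) ≤
        N' * ((Real.log (Fintype.card (TwinKey a c w)) +
          Real.log (27 * (4 * (T + w : ℕ) + 5) : ℕ) +
          (2 * J : ℕ) * (2 / √A * a ^ 2)) * Fintype.card E) +
        A * ∑ j ∈ range (2 * J), ∑ n ∈ range N',
          drop a c w T n (c + j) (fun e => (a : ℝ) ^ (2 * c + 2 * J + r) * X e) := fun r hr => by
    have h1 := card_mul_log_le (c := c) (l := 2 * c + 2 * J + r) hA hε hε1 hX hX1 hsep hN'
      (by omega) hT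
    rw [sum_comm] at h1
    refine le_trans ?_ h1
    have h2 : ((2 * c + 2 * J + r : ℕ) : ℝ) ≤ (2 * c + 2 * J + R : ℕ) := by
      exact_mod_cast Nat.add_le_add_left (mem_range.1 hr).le _
    have h3 : 0 ≤ Real.log a := Real.log_natCast_nonneg _
    gcongr
  have hdrop : ∀ j ∈ range (2 * J), ∑ r ∈ range R, ∑ n ∈ range N',
      drop a c w T n (c + j) (fun e => (a : ℝ) ^ (2 * c + 2 * J + r) * X e) ≤
        4 * κ * bad.card := fun j hj => by
    have hj' := mem_range.1 hj
    have hlt : ∀ r ∈ range R, 2 * J - j + r < 2 * J + R := fun r hr => by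
      have := mem_range.1 hr
      omega
    have h1 : ∀ r ∈ range R, ∑ n ∈ range N',
        drop a c w T n (c + j) (fun e => (a : ℝ) ^ (2 * c + 2 * J + r) * X e) ≤
          4 * κ * (if h : 2 * J - j + r < 2 * J + R then
            ∑ e, ((badRow bad (e, (⟨2 * J - j + r, h⟩ : Fin (2 * J + R)))).card : ℝ) else 0) :=
        fun r hr => by
      rw [dif_pos (hlt r hr)]
      have hN2 : κ * (N' + T + w + j) + m < N := by
        have h2 : κ * (N' + T + w + j) ≤ κ * (N' + T + w + 2 * J) :=
          Nat.mul_le_mul_left _ (by omega)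
        omega
      have := sum_drop_le ha hc hε hε1 hgap hm₀ hmm hκ hκa hX hbad hw hM hN2
        ⟨2 * J - j + r, hlt r hr⟩
      rwa [show 2 * c + (2 * J - j + r) + j = 2 * c + 2 * J + r by omega] at this
    refine (sum_le_sum h1).trans ?_
    rw [← mul_sum]
    refine mul_le_mul_of_nonneg_left ?_ (by positivity)
    set S : Fin (2 * J + R) → ℝ := fun l => ∑ e, ((badRow bad (e, l)).card : ℝ) with hS
    have h3 : ∑ l, S l ≤ bad.card := by
      have := sum_card_badRow_le bad
      rw [Fintype.sum_prod_type, sum_comm] at this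
      simp only [hS]
      exact_mod_cast this
    refine le_trans ?_ h3
    rw [← Fin.sum_univ_eq_sum_range
      (fun r => if h : 2 * J - j + r < 2 * J + R then S ⟨2 * J - j + r, h⟩ else 0)]
    have hinj : Function.Injective (fun r : Fin R =>
        (⟨2 * J - j + r, hlt r (mem_range.2 r.2)⟩ : Fin (2 * J + R))) := fun r r' h => by
      simp only [Fin.mk.injEq] at h
      exact Fin.ext (by omega)
    have h4 : ∀ r : Fin R, (if h : 2 * J - j + r < 2 * J + R then S ⟨2 * J - j + r, h⟩ else 0) =
        S ⟨2 * J - j + r, hlt r (mem_range.2 r.2)⟩ := fun r => dif_pos _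
    rw [sum_congr rfl fun r _ => h4 r]
    rw [← sum_image (f := S) (g := fun r : Fin R =>
        (⟨2 * J - j + r, hlt r (mem_range.2 r.2)⟩ : Fin (2 * J + R))) hinj.injOn]
    exact sum_le_sum_of_subset_of_nonneg (subset_univ _) fun l _ _ =>
      sum_nonneg fun e _ => Nat.cast_nonneg _
  have h1 := sum_le_sum hrow
  simp only [sum_add_distrib, sum_const, card_range, nsmul_eq_mul] at h1
  rw [← mul_sum, sum_comm] at h1
  refine h1.trans ?_
  have h2 := sum_le_sum hdrop
  simp only [sum_const, card_range, nsmul_eq_mul] at h2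
  gcongr

end combined

section count

open Finset Filter

theorem eventually_add_log_le (B : ℝ) {τ : ℝ} (hτ : 0 < τ) :
    ∀ᶠ T : ℕ in atTop, B + Real.log (27 * (4 * T + 5) : ℕ) ≤ T * τ := by
  have h1 : ∀ᶠ x : ℝ in atTop, ‖Real.log x‖ ≤ τ / 216 * ‖x‖ :=
    Real.isLittleO_log_id_atTop.bound (by positivity)
  have h2 : Tendsto (fun T : ℕ => ((27 * (4 * T + 5) : ℕ) : ℝ)) atTop atTop :=
    tendsto_natCast_atTop_atTop.comp (tendsto_atTop_mono (fun T => by simp only [id]; omega) tendsto_id)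
  filter_upwards [h2.eventually h1,
    tendsto_natCast_atTop_atTop.eventually_ge_atTop ((B + τ) * 2 / τ)] with T h3 h4
  rw [div_le_iff₀ hτ] at h4
  rw [Real.norm_eq_abs, Real.norm_eq_abs, abs_of_nonneg (a := ((27 * (4 * T + 5) : ℕ) : ℝ))
    (Nat.cast_nonneg _)] at h3
  have h5 := (le_abs_self _).trans h3
  push_cast at h5 ⊢
  nlinarith

theorem not_entropy_le {x T J R L C N κ Lg s k q A b β NΩ δ : ℝ} (hx : 0 < x) (hT : 0 < T)
    (hC : 0 < C) (hJ : J = C * T) (hR : 0 < R) (hL : L ≤ 2 * R) (hN : 0 < N) (hκ : 0 < κ)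
    (hA : 1 ≤ A) (hβ : 0 ≤ β) (hΩ : 0 ≤ NΩ) (hδ : 0 < δ)
    (h : R * (T * (x * (Lg - s))) ≤
      R * (κ * N * ((k + 2 * J * q) * x)) + A * (2 * J * (4 * κ * b)))
    (hb : b ≤ β * (x * L * NΩ)) (hLg : δ * N / 2 ≤ Lg - s)
    (hk : k ≤ T * (δ / (8 * κ))) (hq : κ * (2 * C * q) ≤ δ / 8) (hNΩ : NΩ ≤ 2 * κ ^ 2 * N)
    (hAβ : 32 * A * κ ^ 3 * β * C ≤ δ / 8) : False := by
  have hJ0 : 0 < J := by rw [hJ]; positivity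
  have h2 : A * (2 * J * (4 * κ * b)) ≤ A * (2 * J * (4 * κ * (β * (x * (2 * R) * NΩ)))) := by
    have : b ≤ β * (x * (2 * R) * NΩ) := hb.trans (by gcongr)
    gcongr
  have h3 : T * (Lg - s) ≤ κ * N * (k + 2 * J * q) + 16 * A * κ * β * J * NΩ := by
    refine le_of_mul_le_mul_left ?_ (mul_pos hR hx)
    linarith
  have hk' : κ * k ≤ T * (δ / 8) := by
    calc κ * k ≤ κ * (T * (δ / (8 * κ))) := by gcongr
      _ = T * (δ / 8) := by field_simp
  have h4 : T * (δ * N / 2) ≤ T * (Lg - s) := by gcongr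
  have h5 : 16 * A * κ * β * J * NΩ ≤ 16 * A * κ * β * J * (2 * κ ^ 2 * N) := by gcongr
  have h6 : 16 * A * κ * β * J * (2 * κ ^ 2 * N) ≤ T * N * (δ / 8) := by
    calc 16 * A * κ * β * J * (2 * κ ^ 2 * N) = T * N * (32 * A * κ ^ 3 * β * C) := by
          rw [hJ]; ring
      _ ≤ T * N * (δ / 8) := by gcongr
  have h7 : κ * N * (k + 2 * J * q) ≤ N * (T * (δ / 8)) + T * N * (δ / 8) := by
    calc κ * N * (k + 2 * J * q) = N * (κ * k) + T * N * (κ * (2 * C * q)) := by rw [hJ]; ring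
      _ ≤ N * (T * (δ / 8)) + T * N * (δ / 8) := by gcongr
  have : 0 < T * N * δ := by positivity
  linarith

/-- The tower condition used for the length of the transitions. -/
theorem sq_lt_gap_mul_pow {a c T : ℕ} {ε : ℝ} (hε : 0 < ε) (ha : 2 ≤ a)
    (hgap : 1024 < gap ε * 2 ^ c) (hT : 0 < T) :
    (32 * 16 ^ T : ℝ) ^ 2 < gap ε * a ^ ((c + 8) * T) := by
  have h1 : (2 : ℝ) ^ ((c + 8) * T) ≤ (a : ℝ) ^ ((c + 8) * T) :=
    pow_le_pow_left₀ zero_le_two (by exact_mod_cast ha) _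
  have h2 : (2 : ℝ) ^ c * 256 ^ T ≤ 2 ^ ((c + 8) * T) := by
    rw [show (256 : ℝ) = 2 ^ 8 by norm_num, ← pow_mul, ← pow_add]
    refine pow_le_pow_right₀ one_le_two ?_
    rw [add_mul]
    gcongr
    exact Nat.le_mul_of_pos_right _ hT
  have hg := gap_pos hε
  calc (32 * 16 ^ T : ℝ) ^ 2 = 1024 * 256 ^ T := by
        rw [mul_pow, ← pow_mul, mul_comm _ 2, pow_mul]; norm_num
    _ < gap ε * 2 ^ c * 256 ^ T := by gcongr
    _ ≤ gap ε * a ^ ((c + 8) * T) := by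
        rw [mul_assoc]
        gcongr
        exact h2.trans h1

theorem exists_pow_gap_lt {ε : ℝ} (hε : 0 < ε) (B : ℝ) : ∃ c, 0 < c ∧ B < gap ε * 2 ^ c := by
  have hg := gap_pos hε
  obtain ⟨n, hn⟩ := pow_unbounded_of_one_lt (B / gap ε) (one_lt_two (α := ℝ))
  refine ⟨n + 1, n.succ_pos, ?_⟩
  rw [div_lt_iff₀' hg] at hn
  rw [pow_succ]
  nlinarith [mul_pos hg (pow_pos (two_pos (α := ℝ)) n)]

set_option maxHeartbeats 1000000 in
/-- Separated sets of points with `ε`-bad orbits have subexponential size. -/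
theorem exists_forall_log_card_lt {a : ℕ} (ha : 2 ≤ a) {ε : ℝ} (hε : 0 < ε) (hε1 : ε ≤ 1) {δ : ℝ}
    (hδ : 0 < δ) : ∃ N₀ : ℕ, ∀ N ≥ N₀, ∀ (E : Type) [Fintype E] (X : E → ℝ),
      (∀ e l, Bad ε ((a : ℝ) ^ l * X e)) → (∀ e, 0 ≤ X e ∧ X e < 1) →
      (∀ e e', e ≠ e' → ((a : ℝ) ^ N)⁻¹ ≤ |X e - X e'|) →
      Real.log (Fintype.card E) < δ * N := by
  have : NeZero a := ⟨by omega⟩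
  have ha0 : (0 : ℝ) < a := by exact_mod_cast (by omega : 0 < a)
  obtain ⟨hr0, hr1⟩ := rate_lt_one hε
  have hcontr := contr_pos hε
  obtain ⟨c, hc, hgap⟩ := exists_pow_gap_lt hε (9 / 4)
  obtain ⟨c₁, -, hgap₁⟩ := exists_pow_gap_lt hε 1024
  obtain ⟨m₀, hm₀⟩ : ∃ m₀ : ℕ,
      ((a : ℝ) ^ (2 * c)) ^ 2 * (1 + 1 / ε) ^ 4 * (1 - contr ε) ^ m₀ < ε ^ 2 := by
    have hpos : 0 < ((a : ℝ) ^ (2 * c)) ^ 2 * (1 + 1 / ε) ^ 4 := by positivity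
    obtain ⟨m₀, h⟩ := exists_pow_lt_of_lt_one (div_pos (pow_pos hε 2) hpos) hr1
    exact ⟨m₀, by rwa [lt_div_iff₀' hpos] at h⟩
  obtain ⟨κ, hκ'⟩ := exists_pow_lt_of_lt_one
    (lt_min (mul_pos (pow_pos hε 2) hcontr) (inv_pos.2 ha0)) hr1
  obtain ⟨hκ, hκa⟩ := lt_min_iff.1 hκ'
  have hκa' : a * (1 - contr ε) ^ κ < 1 := by
    rwa [inv_eq_one_div, lt_div_iff₀' ha0] at hκa
  have hκ0 : 0 < κ := by
    rcases Nat.eq_zero_or_pos κ with rfl | h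
    · rw [pow_zero, mul_one] at hκa'
      have : (2 : ℝ) ≤ a := by exact_mod_cast ha
      linarith
    · exact h
  have hκr : (0 : ℝ) < κ := by exact_mod_cast hκ0
  set C : ℕ := c₁ + 8 with hC
  have hCr : (0 : ℝ) < C := by exact_mod_cast (by omega : 0 < C)
  have hinst : ∀ w, Finite (TwinKey a c w) := fun w => by infer_instance
  have hfin : Finite (SpecialLinearGroup (Fin 2) (ZMod (a ^ (2 * c)))) := by infer_instance
  let _ : ∀ w, Fintype (TwinKey a c w) := fun w => Fintype.ofFinite _
  let _ : Fintype (SpecialLinearGroup (Fin 2) (ZMod (a ^ (2 * c)))) := Fintype.ofFinite _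
  have hTf : ∀ m : ℕ, ∃ T : ℕ, κ * (m + 2) ≤ T ∧
      Real.log (Fintype.card (TwinKey a c (κ * (m + 2)))) + Real.log (27 * (4 * T + 5) : ℕ) ≤
        T * (δ / (8 * κ)) := fun m =>
    ((eventually_ge_atTop _).and (eventually_add_log_le _ (by positivity))).exists
  choose Tf hTf₁ hTf₂ using hTf
  set mm : ℕ → ℕ := fun i => Nat.rec m₀ (fun _ m => m + κ * (Tf m + 1)) i with hmm
  have hmm_succ : ∀ i, mm (i + 1) = mm i + κ * (Tf (mm i) + 1) := fun i => rfl
  have hmono : Monotone mm := monotone_nat_of_le_succ fun i => by rw [hmm_succ]; omega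
  set A : ℝ := (1 + 32 * κ * C * a ^ 2 / δ) ^ 2 with hA
  have hA1 : 1 ≤ A := one_le_pow₀ (le_add_of_nonneg_right (by positivity))
  have hq : κ * (2 * C * (2 / √A * a ^ 2)) ≤ δ / 8 := by
    rw [hA, Real.sqrt_sq (by positivity)]
    rw [show (κ : ℝ) * (2 * C * (2 / (1 + 32 * κ * C * a ^ 2 / δ) * a ^ 2)) =
      (4 * κ * C * a ^ 2) / (1 + 32 * κ * C * a ^ 2 / δ) by ring, div_le_iff₀ (by positivity)]
    have : δ / 8 * (1 + 32 * κ * C * a ^ 2 / δ) = δ / 8 + 4 * κ * C * a ^ 2 := by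
      field_simp; ring
    linarith
  set β : ℝ := δ / (256 * A * κ ^ 3 * C) with hβ
  have hβ0 : 0 < β := by positivity
  have hAβ : 32 * A * κ ^ 3 * β * C ≤ δ / 8 := by
    rw [hβ]
    apply le_of_eq
    field_simp
    norm_num
  set g : ℝ :=
    ((Fintype.card (SpecialLinearGroup (Fin 2) (ZMod (a ^ (2 * c)))) : ℕ) : ℝ) with hg
  have hg0 : 0 < g := by
    have := Fintype.card_pos (α := SpecialLinearGroup (Fin 2) (ZMod (a ^ (2 * c))))
    rw [hg]
    exact_mod_cast this
  set ρ : ℝ := β / (2 * g) with hρ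
  have hρ0 : 0 < ρ := by positivity
  set η : ℝ := ρ / (4 * a ^ c) with hη
  have hη0 : 0 < η := by positivity
  obtain ⟨I, hI⟩ := exists_nat_gt (4 / (β * η ^ 2))
  have hI0 : (0 : ℝ) < I := lt_of_le_of_lt (by positivity) hI
  have hfrac : 2 / (I * η ^ 2) + g * ρ ≤ β := by
    have h1 : g * ρ = β / 2 := by rw [hρ]; field_simp
    have h2 : 2 / (I * η ^ 2) ≤ β / 2 := by
      rw [div_lt_iff₀ (by positivity)] at hI
      rw [div_le_iff₀ (by positivity)]
      nlinarith
    linarith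
  set Tm : ℕ := ∑ i ∈ range I, Tf (mm i) with hTm
  have hTm_le : ∀ i < I, Tf (mm i) ≤ Tm := fun i hi =>
    single_le_sum (f := fun i => Tf (mm i)) (fun _ _ => Nat.zero_le _) (mem_range.2 hi)
  have hev : ∀ᶠ N : ℕ in atTop,
      (2 * c + 4 * (C * Tm) : ℕ) * Real.log a ≤ δ / 4 * N ∧ (Tm : ℝ) * Real.log 2 ≤ δ / 4 * N ∧
        κ * (Tm + 2 * (C * Tm)) + mm I + 1 ≤ N := by
    have ht : Tendsto (fun N : ℕ => δ / 4 * (N : ℝ)) atTop atTop :=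
      tendsto_natCast_atTop_atTop.const_mul_atTop (by positivity)
    exact (ht.eventually_ge_atTop _).and ((ht.eventually_ge_atTop _).and (eventually_ge_atTop _))
  obtain ⟨N₀, hN₀⟩ := eventually_atTop.1 hev
  refine ⟨N₀ + 1, fun N hN E _ X hX hX1 hsep => ?_⟩
  by_contra! hcon
  have hNr : (0 : ℝ) < N := by exact_mod_cast (by omega : 0 < N)
  have hE : 0 < Fintype.card E := by
    rcases Nat.eq_zero_or_pos (Fintype.card E) with h | h
    · rw [h, Nat.cast_zero, Real.log_zero] at hcon
      have : 0 < δ * N := by positivity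
      linarith
    · exact h
  obtain ⟨b1, b2, b3⟩ := hN₀ N (by omega)
  set NΩ : ℕ := κ * (κ * N + Tm + 2 * (C * Tm)) + mm I + 1 with hNΩ
  set L : ℕ := 4 * (C * Tm) with hL
  obtain ⟨i, hi, bad, hcard, hpow⟩ := exists_powersOccur (ι := E × Fin L) (N := NΩ)
    (lett := fun p => letter (orbitPt a c X p))
    (D := fun p k => red (a ^ (2 * c)) (frame (orbitPt a c X p) k))
    (gen := fun b => red (a ^ (2 * c)) (letterMat b))
    (fun p n => by rw [frame_succ, map_mul]) (by exact_mod_cast hI0) hmono hη0 (ρ := ρ)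
    (t₀ := a ^ c) (by rw [hη]; push_cast; apply le_of_eq; field_simp)
  have hcard' : (bad.card : ℝ) ≤ β * (Fintype.card E * L * NΩ) := by
    refine hcard.trans ?_
    rw [Fintype.card_prod, Fintype.card_prod, Fintype.card_fin, Fintype.card_fin, ← hg]
    push_cast
    gcongr
  set m := mm i with hm
  set T := Tf m with hT
  have hTle : T ≤ Tm := hTm_le i hi
  have hmI : m ≤ mm I := hmono hi.le
  have hTw : T - κ * (m + 2) + κ * (m + 2) = T := Nat.sub_add_cancel (hTf₁ _)
  have hT0 : 0 < T := lt_of_lt_of_le (by positivity) (hTf₁ m)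
  have hCT : C * T ≤ C * Tm := Nat.mul_le_mul_left _ hTle
  have hCT0 : 0 < C * T := by positivity
  have hmain := mul_card_mul_log_le (T := T - κ * (m + 2)) (w := κ * (m + 2))
    (N' := κ * N) (J := C * T) (R := L - 2 * (C * T)) ha hc hε hε1 hgap hm₀
    (hmono (Nat.zero_le i)) hκ.le hκa'.le hX hX1 hsep hpow (by omega) rfl
    (by rw [hTw, hmm_succ])
    (by
      rw [add_assoc (κ * N), hTw, hNΩ]
      have : κ * (κ * N + T + 2 * (C * T)) ≤ κ * (κ * N + Tm + 2 * (C * Tm)) :=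
        Nat.mul_le_mul_left _ (by omega)
      omega)
    (by
      rw [pow_mul, ← inv_pow]
      exact pow_lt_pow_left₀ hκa (pow_nonneg hr0.le _) (by omega))
    (by rw [hTw]; exact sq_lt_gap_mul_pow hε ha hgap₁ hT0) hA1
  rw [hTw] at hmain
  have hlog2 : (T : ℝ) * Real.log 2 ≤ Tm * Real.log 2 :=
    mul_le_mul_of_nonneg_right (by exact_mod_cast hTle) (Real.log_nonneg one_le_two)
  refine not_entropy_le (x := Fintype.card E) (T := T) (J := (C * T : ℕ))
    (R := (L - 2 * (C * T) : ℕ)) (L := L) (C := C) (N := N)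
    (κ := κ) (Lg := Real.log (Fintype.card E))
    (s := (2 * c + L : ℕ) * Real.log a + T * Real.log 2)
    (k := Real.log (Fintype.card (TwinKey a c (κ * (m + 2)))) +
      Real.log (27 * (4 * T + 5) : ℕ)) (q := 2 / √A * a ^ 2) (A := A) (b := bad.card)
    (β := β) (NΩ := NΩ) (δ := δ)
    (by exact_mod_cast hE) (by exact_mod_cast hT0) hCr (by push_cast; rfl)
    (by exact_mod_cast (by omega : 0 < L - 2 * (C * T)))
    (by exact_mod_cast (by omega : L ≤ 2 * (L - 2 * (C * T))))
    hNr hκr hA1 hβ0.le (Nat.cast_nonneg _) hδ ?_ hcard' ?_ (hTf₂ _) hq ?_ hAβ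
  · rw [show 2 * c + 2 * (C * T) + (L - 2 * (C * T)) = 2 * c + L by omega, sub_sub] at hmain
    push_cast at hmain ⊢
    exact hmain
  · linarith
  · have h2 : κ ^ 2 * N ≥ N := Nat.le_mul_of_pos_left _ (by positivity)
    have h1 : NΩ ≤ 2 * κ ^ 2 * N := by
      have h3 : NΩ = κ ^ 2 * N + (κ * (Tm + 2 * (C * Tm)) + mm I + 1) := by rw [hNΩ]; ring
      rw [h3]
      linarith
    exact_mod_cast h1

end count

end PAdicLittlewood

namespace PAdicLittlewood

section reduction

open Filter MeasureTheory
open scoped ENNReal NNReal Topology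

/-- A set which admits finitely many separated points only, has a maximal separated subset. -/
theorem exists_finset_net {S : Set ℝ} {r : ℝ} {C : ℕ}
    (h : ∀ s : Finset ℝ, ↑s ⊆ S → (∀ x ∈ s, ∀ y ∈ s, x ≠ y → r ≤ |x - y|) → s.card ≤ C)
    (hr : 0 < r) :
    ∃ s : Finset ℝ, ↑s ⊆ S ∧ (∀ x ∈ s, ∀ y ∈ s, x ≠ y → r ≤ |x - y|) ∧
      ∀ x ∈ S, ∃ y ∈ s, |x - y| ≤ r := by
  classical
  have hmem := Nat.sSup_mem (s := {n | ∃ s : Finset ℝ, ↑s ⊆ S ∧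
    (∀ x ∈ s, ∀ y ∈ s, x ≠ y → r ≤ |x - y|) ∧ s.card = n}) ⟨0, ∅, by simp, by simp, by simp⟩
    ⟨C, by rintro n ⟨s, h1, h2, rfl⟩; exact h s h1 h2⟩
  obtain ⟨s, h1, h2, h3⟩ := hmem
  refine ⟨s, h1, h2, fun x hx => ?_⟩
  by_contra! hcon
  have hxs : x ∉ s := fun hxs => by have := hcon x hxs; simp at this; linarith
  have hle : (insert x s).card ≤ s.card := by
    rw [h3]
    refine le_csSup ⟨C, by rintro n ⟨s, h1, h2, rfl⟩; exact h s h1 h2⟩ ⟨insert x s, ?_, ?_, rfl⟩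
    · rw [Finset.coe_insert]
      exact Set.insert_subset hx h1
    · intro y hy z hz hyz
      rcases Finset.mem_insert.1 hy with rfl | hys <;>
        rcases Finset.mem_insert.1 hz with rfl | hzs
      · exact absurd rfl hyz
      · exact (hcon z hzs).le
      · rw [abs_sub_comm]
        exact (hcon y hys).le
      · exact h2 y hys z hzs hyz
  rw [Finset.card_insert_of_notMem hxs] at hle
  omega

/-- A set of reals whose separated subsets grow subexponentially has Hausdorff dimension zero. -/
theorem dimH_eq_zero_of_log_card_lt {S : Set ℝ} {A : ℝ} (hA : 1 < A)
    (h : ∀ δ : ℝ, 0 < δ → ∃ N₀ : ℕ, ∀ N ≥ N₀, ∀ s : Finset ℝ, ↑s ⊆ S →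
      (∀ x ∈ s, ∀ y ∈ s, x ≠ y → (A ^ N)⁻¹ ≤ |x - y|) → Real.log s.card < δ * N) :
    dimH S = 0 := by
  have hA0 : 0 < A := by linarith
  refine nonpos_iff_eq_zero.1 (ENNReal.le_of_forall_pos_le_add fun d hd _ => ?_)
  rw [zero_add]
  refine dimH_le_of_hausdorffMeasure_ne_top ?_
  have hd' : (0 : ℝ) < d := hd
  obtain ⟨N₀, hN₀⟩ := h (d * Real.log A) (mul_pos hd' (Real.log_pos hA))
  have hcard : ∀ N ≥ N₀, ∀ s : Finset ℝ, ↑s ⊆ S →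
      (∀ x ∈ s, ∀ y ∈ s, x ≠ y → (A ^ N)⁻¹ ≤ |x - y|) →
      (s.card : ℝ) ≤ Real.exp (d * Real.log A * N) := by
    intro N hN s h1 h2
    rcases Nat.eq_zero_or_pos s.card with h0 | h0
    · rw [h0, Nat.cast_zero]
      exact (Real.exp_pos _).le
    · exact (Real.log_le_iff_le_exp (by exact_mod_cast h0)).1 (hN₀ N hN s h1 h2).le
  have hnet : ∀ n : ℕ, ∃ s : Finset ℝ,
      (s.card : ℝ) ≤ Real.exp (d * Real.log A * (n + N₀ : ℕ)) ∧
      ∀ x ∈ S, ∃ y ∈ s, |x - y| ≤ (A ^ (n + N₀))⁻¹ := by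
    intro n
    obtain ⟨s, h1, h2, h3⟩ := exists_finset_net (S := S) (r := (A ^ (n + N₀))⁻¹)
      (C := ⌊Real.exp (d * Real.log A * (n + N₀ : ℕ))⌋₊)
      (fun s h1 h2 => Nat.le_floor (hcard _ (by omega) s h1 h2)) (by positivity)
    exact ⟨s, hcard _ (by omega) s h1 h2, h3⟩
  choose s hs1 hs2 using hnet
  have hdiam : ∀ n (i : s n), Metric.ediam (Set.Icc ((i : ℝ) - (A ^ (n + N₀))⁻¹)
      ((i : ℝ) + (A ^ (n + N₀))⁻¹)) = ENNReal.ofReal (2 * (A ^ (n + N₀))⁻¹) := by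
    intro n i
    rw [Real.ediam_Icc]
    congr 1
    ring
  have hlim : Tendsto (fun n : ℕ => ENNReal.ofReal (2 * (A ^ (n + N₀))⁻¹)) atTop (𝓝 0) := by
    rw [← ENNReal.ofReal_zero]
    refine ENNReal.tendsto_ofReal ?_
    rw [← mul_zero (2 : ℝ)]
    refine Tendsto.const_mul _ (Tendsto.inv_tendsto_atTop ?_)
    exact (tendsto_pow_atTop_atTop_of_one_lt hA).comp (tendsto_add_atTop_nat N₀)
  have hle := Measure.hausdorffMeasure_le_liminf_sum (ι := fun n => s n) (d : ℝ) S
    (l := atTop) _ hlim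
    (fun n (i : s n) => Set.Icc ((i : ℝ) - (A ^ (n + N₀))⁻¹) ((i : ℝ) + (A ^ (n + N₀))⁻¹))
    (.of_forall fun n i => (hdiam n i).le)
    (.of_forall fun n x hx => by
      obtain ⟨y, hy, hxy⟩ := hs2 n x hx
      rw [abs_le] at hxy
      exact Set.mem_iUnion.2 ⟨⟨y, hy⟩, by constructor <;> dsimp only <;> linarith⟩)
  refine ne_top_of_le_ne_top (b := ENNReal.ofReal (2 ^ (d : ℝ))) ENNReal.ofReal_ne_top
    (hle.trans ?_)
  refine (liminf_le_liminf (v := fun _ => ENNReal.ofReal (2 ^ (d : ℝ)))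
    (.of_forall fun n => ?_)).trans_eq (liminf_const _)
  simp only [hdiam, Finset.sum_const, Finset.card_univ, Fintype.card_coe, nsmul_eq_mul]
  rw [ENNReal.ofReal_rpow_of_pos (by positivity), ← ENNReal.ofReal_natCast,
    ← ENNReal.ofReal_mul (by positivity)]
  refine ENNReal.ofReal_le_ofReal ?_
  rw [Real.mul_rpow (by norm_num) (by positivity), Real.inv_rpow (by positivity)]
  have hexp : Real.exp (d * Real.log A * (n + N₀ : ℕ)) = (A ^ (n + N₀)) ^ (d : ℝ) := by
    rw [Real.rpow_def_of_pos (by positivity), Real.log_pow]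
    congr 1
    ring
  have hp : 0 < (A ^ (n + N₀)) ^ (d : ℝ) := by positivity
  have := hs1 n
  rw [hexp] at this
  calc ((s n).card : ℝ) * (2 ^ (d : ℝ) * ((A ^ (n + N₀)) ^ (d : ℝ))⁻¹)
      ≤ (A ^ (n + N₀)) ^ (d : ℝ) * (2 ^ (d : ℝ) * ((A ^ (n + N₀)) ^ (d : ℝ))⁻¹) := by gcongr
    _ = 2 ^ (d : ℝ) := by field_simp

theorem Bad.mono {ε ε' y : ℝ} (h : Bad ε y) (hε : ε' ≤ ε) : Bad ε' y :=
  fun q hq r => hε.trans (h q hq r)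

theorem Bad.add_intCast {ε y : ℝ} (h : Bad ε y) (z : ℤ) : Bad ε (y + z) := fun q hq r => by
  have := h q hq (r - q * z)
  push_cast at this
  rwa [show (q : ℝ) * y - (r - q * z) = q * (y + z) - r by ring] at this

/-- The reals all of whose multiples by powers of `a` are badly approximable with constant `ε`. -/
def uniformlyBad (a : ℕ) (ε : ℝ) : Set ℝ := {x | ∀ l : ℕ, Bad ε ((a : ℝ) ^ l * x)}

theorem dimH_uniformlyBad_inter_Ico {a : ℕ} (ha : 2 ≤ a) {ε : ℝ} (hε : 0 < ε) (hε1 : ε ≤ 1) :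
    dimH (uniformlyBad a ε ∩ Set.Ico 0 1) = 0 := by
  refine dimH_eq_zero_of_log_card_lt (A := a) (by exact_mod_cast (by omega : 1 < a))
    fun δ hδ => ?_
  obtain ⟨N₀, hN₀⟩ := exists_forall_log_card_lt ha hε hε1 hδ
  refine ⟨N₀, fun N hN s hs hsep => ?_⟩
  have := hN₀ N hN s (fun x => (x : ℝ)) (fun e l => (hs e.2).1 l) (fun e => (hs e.2).2)
    (fun e e' hne => hsep e e.2 e' e'.2 fun h => hne (Subtype.ext h))
  rwa [Fintype.card_coe] at this

theorem dimH_uniformlyBad {a : ℕ} (ha : 2 ≤ a) {ε : ℝ} (hε : 0 < ε) (hε1 : ε ≤ 1) :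
    dimH (uniformlyBad a ε) = 0 := by
  have hsub : uniformlyBad a ε ⊆
      ⋃ z : ℤ, (fun x : ℝ => x + z) '' (uniformlyBad a ε ∩ Set.Ico 0 1) := by
    intro x hx
    refine Set.mem_iUnion.2 ⟨⌊x⌋, Int.fract x, ⟨fun l => ?_, Int.fract_nonneg x,
      Int.fract_lt_one x⟩, Int.fract_add_floor x⟩
    have := (hx l).add_intCast (-((a : ℤ) ^ l * ⌊x⌋))
    push_cast at this
    rwa [show (a : ℝ) ^ l * x + -((a : ℝ) ^ l * ⌊x⌋) = (a : ℝ) ^ l * Int.fract x by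
      rw [Int.fract]; ring] at this
  refine nonpos_iff_eq_zero.1 ((dimH_mono hsub).trans ?_)
  rw [dimH_iUnion]
  refine iSup_le fun z => ?_
  rw [(isometry_add_right (z : ℝ)).dimH_image, dimH_uniformlyBad_inter_Ico ha hε hε1]

theorem bddBelow_aAdicNorm (a : ℕ) (q : ℤ) :
    BddBelow {x : ℝ | ∃ n : ℕ, (a : ℤ) ^ n ∣ q ∧ x = ((a : ℝ) ^ n)⁻¹} :=
  ⟨0, by rintro x ⟨n, -, rfl⟩; positivity⟩

theorem aAdicNorm_le {a : ℕ} {q : ℤ} {n : ℕ} (h : (a : ℤ) ^ n ∣ q) :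
    aAdicNorm a q ≤ ((a : ℝ) ^ n)⁻¹ :=
  csInf_le (bddBelow_aAdicNorm a q) ⟨n, h, rfl⟩

theorem aAdicNorm_nonneg (a : ℕ) (q : ℤ) : 0 ≤ aAdicNorm a q :=
  Real.sInf_nonneg (by rintro x ⟨n, -, rfl⟩; positivity)

theorem aAdicNorm_pos {a : ℕ} (ha : 2 ≤ a) {q : ℤ} (hq : 0 < q) : 0 < aAdicNorm a q := by
  have hq' : (0 : ℝ) < q := by exact_mod_cast hq
  refine (inv_pos.2 hq').trans_le (le_csInf ⟨_, 0, by simp, rfl⟩ ?_)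
  rintro x ⟨n, hn, rfl⟩
  have ha' : (0 : ℝ) < a := by exact_mod_cast (by omega : 0 < a)
  exact inv_anti₀ (by positivity) (by exact_mod_cast Int.le_of_dvd hq hn)

theorem nearestIntDist_le (z : ℝ) (r : ℤ) : nearestIntDist z ≤ |z - r| :=
  ciInf_le ⟨0, by rintro x ⟨k, rfl⟩; exact abs_nonneg _⟩ r

theorem nearestIntDist_nonneg (z : ℝ) : 0 ≤ nearestIntDist z :=
  Real.iInf_nonneg fun _ => abs_nonneg _

theorem nearestIntDist_pos {z : ℝ} (hz : ∀ r : ℤ, z ≠ r) : 0 < nearestIntDist z := by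
  have h : 0 < |z - round z| := abs_pos.2 (sub_ne_zero.2 (hz _))
  exact h.trans_le (le_ciInf fun k => round_le z k)

theorem exists_mem_uniformlyBad {a : ℕ} (ha : 2 ≤ a) {u : ℝ}
    (hu : 0 < liminf (fun q : ℕ => (q : ℝ) * aAdicNorm a (q : ℤ) *
      nearestIntDist ((q : ℝ) * u)) atTop) :
    ∃ ε : ℝ, 0 < ε ∧ u ∈ uniformlyBad a ε := by
  set f : ℕ → ℝ := fun q => (q : ℝ) * aAdicNorm a (q : ℤ) * nearestIntDist ((q : ℝ) * u) with hf
  have hf0 : ∀ q, 0 ≤ f q := fun q =>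
    mul_nonneg (mul_nonneg (Nat.cast_nonneg q) (aAdicNorm_nonneg _ _)) (nearestIntDist_nonneg _)
  obtain ⟨c, hc0, hc⟩ := exists_between hu
  have hev := eventually_lt_of_lt_liminf hc ⟨0, by simpa using ⟨0, fun q _ => hf0 q⟩⟩
  obtain ⟨Q, hQ⟩ := eventually_atTop.1 hev
  have hirr : ∀ q : ℕ, 0 < q → ∀ r : ℤ, (q : ℝ) * u ≠ r := by
    intro q hq r hr
    have h1 := hQ (q * (Q + 1)) (by nlinarith)
    have h2 := nearestIntDist_le (((q * (Q + 1) : ℕ) : ℝ) * u) (r * (Q + 1))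
    rw [show ((q * (Q + 1) : ℕ) : ℝ) * u - ((r * (Q + 1) : ℤ) : ℝ) = 0 by
      push_cast; rw [← hr]; ring, abs_zero] at h2
    have h3 : f (q * (Q + 1)) = 0 := by
      simp only [hf]
      rw [le_antisymm h2 (nearestIntDist_nonneg _), mul_zero]
    linarith
  have hpos : ∀ q : ℕ, 0 < q → 0 < f q := fun q hq =>
    mul_pos (mul_pos (by exact_mod_cast hq) (aAdicNorm_pos ha (by exact_mod_cast hq)))
      (nearestIntDist_pos (hirr q hq))
  have hmin : ∀ K : ℕ, ∃ ε : ℝ, 0 < ε ∧ ∀ q : ℕ, 0 < q → q < K → ε ≤ f q := by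
    intro K
    induction K with
    | zero => exact ⟨1, one_pos, by intro q _ h; omega⟩
    | succ K ih =>
      obtain ⟨ε, h1, h2⟩ := ih
      rcases Nat.eq_zero_or_pos K with rfl | hK
      · exact ⟨1, one_pos, by intro q _ h; omega⟩
      · refine ⟨min ε (f K), lt_min h1 (hpos K hK), fun q hq hqK => ?_⟩
        rcases Nat.lt_succ_iff_lt_or_eq.1 hqK with h | rfl
        · exact (min_le_left _ _).trans (h2 q hq h)
        · exact min_le_right _ _
  obtain ⟨ε, hε, hεQ⟩ := hmin Q
  refine ⟨min ε c, lt_min hε hc0, fun l q hq r => ?_⟩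
  obtain ⟨q, rfl⟩ := Int.eq_ofNat_of_zero_le hq.le
  have hq' : 0 < q := by exact_mod_cast hq
  have hal : 0 < a ^ l := pow_pos (by omega) l
  have halR : (0 : ℝ) < (a : ℝ) ^ l := by exact_mod_cast hal
  have hle : min ε c ≤ f (a ^ l * q) := by
    rcases lt_or_ge (a ^ l * q) Q with h | h
    · exact (min_le_left _ _).trans (hεQ _ (Nat.mul_pos hal hq') h)
    · exact (min_le_right _ _).trans (hQ _ h).le
  refine hle.trans ?_
  have h1 : aAdicNorm a ((a ^ l * q : ℕ) : ℤ) ≤ ((a : ℝ) ^ l)⁻¹ :=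
    aAdicNorm_le ⟨q, by push_cast; ring⟩
  have h2 := nearestIntDist_le (((a ^ l * q : ℕ) : ℝ) * u) r
  calc f (a ^ l * q) ≤ ((a ^ l * q : ℕ) : ℝ) * ((a : ℝ) ^ l)⁻¹ *
        |((a ^ l * q : ℕ) : ℝ) * u - r| := by
        simp only [hf]
        exact mul_le_mul (mul_le_mul_of_nonneg_left h1 (Nat.cast_nonneg _)) h2
          (nearestIntDist_nonneg _) (by positivity)
    _ = ((q : ℤ) : ℝ) * |((q : ℤ) : ℝ) * ((a : ℝ) ^ l * u) - r| := by
        push_cast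
        rw [show (a : ℝ) ^ l * q * ((a : ℝ) ^ l)⁻¹ = q by field_simp,
          show (a : ℝ) ^ l * q * u = q * ((a : ℝ) ^ l * u) by ring]

end reduction

end PAdicLittlewood

/-- For an integer `a ≥ 2`, the set of `u ∈ ℝ` with `liminf_{q → ∞} q·|q|_a·⟨qu⟩ > 0` has
Hausdorff dimension zero. -/
theorem dimH_set_liminf_aAdic_pos_eq_zero (a : ℕ) (ha : 2 ≤ a) :
    dimH {u : ℝ |
      0 < Filter.liminf
        (fun q : ℕ => (q : ℝ) * aAdicNorm a (q : ℤ) * nearestIntDist ((q : ℝ) * u))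
        Filter.atTop} = 0 := by
  have hsub : {u : ℝ | 0 < Filter.liminf (fun q : ℕ => (q : ℝ) * aAdicNorm a (q : ℤ) *
      nearestIntDist ((q : ℝ) * u)) Filter.atTop} ⊆
      ⋃ k : ℕ, PAdicLittlewood.uniformlyBad a (1 / (k + 1)) := by
    intro u hu
    obtain ⟨ε, hε, hmem⟩ := PAdicLittlewood.exists_mem_uniformlyBad ha hu
    obtain ⟨k, hk⟩ := exists_nat_one_div_lt hε
    exact Set.mem_iUnion.2 ⟨k, fun l => (hmem l).mono hk.le⟩
  refine nonpos_iff_eq_zero.1 ((dimH_mono hsub).trans ?_)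
  rw [dimH_iUnion]
  refine iSup_le fun k => (PAdicLittlewood.dimH_uniformlyBad ha (by positivity) ?_).le
  rw [div_le_one (by positivity)]
  linarith [(Nat.cast_nonneg k : (0 : ℝ) ≤ k)]
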